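/- arXiv:1705.02066 — 7 statements merged into one kernel-verified Lean document; each statement's English description precedes it below -/
import Mathlib

section
/- Let Γ be a primitive strongly regular graph with eigenvalues k, e⁺, e⁻ (multiplicity m⁻ of e⁻) satisfying v·e⁻ = m⁻(e⁻ − k). If e⁺ and e⁻ are coprime (as integers) and e⁺ > 1, then Γ contains at most two distinct Delsarte cocliques. -/
/-- `Y` is a coclique (independent set) in the graph `G`. -/
def IsCoclique {V : Type*} (G : SimpleGraph V) (Y : Finset V) : Prop :=
  ∀ x ∈ Y, ∀ y ∈ Y, ¬ G.Adj x y

/-- `Y` is a Delsarte coclique: an independent set whose size equals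
`v * e⁻ / (e⁻ - k)`, i.e. meeting Hoffman's ratio bound with equality. -/
def IsDelsarteCoclique {V : Type*} (G : SimpleGraph V) (v k : ℕ) (eN : ℤ)
    (Y : Finset V) : Prop :=
  IsCoclique G Y ∧ (Y.card : ℤ) * (eN - (k : ℤ)) = (v : ℤ) * eN

open Matrix

theorem card_sdiff_union_add_card_inter_sdiff {α : Type*} [DecidableEq α] (X Y Z : Finset α) :
    (X \ (Y ∪ Z)).card + ((X ∩ Z) \ Y).card = (X \ Y).card := by
  rw [← Finset.card_union_of_disjoint (Finset.disjoint_left.2 (by grind))]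
  congr 1
  grind

section

variable {V R : Type*} [Fintype V] [DecidableEq V] [CommRing R] [LinearOrder R]
  [IsStrictOrderedRing R]

theorem sum_adj_eq_of_ratio_bound {A : Matrix V V R} (hA : A.IsSymm) {r s k m : R}
    (hsq : A * A = (r - s) • A + (r * s) • 1 + m • vecMulVec 1 1) (hreg : A *ᵥ 1 = k • 1)
    (hk : k = m + r * s) (hks : k + s ≠ 0) {Y : Finset V} (hY : ∀ x ∈ Y, ∀ y ∈ Y, A x y = 0)
    (hcard : (Y.card : R) * (k + s) = Fintype.card V * s)
    (hv : (Fintype.card V : R) * m = (k - r) * (k + s)) {p : V} (hp : p ∉ Y) :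
    ∑ y ∈ Y, A p y = s := by
  set χ : V → R := fun x => if x ∈ Y then 1 else 0 with hχ
  have h1 : (1 : V → R) ⬝ᵥ χ = Y.card := by simp [hχ, dotProduct]
  have h2 : χ ⬝ᵥ χ = Y.card := by simp [hχ, dotProduct]
  have h11 : (1 : V → R) ⬝ᵥ 1 = Fintype.card V := by simp [dotProduct]
  have h3 : χ ⬝ᵥ (A *ᵥ χ) = 0 := by
    simp only [dotProduct, mulVec, hχ, ite_mul, one_mul, zero_mul, mul_ite, mul_one, mul_zero,
      Finset.sum_ite_mem, Finset.univ_inter]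
    exact Finset.sum_eq_zero fun x hx => Finset.sum_eq_zero fun y hy => hY x hx y hy
  have h4 : (1 : V → R) ⬝ᵥ (A *ᵥ χ) = k * Y.card := by
    rw [dotProduct_mulVec, ← mulVec_transpose, hA, hreg, smul_dotProduct, h1, smul_eq_mul]
  have h5 : (A *ᵥ χ) ⬝ᵥ (A *ᵥ χ) = r * s * Y.card + m * Y.card ^ 2 := by
    have : (A *ᵥ χ) ⬝ᵥ (A *ᵥ χ) = χ ⬝ᵥ ((A * A) *ᵥ χ) := by
      rw [dotProduct_mulVec, ← mulVec_transpose, hA, mulVec_mulVec, dotProduct_comm]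
    rw [this, hsq]
    simp only [add_mulVec, smul_mulVec, one_mulVec, dotProduct_add, dotProduct_smul, h3, h2,
      vecMulVec_mulVec, h1]
    simp only [op_smul_eq_smul, h1, smul_eq_mul, dotProduct_comm χ 1]
    ring
  have hm : m * Y.card = s * (k - r) := by
    apply mul_right_cancel₀ hks
    linear_combination m * hcard + s * hv
  have hw : (A *ᵥ χ + s • χ - s • 1) ⬝ᵥ (A *ᵥ χ + s • χ - s • 1) = 0 := by
    simp only [dotProduct_add, add_dotProduct, dotProduct_sub, sub_dotProduct, dotProduct_smul,
      smul_dotProduct, h1, h2, h3, h4, h5, h11, dotProduct_comm χ 1, dotProduct_comm (A *ᵥ χ) χ,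
      dotProduct_comm (A *ᵥ χ) 1, smul_eq_mul]
    subst hk
    linear_combination (Y.card : R) * hm - s * hcard
  have := congrFun (dotProduct_self_eq_zero.1 hw) p
  simp [hχ, mulVec, dotProduct, hp] at this
  linarith

/-- Outside a coclique meeting the ratio bound, the numbers of common neighbours inside the coclique
are determined: the rank-one-corrected Gram matrix `E` below satisfies `E * E = -(r * (r + s)) • E`
and has zero diagonal outside `Y`, so its rows there vanish. -/
theorem sum_adj_mul_adj_of_ratio_bound {A : Matrix V V R} (hA : A.IsSymm) {r s k m : R}
    (hsq : A * A = (r - s) • A + (r * s) • 1 + m • vecMulVec 1 1) (hreg : A *ᵥ 1 = k • 1)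
    (hdiag : ∀ x, A x x = 0) (h01 : ∀ x y, A x y * A x y = A x y)
    {Y : Finset V} (hY : ∀ x ∈ Y, ∀ y ∈ Y, A x y = 0)
    (hout : ∀ p ∉ Y, ∑ y ∈ Y, A p y = s)
    (hxk : (s - r ^ 2) * k = m * (r + s))
    (hxv : (s - r ^ 2) * (Fintype.card V - Y.card) = (k - r) * (r + s))
    {p q : V} (hp : p ∉ Y) (hq : q ∉ Y) :
    ∑ y ∈ Y, A p y * A q y = r ^ 2 * (if p = q then 1 else 0) - r * A p q + (s - r ^ 2) := by
  set χ : V → R := fun x => if x ∈ Y then 1 else 0 with hχ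
  set ψ : V → R := 1 - χ with hψ
  have hAχ : A *ᵥ χ = s • ψ := by
    ext x
    by_cases hx : x ∈ Y
    · simp [hψ, hχ, mulVec, dotProduct, hx]
      exact Finset.sum_eq_zero fun y hy => hY x hx y hy
    · simpa [hψ, hχ, mulVec, dotProduct, hx] using hout x hx
  set K : Matrix V V R := A - r • 1 with hK
  have hKT : Kᵀ = K := by simp [hK, hA.eq]
  set D : Matrix V V R := diagonal χ with hD
  have hKK : K * K = m • vecMulVec 1 1 - (r + s) • K := by
    simp only [hK, sub_mul, mul_sub, hsq, smul_mul_assoc, mul_smul_comm, one_mul, mul_one]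
    module
  have hDKD : D * (K * D) = -r • D := by
    ext x y
    by_cases hxy : x = y
    · subst hxy
      by_cases hx : x ∈ Y <;> simp [hD, hK, hχ, diagonal_mul, mul_diagonal, hx, hdiag]
    · by_cases hx : x ∈ Y <;> by_cases hy : y ∈ Y <;>
        simp [hD, hK, hχ, diagonal_mul, mul_diagonal, hx, hy, hxy, hY]
  have hKψ : K *ᵥ ψ = k • 1 - (r + s) • ψ := by
    rw [hK, sub_mulVec, smul_mulVec, one_mulVec]
    conv_lhs => rw [hψ, mulVec_sub, hAχ, hreg, ← hψ]
    module
  have hKχ : K *ᵥ χ = -r • 1 + (r + s) • ψ := by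
    rw [hK, sub_mulVec, smul_mulVec, one_mulVec, hAχ, hψ]; module
  have hD1 : D *ᵥ 1 = χ := by ext x; simp [hD, mulVec_diagonal]
  have hDψ : D *ᵥ ψ = 0 := by
    ext x; by_cases hx : x ∈ Y <;> simp [hD, hψ, hχ, mulVec_diagonal, hx]
  have hψψ : ψ ⬝ᵥ ψ = Fintype.card V - Y.card := by
    have e1 : (1 : V → R) ⬝ᵥ χ = Y.card := by simp [hχ, dotProduct]
    have e2 : χ ⬝ᵥ χ = Y.card := by simp [hχ, dotProduct]
    have e3 : (1 : V → R) ⬝ᵥ 1 = Fintype.card V := by simp [dotProduct]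
    rw [hψ, sub_dotProduct, dotProduct_sub, dotProduct_sub, dotProduct_comm χ 1, e1, e2, e3]
    ring
  have hQK : vecMulVec ψ ψ * K = k • vecMulVec ψ 1 - (r + s) • vecMulVec ψ ψ := by
    rw [vecMulVec_mul, ← mulVec_transpose, hKT, hKψ]
    simp [vecMulVec_sub, vecMulVec_smul]
  have hKDJ : K * (D * vecMulVec 1 1) =
      -r • vecMulVec 1 1 + (r + s) • vecMulVec ψ (1 : V → R) := by
    rw [mul_vecMulVec, mul_vecMulVec, hD1, hKχ, add_vecMulVec, smul_vecMulVec, smul_vecMulVec]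
  have hQD : vecMulVec ψ ψ * D = 0 := by
    rw [vecMulVec_mul, ← mulVec_transpose, hD, diagonal_transpose, ← hD, hDψ, vecMulVec_zero]
  set E : Matrix V V R := r • K + K * (D * K) - (s - r ^ 2) • vecMulVec ψ ψ with hE
  have hEK : E * K = -(r + s) • E := by
    simp only [hE, sub_mul, add_mul, smul_mul_assoc, mul_assoc, hKK, hQK, mul_sub, mul_smul_comm,
      hKDJ]
    linear_combination (norm := module) (-hxk) • vecMulVec ψ (1 : V → R)
  have hED : E * D = 0 := by
    simp only [hE, sub_mul, add_mul, smul_mul_assoc, mul_assoc, hDKD, hQD, mul_smul_comm]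
    module
  have hEψ : E *ᵥ ψ = 0 := by
    have : K *ᵥ (D *ᵥ (K *ᵥ ψ)) = k • (-r • 1 + (r + s) • ψ) := by
      rw [hKψ, mulVec_sub, mulVec_smul, mulVec_smul, hD1, hDψ, smul_zero, sub_zero, mulVec_smul,
        hKχ]
    simp only [hE, sub_mulVec, add_mulVec, smul_mulVec, ← mulVec_mulVec, this, vecMulVec_mulVec,
      hψψ]
    rw [hKψ]
    ext x
    simp
    linear_combination -ψ x * hxv
  have hEE : E * E = -(r * (r + s)) • E := by
    have e : E * E = r • (E * K) + E * K * D * K - (s - r ^ 2) • vecMulVec (E *ᵥ ψ) ψ := by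
      rw [← mul_vecMulVec]
      simp only [mul_assoc, ← mul_smul_comm, ← mul_add, ← mul_sub]
      rfl
    rw [e, hEK, hEψ, smul_mul_assoc, smul_mul_assoc, hED, zero_mul, zero_vecMulVec]
    module
  have hET : Eᵀ = E := by
    simp [hE, transpose_mul, hKT, hD, transpose_vecMulVec, mul_assoc]
  have hent : ∀ x ∉ Y, ∀ y ∉ Y, E x y =
      r * A x y - r ^ 2 * (if x = y then 1 else 0) + ∑ u ∈ Y, A x u * A y u - (s - r ^ 2) := by
    intro x hx y hy
    have h2 : (K * (D * K)) x y = ∑ u ∈ Y, A x u * A y u := by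
      rw [mul_apply]
      simp only [hD, diagonal_mul, hχ, ite_mul, one_mul, zero_mul, mul_ite, mul_zero,
        Finset.sum_ite_mem, Finset.univ_inter]
      refine Finset.sum_congr rfl fun u hu => ?_
      have hxu : x ≠ u := fun h => hx (h ▸ hu)
      have huy : u ≠ y := fun h => hy (h ▸ hu)
      simp [hK, one_apply, hxu, huy, hA.apply]
    rw [hE, Matrix.sub_apply, Matrix.add_apply, h2]
    simp only [hK, hψ, hχ, hx, hy, one_apply, vecMulVec_apply, Matrix.smul_apply,
      Matrix.sub_apply, smul_eq_mul, Pi.sub_apply, Pi.one_apply, if_false]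
    ring
  have hEpp : E p p = 0 := by
    rw [hent p hp p hp]
    simp [h01, hout p hp, hdiag]
    ring
  have hrow : E p ⬝ᵥ E p = 0 := by
    have := congrFun (congrFun hEE p) p
    rw [Matrix.smul_apply, hEpp, smul_zero, mul_apply] at this
    rw [← this]
    exact Finset.sum_congr rfl fun u _ =>
      congrArg (E p u * ·) (congrFun (congrFun hET u) p)
  have := congrFun (dotProduct_self_eq_zero.1 hrow) q
  rw [hent p hp q hq] at this
  simp only [Pi.zero_apply] at this
  linarith

end

section

variable {V R : Type*} [DecidableEq V] [CommRing R]

theorem sum_sdiff_adj_relation {A : Matrix V V R} (hA : A.IsSymm) {r s d : R} {Y Z : Finset V}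
    (hY : ∀ x ∈ Y, ∀ y ∈ Y, A x y = 0) (hZ : ∀ x ∈ Z, ∀ y ∈ Z, A x y = 0)
    (hZout : ∀ p ∉ Z, ∑ z ∈ Z, A p z = s)
    (hint : ∀ p ∉ Y, ∀ q ∉ Y,
      ∑ y ∈ Y, A p y * A q y = r ^ 2 * (if p = q then 1 else 0) - r * A p q + d)
    {p : V} (hp : p ∉ Y) :
    r ^ 2 * (if p ∈ Z then 1 else 0) - r * ∑ z ∈ Z \ Y, A p z + d * (Z \ Y).card =
      s * ∑ y ∈ Y \ Z, A p y := by
  have hcol : ∀ y ∈ Y, ∑ z ∈ Z \ Y, A z y = if y ∈ Z then 0 else s := by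
    intro y hy
    split_ifs with hyZ
    · exact Finset.sum_eq_zero fun z hz => hZ z (Finset.mem_sdiff.1 hz).1 y hyZ
    · rw [← hZout y hyZ, ← Finset.sum_sdiff (Finset.inter_subset_left (s₁ := Z) (s₂ := Y)),
        Finset.sdiff_inter_self_left,
        Finset.sum_eq_zero (s := Z ∩ Y) (f := A y) fun z hz => hY y hy z (Finset.mem_inter.1 hz).2,
        add_zero]
      exact Finset.sum_congr rfl fun z _ => hA.apply y z
  have h1 : ∑ z ∈ Z \ Y, ∑ y ∈ Y, A p y * A z y = s * ∑ y ∈ Y \ Z, A p y := by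
    rw [Finset.sum_comm, ← Finset.sum_sdiff (Finset.inter_subset_left (s₁ := Y) (s₂ := Z)),
      Finset.sdiff_inter_self_left]
    simp only [← Finset.mul_sum]
    have h0 : ∑ y ∈ Y ∩ Z, A p y * ∑ z ∈ Z \ Y, A z y = 0 := Finset.sum_eq_zero fun y hy => by
      rw [hcol y (Finset.mem_inter.1 hy).1, if_pos (Finset.mem_inter.1 hy).2, mul_zero]
    rw [h0, add_zero, Finset.mul_sum]
    refine Finset.sum_congr rfl fun y hy => ?_
    rw [hcol y (Finset.mem_sdiff.1 hy).1, if_neg (Finset.mem_sdiff.1 hy).2, mul_comm]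
  have h2 : ∑ z ∈ Z \ Y, ∑ y ∈ Y, A p y * A z y =
      ∑ z ∈ Z \ Y, (r ^ 2 * (if p = z then 1 else 0) - r * A p z + d) :=
    Finset.sum_congr rfl fun z hz => hint p hp z (Finset.mem_sdiff.1 hz).2
  rw [← h1, h2]
  simp [Finset.sum_add_distrib, Finset.sum_sub_distrib, ← Finset.mul_sum, hp, mul_comm]

theorem mul_card_sdiff_eq {A : Matrix V V R} (hA : A.IsSymm) {r s d : R} {Y Z : Finset V}
    (hY : ∀ x ∈ Y, ∀ y ∈ Y, A x y = 0) (hZ : ∀ x ∈ Z, ∀ y ∈ Z, A x y = 0)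
    (hYout : ∀ p ∉ Y, ∑ y ∈ Y, A p y = s) (hZout : ∀ p ∉ Z, ∑ z ∈ Z, A p z = s)
    (hint : ∀ p ∉ Y, ∀ q ∉ Y,
      ∑ y ∈ Y, A p y * A q y = r ^ 2 * (if p = q then 1 else 0) - r * A p q + d)
    (hne : (Z \ Y).Nonempty) :
    d * (Z \ Y).card = s ^ 2 - r ^ 2 := by
  obtain ⟨p, hp⟩ := hne
  obtain ⟨hpZ, hpY⟩ := Finset.mem_sdiff.1 hp
  have h := sum_sdiff_adj_relation hA hY hZ hZout hint hpY
  have h1 := hYout p hpY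
  rw [← Finset.sum_sdiff (Finset.inter_subset_left (s₁ := Y) (s₂ := Z)),
    Finset.sdiff_inter_self_left,
    Finset.sum_eq_zero fun z hz => hZ p hpZ z (Finset.mem_inter.1 hz).2, add_zero] at h1
  rw [h1, if_pos hpZ, Finset.sum_eq_zero fun z hz => hZ p hpZ z (Finset.mem_sdiff.1 hz).1] at h
  linear_combination h

theorem sum_inter_adj_eq [IsDomain R] {A : Matrix V V R} (hA : A.IsSymm) {r s d : R}
    {Y Z : Finset V} (hrs : r + s ≠ 0)
    (hY : ∀ x ∈ Y, ∀ y ∈ Y, A x y = 0) (hZ : ∀ x ∈ Z, ∀ y ∈ Z, A x y = 0)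
    (hYout : ∀ p ∉ Y, ∑ y ∈ Y, A p y = s) (hZout : ∀ p ∉ Z, ∑ z ∈ Z, A p z = s)
    (hint : ∀ p ∉ Y, ∀ q ∉ Y,
      ∑ y ∈ Y, A p y * A q y = r ^ 2 * (if p = q then 1 else 0) - r * A p q + d)
    (hne : (Z \ Y).Nonempty) {p : V} (hpY : p ∉ Y) (hpZ : p ∉ Z) :
    ∑ y ∈ Y ∩ Z, A p y = r := by
  have h := sum_sdiff_adj_relation hA hY hZ hZout hint hpY
  have hn := mul_card_sdiff_eq hA hY hZ hYout hZout hint hne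
  have h1 := hYout p hpY
  have h2 := hZout p hpZ
  rw [← Finset.sum_sdiff (Finset.inter_subset_left (s₁ := Y) (s₂ := Z)),
    Finset.sdiff_inter_self_left] at h1
  rw [← Finset.sum_sdiff (Finset.inter_subset_right (s₁ := Y) (s₂ := Z)),
    Finset.sdiff_inter_self_right] at h2
  rw [if_neg hpZ, hn] at h
  apply mul_left_cancel₀ hrs
  linear_combination h + s * h1 + r * h2

/-- Double counting of the edges between `(Y ∩ Z) \ X` and `X \ (Y ∪ Z)` for three cocliques. -/
theorem card_inter_sdiff_mul_eq {A : Matrix V V R} (hA : A.IsSymm) {r s : R}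
    {X Y Z : Finset V} (hX : ∀ x ∈ X, ∀ y ∈ X, A x y = 0) (hY : ∀ x ∈ Y, ∀ y ∈ Y, A x y = 0)
    (hZ : ∀ x ∈ Z, ∀ y ∈ Z, A x y = 0)
    (hXout : ∀ p ∉ X, ∑ x ∈ X, A p x = s)
    (hYZ : ∀ p ∉ Y, p ∉ Z → ∑ y ∈ Y ∩ Z, A p y = r)
    (hn : (Z \ Y).card = (Z \ X).card) :
    (((Y ∩ Z) \ X).card : R) * (r + s) = r * (X \ Y).card := by
  have h1 : ∀ p ∈ (Y ∩ Z) \ X, ∑ x ∈ X \ (Y ∪ Z), A p x = s := by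
    intro p hp
    obtain ⟨hpYZ, hpX⟩ := Finset.mem_sdiff.1 hp
    obtain ⟨hpY, hpZ⟩ := Finset.mem_inter.1 hpYZ
    rw [← hXout p hpX]
    refine Finset.sum_subset Finset.sdiff_subset fun x hx hx' => ?_
    have : x ∈ Y ∪ Z := by by_contra h; exact hx' (Finset.mem_sdiff.2 ⟨hx, h⟩)
    rcases Finset.mem_union.1 this with h | h
    exacts [hY p hpY x h, hZ p hpZ x h]
  have h2 : ∀ x ∈ X \ (Y ∪ Z), ∑ p ∈ (Y ∩ Z) \ X, A p x = r := by
    intro x hx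
    obtain ⟨hxX, hxYZ⟩ := Finset.mem_sdiff.1 hx
    rw [Finset.mem_union, not_or] at hxYZ
    rw [← hYZ x hxYZ.1 hxYZ.2, Finset.sum_congr rfl fun p _ => hA.apply x p]
    refine Finset.sum_subset Finset.sdiff_subset fun p hp hp' => hX x hxX p ?_
    by_contra h; exact hp' (Finset.mem_sdiff.2 ⟨hp, h⟩)
  have h3 : (((Y ∩ Z) \ X).card : R) * s = (X \ (Y ∪ Z)).card * r := by
    rw [← nsmul_eq_mul, ← nsmul_eq_mul, ← Finset.sum_const, ← Finset.sum_const,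
      ← Finset.sum_congr rfl h1, ← Finset.sum_congr rfl h2, Finset.sum_comm]
  have h4 : (X \ (Y ∪ Z)).card + ((Y ∩ Z) \ X).card = (X \ Y).card := by
    have e1 := card_sdiff_union_add_card_inter_sdiff X Y Z
    have e2 := card_sdiff_union_add_card_inter_sdiff Z Y X
    have e3 := card_sdiff_union_add_card_inter_sdiff Z X Y
    rw [Finset.inter_comm Z X, Finset.union_comm Y X] at e2
    rw [Finset.inter_comm Z Y] at e3
    omega
  rw [← h4]
  push_cast
  linear_combination h3

end

theorem eigenvalue_le_one_of_card_relations {r s n f : ℤ} (hr : 0 ≤ r) (hs : 0 < s)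
    (hcop : IsCoprime r s) (hd : r ≤ s - r ^ 2) (hn : (s - r ^ 2) * n = s ^ 2 - r ^ 2)
    (hf : f * (r + s) = r * n) : r ≤ 1 := by
  have hc : IsCoprime (r + s) r := by
    have := hcop.symm.add_mul_left_left 1
    rwa [mul_one, add_comm] at this
  obtain ⟨j, rfl⟩ : r + s ∣ n := hc.dvd_of_dvd_mul_left ⟨f, by linear_combination -hf⟩
  have hj : (s - r ^ 2) * j = s - r := by
    apply mul_left_cancel₀ (show r + s ≠ 0 by omega)
    linear_combination hn
  have hdr : IsCoprime (s - r ^ 2) r := by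
    have := hcop.symm.add_mul_left_left (-r)
    rwa [show s + r * -r = s - r ^ 2 by ring] at this
  have hdvd : s - r ^ 2 ∣ r - 1 :=
    hdr.dvd_of_dvd_mul_left ⟨j - 1, by linear_combination -hj⟩
  by_contra! h
  have := Int.le_of_dvd (by omega) hdvd
  omega

theorem SimpleGraph.IsSRGWith.adjMatrix_mul_self {V : Type*} [Fintype V] [DecidableEq V]
    {G : SimpleGraph V} [DecidableRel G.Adj] {v k l m : ℕ} (h : G.IsSRGWith v k l m) :
    G.adjMatrix ℤ * G.adjMatrix ℤ =
      ((l : ℤ) - m) • G.adjMatrix ℤ + ((k : ℤ) - m) • 1 + (m : ℤ) • vecMulVec 1 1 := by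
  rw [← pow_two, h.matrix_eq]
  ext x y
  simp only [Matrix.add_apply, Matrix.smul_apply, SimpleGraph.adjMatrix_apply, one_apply,
    vecMulVec_apply, SimpleGraph.compl_adj, smul_eq_mul, Pi.one_apply]
  by_cases hxy : x = y
  · subst hxy; simp
  · by_cases ha : G.Adj x y <;> simp [hxy, ha]

theorem srg_coprime_eigenvalues_at_most_two_delsarte_cocliques
    {V : Type*} [Fintype V] [DecidableEq V] (G : SimpleGraph V) [DecidableRel G.Adj]
    (v k l m : ℕ) (eP eN : ℤ) (mN : ℕ)
    (hsrg : G.IsSRGWith v k l m)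
    (hconn : G.Connected) (hconnCompl : Gᶜ.Connected)
    (heP : 0 ≤ eP) (heN : eN < 0)
    (hProot : eP ^ 2 - ((l : ℤ) - (m : ℤ)) * eP - ((k : ℤ) - (m : ℤ)) = 0)
    (hNroot : eN ^ 2 - ((l : ℤ) - (m : ℤ)) * eN - ((k : ℤ) - (m : ℤ)) = 0)
    (hmult : (mN : ℚ) = (v : ℚ) - 1 -
      ((eN : ℚ) + 1) * (k : ℚ) * ((k : ℚ) - (eN : ℚ)) / ((m : ℚ) * ((eN : ℚ) - (eP : ℚ))))
    (hbound : (v : ℤ) * eN = (mN : ℤ) * (eN - (k : ℤ)))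
    (hcop : IsCoprime eP eN) (hePgt : 1 < eP) :
    {Y : Finset V | IsDelsarteCoclique G v k eN Y}.ncard ≤ 2 := by
  obtain ⟨s, rfl⟩ : ∃ s, eN = -s := ⟨-eN, by ring⟩
  set r := eP
  have hs : 0 < s := by linarith
  have hl : (l : ℤ) - m = r - s := by
    apply mul_left_cancel₀ (show r + s ≠ 0 by omega)
    linear_combination hNroot - hProot
  have hk : (k : ℤ) = m + r * s := by
    linear_combination -hProot - r * hl
  have hrs : 0 < r * s := by positivity
  have hks : 0 < (k : ℤ) + s := by positivity
  have hcardV : Fintype.card V = v := hsrg.card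
  have hvpos : 0 < v := by
    rw [← hcardV]; exact Fintype.card_pos_iff.2 hconn.nonempty
  have hsq : G.adjMatrix ℤ * G.adjMatrix ℤ =
      (r - s) • G.adjMatrix ℤ + (r * s) • 1 + (m : ℤ) • vecMulVec 1 1 := by
    rw [hsrg.adjMatrix_mul_self, hl, show (k : ℤ) - m = r * s by linarith]
  have hreg : G.adjMatrix ℤ *ᵥ 1 = (k : ℤ) • 1 := by
    ext x
    simp [hsrg.regular x]
  have hv : (v : ℤ) * m = (k - r) * (k + s) := by
    have h1 := congrArg (· *ᵥ (1 : V → ℤ)) hsq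
    obtain ⟨x⟩ := hconn.nonempty
    have h2 := congrFun h1 x
    simp only [← mulVec_mulVec, add_mulVec, smul_mulVec, hreg, mulVec_smul, one_mulVec,
      vecMulVec_mulVec] at h2
    simp [dotProduct, hcardV] at h2
    linear_combination -h2
  have hm : 0 < (m : ℤ) := by
    rcases Nat.eq_zero_or_pos m with rfl | h
    · simp only [Nat.cast_zero, zero_mul, div_zero, sub_zero] at hmult
      have h1 : (mN : ℤ) = v - 1 := by exact_mod_cast hmult
      rw [h1, hk] at hbound
      have h2 : s * (((v : ℤ) - 1) * r - 1) = 0 := by push_cast at hbound; linear_combination hbound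
      have h3 : ((v : ℤ) - 1) * r = 1 := by
        rcases mul_eq_zero.1 h2 with h | h <;> linarith
      have := Int.eq_one_or_neg_one_of_mul_eq_one' h3
      omega
    · exact_mod_cast h
  have hkr : 0 < (k : ℤ) - r := by nlinarith
  have hmult' : (mN : ℤ) * (m * (r + s)) = (v - 1) * (m * (r + s)) - (s - 1) * k * (k + s) := by
    have h0 : (m : ℚ) * (((-s : ℤ) : ℚ) - (r : ℚ)) ≠ 0 := by
      have : (m : ℤ) * (-s - r) ≠ 0 := mul_ne_zero hm.ne' (by linarith)
      exact_mod_cast this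
    have h1 : (mN : ℤ) * (m * (-s - r)) = (v - 1) * (m * (-s - r)) - (-s + 1) * k * (k - -s) := by
      have : (mN : ℚ) * (m * (((-s : ℤ) : ℚ) - r)) =
          (v - 1) * (m * (((-s : ℤ) : ℚ) - r)) - (((-s : ℤ) : ℚ) + 1) * k * (k - ((-s : ℤ) : ℚ)) := by
        rw [hmult, sub_mul, div_mul_cancel₀ _ h0]
      exact_mod_cast this
    linear_combination -h1
  have hksr : (k : ℤ) * (r + 1) = s * (r + s) := by
    have h1 : (mN : ℤ) * (r + s) = r * v + k - r := by
      apply mul_left_cancel₀ hm.ne'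
      linear_combination hmult' + s * hv + (k + s) * hk
    have h2 : (mN : ℤ) * m = s * (k - r) := by
      apply mul_right_cancel₀ hks.ne'
      linear_combination s * hv + m * hbound
    apply mul_left_cancel₀ hkr.ne'
    linear_combination (r + s) * h2 - m * h1 - r * hv + (k - r) * hk
  have hxk : (s - r ^ 2) * k = m * (r + s) := by
    linear_combination -r * hksr + (r + s) * hk
  have hd : 0 < s - r ^ 2 := by
    have : 0 < (k : ℤ) := by linarith
    refine pos_of_mul_pos_left (b := (k : ℤ)) ?_ this.le
    rw [hxk]; positivity
  have hcoc : ∀ Y, IsDelsarteCoclique G v k (-s) Y → ∀ x ∈ Y, ∀ y ∈ Y, G.adjMatrix ℤ x y = 0 := by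
    intro Y hY x hx y hy
    simp [hY.1 x hx y hy]
  have hcard : ∀ Y, IsDelsarteCoclique G v k (-s) Y → (Y.card : ℤ) * (k + s) = v * s := by
    intro Y hY
    linear_combination -hY.2
  have hA : (G.adjMatrix ℤ).IsSymm := G.isSymm_adjMatrix
  have hout : ∀ Y, IsDelsarteCoclique G v k (-s) Y → ∀ p ∉ Y, ∑ y ∈ Y, G.adjMatrix ℤ p y = s :=
    fun Y hY p hp => sum_adj_eq_of_ratio_bound hA hsq hreg hk hks.ne' (hcoc Y hY)
      (by rw [hcardV]; exact hcard Y hY) (by rw [hcardV]; exact hv) hp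
  have hint : ∀ Y, IsDelsarteCoclique G v k (-s) Y → ∀ p ∉ Y, ∀ q ∉ Y,
      ∑ y ∈ Y, G.adjMatrix ℤ p y * G.adjMatrix ℤ q y =
        r ^ 2 * (if p = q then 1 else 0) - r * G.adjMatrix ℤ p q + (s - r ^ 2) := by
    intro Y hY p hp q hq
    refine sum_adj_mul_adj_of_ratio_bound hA hsq hreg (by simp) (by simp) (hcoc Y hY)
      (hout Y hY) hxk ?_ hp hq
    rw [hcardV]
    apply mul_right_cancel₀ hks.ne'
    linear_combination -(s - r ^ 2) * hcard Y hY + v * hxk + (r + s) * hv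
  have hne : ∀ Y Z, IsDelsarteCoclique G v k (-s) Y → IsDelsarteCoclique G v k (-s) Z → Y ≠ Z →
      (Z \ Y).Nonempty := by
    intro Y Z hY hZ hYZ
    have hc : Y.card = Z.card := by
      have := mul_right_cancel₀ hks.ne' ((hcard Y hY).trans (hcard Z hZ).symm)
      exact_mod_cast this
    rw [Finset.sdiff_nonempty]
    exact fun h => hYZ (Finset.eq_of_subset_of_card_le h hc.le).symm
  have hn : ∀ Y Z, IsDelsarteCoclique G v k (-s) Y → IsDelsarteCoclique G v k (-s) Z → Y ≠ Z →
      (s - r ^ 2) * (Z \ Y).card = s ^ 2 - r ^ 2 :=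
    fun Y Z hY hZ hYZ => mul_card_sdiff_eq hA (hcoc Y hY) (hcoc Z hZ) (hout Y hY) (hout Z hZ)
      (hint Y hY) (hne Y Z hY hZ hYZ)
  by_contra! hlt
  obtain ⟨X, hX, Y, hY, Z, hZ, hXY, hXZ, hYZ⟩ := (Set.two_lt_ncard (Set.toFinite _)).1 hlt
  have hdr : r ≤ s - r ^ 2 := by
    obtain ⟨p, hp⟩ := hne X Y hX hY hXY
    have hp := (Finset.mem_sdiff.1 hp).2
    obtain ⟨q, hq, hpq⟩ : ∃ q ∉ X, G.Adj p q := by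
      by_contra! h
      have h1 : ∑ y ∈ X, G.adjMatrix ℤ p y = k := by
        rw [Finset.sum_subset X.subset_univ fun q _ hq => by simp [h q hq]]
        simpa [mulVec, dotProduct] using congrFun hreg p
      rw [hout X hX p hp] at h1
      nlinarith
    have h1 := hint X hX p hp q hq
    have h2 : 0 ≤ ∑ y ∈ X, G.adjMatrix ℤ p y * G.adjMatrix ℤ q y :=
      Finset.sum_nonneg fun y _ => by simp only [SimpleGraph.adjMatrix_apply]; positivity
    simp only [hpq.ne, if_false, SimpleGraph.adjMatrix_apply, hpq, if_true] at h1 h2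
    linarith
  have hcardn : (Z \ Y).card = (Z \ X).card := by
    have := mul_left_cancel₀ hd.ne' ((hn Y Z hY hZ hYZ).trans (hn X Z hX hZ hXZ).symm)
    exact_mod_cast this
  have hf := card_inter_sdiff_mul_eq hA (hcoc X hX) (hcoc Y hY) (hcoc Z hZ) (hout X hX)
    (fun p hpY hpZ => sum_inter_adj_eq hA (by omega) (hcoc Y hY) (hcoc Z hZ) (hout Y hY)
      (hout Z hZ) (hint Y hY) (hne Y Z hY hZ hYZ) hpY hpZ) hcardn
  have := eigenvalue_le_one_of_card_relations heP hs (by simpa using hcop.neg_right) hdr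
    (hn Y X hY hX hXY.symm) hf
  omega
end

section
/- Let ṽ, k̃ be positive integers, let s be a nonnegative integer with s < k̃, and let 𝓑 be a family of k̃-element subsets of {1, …, ṽ} with |𝓑| = ṽ such that |b ∩ b'| ∈ {s, k̃} for all b, b' ∈ 𝓑 (so any two distinct blocks meet in exactly s points). Then the following are equivalent: (i) every point of {1, …, ṽ} lies in exactly k̃ blocks of 𝓑 and every pair of distinct points of {1, …, ṽ} lies in exactly s blocks of 𝓑 (i.e., 𝓑 is a symmetric 2-(ṽ, k̃, s) design); (ii) k̃(k̃ − 1) = s(ṽ − 1). -/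
/-- **Ryser's theorem**, matrix form: if `N` is square with `N * Nᵀ = (k - s) I + s J` and constant
row sums `k`, where `k ≠ 0` and `k ≠ s`, then `Nᵀ * N = (k - s) I + (s / k) J N`. -/
theorem Matrix.transpose_mul_apply_of_mul_transpose_apply {ι κ K : Type*} [Field K]
    [Fintype ι] [Fintype κ] [DecidableEq ι] [DecidableEq κ] (hc : Fintype.card ι = Fintype.card κ)
    {k s : K} (hk : k ≠ 0) (hks : k ≠ s) (N : Matrix ι κ K) (hrow : ∀ i, ∑ x, N i x = k)
    (hN : ∀ i j, ∑ x, N i x * N j x = if i = j then k else s) (x y : κ) :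
    ∑ i, N i x * N i y = (if x = y then k - s else 0) + s / k * ∑ i, N i y := by
  have hks' : k - s ≠ 0 := sub_ne_zero.mpr hks
  have hinv : N * Matrix.of (fun x i => (k - s)⁻¹ * (N i x - s / k)) = 1 := by
    ext i j
    have h : ∑ x, N i x * ((k - s)⁻¹ * (N j x - s / k)) =
        (k - s)⁻¹ * (∑ x, N i x * N j x - s / k * ∑ x, N i x) := by
      rw [Finset.mul_sum, ← Finset.sum_sub_distrib, Finset.mul_sum]
      exact Finset.sum_congr rfl fun x _ => by ring
    simp only [Matrix.mul_apply, Matrix.of_apply, h, hN, hrow, Matrix.one_apply]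
    split_ifs <;> field_simp
    ring
  replace hinv := (Matrix.mul_eq_one_comm_of_card_eq ι κ K hc).mp hinv
  have hxy := congrFun (congrFun hinv x) y
  have h : ∑ i, (k - s)⁻¹ * (N i x - s / k) * N i y =
      (k - s)⁻¹ * (∑ i, N i x * N i y - s / k * ∑ i, N i y) := by
    rw [Finset.mul_sum, ← Finset.sum_sub_distrib, Finset.mul_sum]
    exact Finset.sum_congr rfl fun i _ => by ring
  simp only [Matrix.mul_apply, Matrix.of_apply, h, Matrix.one_apply] at hxy
  rw [inv_mul_eq_iff_eq_mul₀ hks', sub_eq_iff_eq_add] at hxy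
  rw [hxy]
  split_ifs <;> ring

/-- As many blocks as points, of constant size `k` and pairwise meeting in `s < k` points, form a
symmetric design. -/
theorem Finset.card_filter_mem_of_card_inter {α : Type*} [Fintype α] [DecidableEq α] {k s : ℕ}
    (hs : s < k) (B : Finset (Finset α)) (hcard : B.card = Fintype.card α)
    (hsize : ∀ b ∈ B, b.card = k) (hint : ∀ b ∈ B, ∀ b' ∈ B, b ≠ b' → (b ∩ b').card = s) :
    (∀ x, (B.filter (fun b => x ∈ b)).card = k) ∧
      ∀ x y, x ≠ y → (B.filter (fun b => x ∈ b ∧ y ∈ b)).card = s := by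
  have hk : (k : ℚ) ≠ 0 := by exact_mod_cast (by omega : k ≠ 0)
  have hks : (k : ℚ) ≠ s := by exact_mod_cast hs.ne'
  let N : Matrix B α ℚ := Matrix.of fun b x => if x ∈ b.1 then 1 else 0
  have hrow : ∀ b, ∑ x, N b x = k := fun b => by
    simp [N, hsize b.1 b.2]
  have hN : ∀ b c, ∑ x, N b x * N c x = if b = c then (k : ℚ) else s := fun b c => by
    have h : ∑ x, N b x * N c x = ((b.1 ∩ c.1).card : ℚ) := by
      simp [N, ← ite_and, ← Finset.mem_inter, Finset.inter_comm]
    rw [h]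
    split_ifs with hbc
    · rw [hbc, Finset.inter_self, hsize c.1 c.2]
    · rw [hint b.1 b.2 c.1 c.2 fun h => hbc (Subtype.ext h)]
  have key := Matrix.transpose_mul_apply_of_mul_transpose_apply (by simpa using hcard) hk hks N
    hrow hN
  have hcol : ∀ y, ∑ b, N b y = ((B.filter (fun b => y ∈ b)).card : ℚ) := fun y => by
    simp only [N, Matrix.of_apply]
    rw [Finset.sum_coe_sort B (fun b => if y ∈ b then (1 : ℚ) else 0), Finset.sum_boole]
  have hpair : ∀ x y, ∑ b, N b x * N b y =
      ((B.filter (fun b => x ∈ b ∧ y ∈ b)).card : ℚ) := fun x y => by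
    simp only [N, Matrix.of_apply, mul_ite, mul_one, mul_zero, ← ite_and]
    rw [Finset.sum_coe_sort B (fun b => if y ∈ b ∧ x ∈ b then (1 : ℚ) else 0), Finset.sum_boole]
    simp only [and_comm]
  have hdeg : ∀ x, (B.filter (fun b => x ∈ b)).card = k := fun x => by
    have h := key x x
    rw [hpair, hcol, if_pos rfl] at h
    simp only [and_self] at h
    field_simp at h
    have h' : ((k : ℚ) - s) * ((B.filter (fun b => x ∈ b)).card - k) = 0 := by linear_combination h
    rcases mul_eq_zero.mp h' with h' | h'
    · exact absurd (sub_eq_zero.mp h') hks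
    · exact_mod_cast sub_eq_zero.mp h'
  refine ⟨hdeg, fun x y hxy => ?_⟩
  have h := key x y
  rw [hpair, hcol, if_neg hxy, hdeg, zero_add, div_mul_cancel₀ _ hk] at h
  exact_mod_cast h

/-- In a block design with replication number `r`, block size `k` and pair index `s`, counting
the flags through a fixed point gives `r * (k - 1) = s * (v - 1)`. -/
theorem Finset.mul_pred_eq_of_card_filter_mem {α : Type*} [Fintype α] [DecidableEq α]
    {r k s : ℕ} (B : Finset (Finset α)) (hsize : ∀ b ∈ B, b.card = k) (x : α)
    (hdeg : (B.filter (fun b => x ∈ b)).card = r)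
    (hpair : ∀ y, x ≠ y → (B.filter (fun b => x ∈ b ∧ y ∈ b)).card = s) :
    r * (k - 1) = s * (Fintype.card α - 1) := by
  have h := Finset.sum_card_bipartiteAbove_eq_sum_card_bipartiteBelow
    (s := B.filter (fun b => x ∈ b)) (t := Finset.univ.erase x) (fun b y => y ∈ b)
  rw [Finset.sum_congr rfl (g := fun _ => k - 1), Finset.sum_const, hdeg,
    Finset.sum_congr rfl (g := fun _ => s), Finset.sum_const,
    Finset.card_erase_of_mem (Finset.mem_univ x), Finset.card_univ] at h
  · simpa [mul_comm] using h
  · intro y hy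
    rw [← hpair y (Finset.ne_of_mem_erase hy).symm, Finset.bipartiteBelow, Finset.filter_filter]
  · intro b hb
    obtain ⟨hb, hx⟩ := Finset.mem_filter.mp hb
    rw [← hsize b hb, ← Finset.card_erase_of_mem hx]
    congr 1
    ext y
    simp [Finset.bipartiteAbove]

theorem symmetric_design_characterization (v k s : ℕ) (hv : 0 < v) (hk : 0 < k)
    (hs : s < k) (B : Finset (Finset (Fin v))) (hcard : B.card = v)
    (hsize : ∀ b ∈ B, b.card = k)
    (hint : ∀ b ∈ B, ∀ b' ∈ B, (b ∩ b').card = s ∨ (b ∩ b').card = k) :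
    ((∀ x : Fin v, (B.filter (fun b => x ∈ b)).card = k) ∧
      (∀ x y : Fin v, x ≠ y → (B.filter (fun b => x ∈ b ∧ y ∈ b)).card = s))
      ↔ k * (k - 1) = s * (v - 1) := by
  refine ⟨fun ⟨hdeg, hpair⟩ => ?_, fun _ => ?_⟩
  · simpa using Finset.mul_pred_eq_of_card_filter_mem B hsize ⟨0, hv⟩ (hdeg _) (hpair _)
  · refine Finset.card_filter_mem_of_card_inter hs B (by simpa using hcard) hsize
      fun b hb c hc hbc => (hint b hb c hc).resolve_right fun h => hbc ?_
    exact (Finset.eq_of_subset_of_card_le Finset.inter_subset_left (by rw [h, hsize b hb])).symm.trans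
      (Finset.eq_of_subset_of_card_le Finset.inter_subset_right (by rw [h, hsize c hc]))
end

section
/- Let q > 1 be an integer with q ≡ 3 (mod 8). Then a strongly regular graph with parameters v = (q + 1)(q³ − q² + 1), k = q(q² − q + 1), λ = q − 1, μ = q² − q + 1 (the parameters of the point graph of a generalized quadrangle of order (q, q² − q), with eigenvalues e⁺ = q − 1 and e⁻ = −q² + q − 1) contains no coclique of size q³ − q² + 1 (i.e., no Delsarte coclique; equivalently, a generalized quadrangle of order (q, q² − q) possesses no ovoid). -/
open Matrix Finset in
/-- The quadratic form of the square of the adjacency matrix of a strongly regular graph. -/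
lemma SimpleGraph.IsSRGWith.mulVec_dotProduct_mulVec {V : Type*} [Fintype V] [DecidableEq V]
    {G : SimpleGraph V} [DecidableRel G.Adj] {n k l m : ℕ} (h : G.IsSRGWith n k l m)
    (u : V → ℤ) :
    (G.adjMatrix ℤ *ᵥ u) ⬝ᵥ (G.adjMatrix ℤ *ᵥ u) =
      ((k : ℤ) - m) * (u ⬝ᵥ u) + ((l : ℤ) - m) * (u ⬝ᵥ G.adjMatrix ℤ *ᵥ u)
        + m * (∑ v, u v) ^ 2 := by
  have hone : u ⬝ᵥ (Matrix.of (fun _ _ => (1 : ℤ)) : Matrix V V ℤ) *ᵥ u = (∑ v, u v) ^ 2 := by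
    simp [dotProduct, mulVec, ← Finset.sum_mul, sq]
  have hc : Gᶜ.adjMatrix ℤ = Matrix.of (fun _ _ => (1 : ℤ)) - 1 - G.adjMatrix ℤ := by
    ext v w
    by_cases hvw : v = w
    · simp [hvw]
    · by_cases hadj : G.Adj v w <;> simp [hvw, hadj, one_apply]
  have hsq := h.matrix_eq (α := ℤ)
  have : (G.adjMatrix ℤ *ᵥ u) ⬝ᵥ (G.adjMatrix ℤ *ᵥ u) = u ⬝ᵥ (G.adjMatrix ℤ ^ 2) *ᵥ u := by
    rw [sq, ← mulVec_mulVec, dotProduct_mulVec u, ← mulVec_transpose,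
      SimpleGraph.transpose_adjMatrix]
  rw [this, hsq, hc]
  simp only [add_mulVec, sub_mulVec, smul_mulVec, one_mulVec, dotProduct_add, dotProduct_sub,
    dotProduct_smul, smul_sub, hone, ← Nat.cast_smul_eq_nsmul ℤ, smul_eq_mul]
  ring

open Finset in
lemma even_card_symmDiff_inter {α : Type*} [DecidableEq α] (S T U : Finset α) :
    Even (#(symmDiff S T ∩ U)) ↔ (Even #(S ∩ U) ↔ Even #(T ∩ U)) := by
  have h : #(symmDiff S T ∩ U) + 2 * #(S ∩ T ∩ U) = #(S ∩ U) + #(T ∩ U) := by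
    have e1 : symmDiff S T ∩ U = (S \ T ∩ U) ∪ (T \ S ∩ U) := by
      ext; simp [mem_symmDiff]; tauto
    have e2 : S ∩ U = (S \ T ∩ U) ∪ (S ∩ T ∩ U) := by ext; simp; tauto
    have e3 : T ∩ U = (T \ S ∩ U) ∪ (S ∩ T ∩ U) := by ext; simp; tauto
    rw [e1, e2, e3, card_union_of_disjoint, card_union_of_disjoint, card_union_of_disjoint]
    · ring
    all_goals
      rw [disjoint_left]; intro a; simp; tauto
  rw [← Nat.even_add, ← h]
  simp [Nat.even_add]

open Finset in
/-- For a family of sets of size divisible by `4` with even pairwise intersections, the sum of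
`I ^ #T` over all sets is carried by the sets meeting every member of the family evenly. -/
lemma sum_powerset_I_pow_card_eq {α ι : Type*} [DecidableEq α] (Y : Finset α)
    (D : ι → Finset α) (hsub : ∀ i, D i ⊆ Y) (hfour : ∀ i, 4 ∣ #(D i))
    (heven : ∀ i j, Even #(D i ∩ D j)) [DecidablePred fun T => ∀ i, Even #(T ∩ D i)] :
    ∑ T ∈ Y.powerset, Complex.I ^ #T =
      ∑ T ∈ Y.powerset with ∀ i, Even #(T ∩ D i), Complex.I ^ #T := by
  rw [← sum_filter_add_sum_filter_not Y.powerset (fun T => ∀ i, Even #(T ∩ D i)),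
    add_eq_left]
  rcases isEmpty_or_nonempty ι with hι | hι
  · simp
  let pick : Finset α → ι := fun T => Classical.epsilon fun i => ¬ Even #(T ∩ D i)
  have hinv : ∀ T i j, Even #(symmDiff T (D i) ∩ D j) ↔ Even #(T ∩ D j) := fun T i j => by
    rw [even_card_symmDiff_inter]; simp [heven]
  have hpick : ∀ T i, pick (symmDiff T (D i)) = pick T := fun T i => by
    simp only [pick, hinv]
  have hspec : ∀ T, (¬ ∀ i, Even #(T ∩ D i)) → ¬ Even #(T ∩ D (pick T)) := fun T hT =>
    Classical.epsilon_spec (p := fun i => ¬ Even #(T ∩ D i)) (not_forall.mp hT)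
  have hneg : ∀ T, (¬ ∀ i, Even #(T ∩ D i)) →
      Complex.I ^ #(symmDiff T (D (pick T))) = - Complex.I ^ #T := fun T hT => by
    have hodd := hspec T hT
    set E := D (pick T) with hE
    have hcard : #(symmDiff T E) + 2 * #(T ∩ E) = #T + #E := by
      rw [symmDiff_def, sup_eq_union, card_union_of_disjoint disjoint_sdiff_sdiff]
      have h1 := card_sdiff_add_card_inter T E
      have h2 := card_sdiff_add_card_inter E T
      rw [inter_comm E T] at h2
      omega
    have hp := congrArg (fun n => Complex.I ^ n) hcard
    obtain ⟨m, hm⟩ := hfour (pick T)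
    rw [← hE] at hm
    simp only [pow_add, pow_mul, Complex.I_sq, hm, Complex.I_pow_four, one_pow, mul_one] at hp
    rw [(Nat.not_even_iff_odd.mp hodd).neg_one_pow] at hp
    linear_combination -hp
  refine sum_involution (fun T _ => symmDiff T (D (pick T))) ?_ ?_ ?_ ?_
  · intro T hT
    rw [hneg T (mem_filter.mp hT).2]; ring
  · intro T hT _ heq
    have hn := hneg T (mem_filter.mp hT).2
    rw [heq] at hn
    exact pow_ne_zero _ Complex.I_ne_zero (self_eq_neg.mp hn)
  · intro T hT
    simp only [mem_filter, mem_powerset, hinv] at hT ⊢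
    refine ⟨?_, hT.2⟩
    rw [symmDiff_def, sup_eq_union]
    exact union_subset (sdiff_subset.trans hT.1) (sdiff_subset.trans (hsub _))
  · intro T hT
    simp only [hpick, symmDiff_symmDiff_cancel_right]

open Finset in
lemma sum_powerset_I_pow_card {α : Type*} (Y : Finset α) :
    ∑ T ∈ Y.powerset, Complex.I ^ #T = (1 + Complex.I) ^ #Y := by
  classical
  rw [add_comm, ← Finset.sum_pow_mul_eq_add_pow]
  simp

/-- A family as in `sum_powerset_I_pow_card_eq` on `8 m + 3` points cannot be such that every set
meeting its members evenly has size `0` or `3` modulo `4`. -/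
lemma exists_even_inter_card_mod_four {α ι : Type*} [DecidableEq α] (Y : Finset α)
    (D : ι → Finset α) (hsub : ∀ i, D i ⊆ Y) (hfour : ∀ i, 4 ∣ (D i).card)
    (heven : ∀ i j, Even (D i ∩ D j).card) (hY : Y.card % 8 = 3) :
    ∃ T ⊆ Y, (∀ i, Even (T ∩ D i).card) ∧ T.card % 4 ≠ 0 ∧ T.card % 4 ≠ 3 := by
  classical
  by_contra! hcon
  have h := sum_powerset_I_pow_card_eq Y D hsub hfour heven
  rw [sum_powerset_I_pow_card] at h
  have hre := congrArg Complex.re h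
  obtain ⟨m, hm⟩ : ∃ m, Y.card = 8 * m + 3 := ⟨Y.card / 8, by omega⟩
  have h8 : (1 + Complex.I) ^ 8 = 16 := by
    have h2 : (1 + Complex.I) ^ 2 = 2 * Complex.I := by
      linear_combination Complex.I_sq
    linear_combination ((1 + Complex.I) ^ 4 + 4 * Complex.I ^ 2) *
      ((1 + Complex.I) ^ 2 + 2 * Complex.I) * h2 + 16 * Complex.I_pow_four
  have h3 : (1 + Complex.I) ^ 3 = -2 + 2 * Complex.I := by
    linear_combination (3 + Complex.I) * Complex.I_sq
  have hneg : ((1 + Complex.I) ^ Y.card).re < 0 := by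
    have : (1 + Complex.I) ^ Y.card = (((16 : ℝ) ^ m : ℝ) : ℂ) * (-2 + 2 * Complex.I) := by
      rw [hm, pow_add, pow_mul, h8, h3]; push_cast; rfl
    rw [this, Complex.re_ofReal_mul]
    simp
  have hnonneg : 0 ≤ (∑ T ∈ Y.powerset with ∀ i, Even (T ∩ D i).card, Complex.I ^ T.card).re := by
    rw [Complex.re_sum]
    refine Finset.sum_nonneg fun T hT => ?_
    simp only [Finset.mem_filter, Finset.mem_powerset] at hT
    rw [Complex.I_pow_eq_pow_mod]
    by_cases h0 : T.card % 4 = 0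
    · simp [h0]
    · simp [hcon T hT.1 hT.2 h0, Complex.I_pow_three]
  linarith

section Indicator

open Matrix Finset

/-- The indicator function of a finite set, with integer values. -/
def chi {V : Type*} [DecidableEq V] (T : Finset V) : V → ℤ := fun v => if v ∈ T then 1 else 0

lemma dotProduct_one_eq_sum {V : Type*} [Fintype V] (u : V → ℤ) : u ⬝ᵥ 1 = ∑ v, u v := by
  simp [dotProduct]

lemma dotProduct_adjMatrix_mulVec {V : Type*} [Fintype V] (G : SimpleGraph V)
    [DecidableRel G.Adj] (u w : V → ℤ) :
    u ⬝ᵥ G.adjMatrix ℤ *ᵥ w = (G.adjMatrix ℤ *ᵥ u) ⬝ᵥ w := by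
  rw [dotProduct_mulVec, ← mulVec_transpose, SimpleGraph.transpose_adjMatrix]

lemma adjMatrix_mulVec_one {V : Type*} [Fintype V] {G : SimpleGraph V} [DecidableRel G.Adj]
    {k : ℕ} (h : G.IsRegularOfDegree k) : G.adjMatrix ℤ *ᵥ 1 = fun _ => (k : ℤ) := by
  ext v; simp [SimpleGraph.adjMatrix_mulVec_apply, h.degree_eq v]

lemma sum_adjMatrix_mulVec {V : Type*} [Fintype V] {G : SimpleGraph V} [DecidableRel G.Adj]
    {k : ℕ} (h : G.IsRegularOfDegree k) (u : V → ℤ) :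
    ∑ v, (G.adjMatrix ℤ *ᵥ u) v = k * ∑ v, u v := by
  rw [← dotProduct_one_eq_sum, ← dotProduct_adjMatrix_mulVec, adjMatrix_mulVec_one h,
    mul_comm, sum_mul]
  rfl

variable {V : Type*} [Fintype V] [DecidableEq V]

lemma chi_dotProduct (T : Finset V) (u : V → ℤ) : chi T ⬝ᵥ u = ∑ v ∈ T, u v := by
  simp [chi, dotProduct]

lemma sum_chi (T : Finset V) : ∑ v, chi T v = #T := by simp [chi]

lemma chi_dotProduct_chi (S T : Finset V) : chi S ⬝ᵥ chi T = #(S ∩ T) := by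
  simp [chi_dotProduct, chi]

variable (G : SimpleGraph V) [DecidableRel G.Adj]

lemma adjMatrix_mulVec_chi (T : Finset V) (v : V) :
    (G.adjMatrix ℤ *ᵥ chi T) v = #(G.neighborFinset v ∩ T) := by
  simp [chi]

variable {G}

lemma IsCoclique.adjMatrix_mulVec_chi_eq_zero {Y T : Finset V} (hY : IsCoclique G Y)
    (hT : T ⊆ Y) {v : V} (hv : v ∈ Y) : (G.adjMatrix ℤ *ᵥ chi T) v = 0 := by
  rw [adjMatrix_mulVec_chi, Nat.cast_eq_zero, card_eq_zero, ← disjoint_iff_inter_eq_empty,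
    disjoint_left]
  intro w hw hwT
  exact hY v hv w (hT hwT) (by simpa using hw)

lemma IsCoclique.chi_dotProduct_adjMatrix_mulVec {Y S T : Finset V} (hY : IsCoclique G Y)
    (hS : S ⊆ Y) (hT : T ⊆ Y) : chi S ⬝ᵥ G.adjMatrix ℤ *ᵥ chi T = 0 := by
  rw [chi_dotProduct]
  exact sum_eq_zero fun v hv => hY.adjMatrix_mulVec_chi_eq_zero hT (hS hv)

variable {n k l m : ℕ} {q : ℤ} {Y : Finset V}

/-- A vertex outside a Delsarte coclique has `m` neighbours in it. -/
lemma IsCoclique.card_neighborFinset_inter (hY : IsCoclique G Y) (h : G.IsSRGWith n k l m)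
    (hn : (n : ℤ) = (q + 1) * (q ^ 3 - q ^ 2 + 1)) (hk : (k : ℤ) = q * m)
    (hm : (m : ℤ) = q ^ 2 - q + 1) (hc : (#Y : ℤ) = q ^ 3 - q ^ 2 + 1) {x : V} (hx : x ∉ Y) :
    #(G.neighborFinset x ∩ Y) = m := by
  set A := G.adjMatrix ℤ with hA
  set z : V → ℤ := A *ᵥ chi Y + (m : ℤ) • (chi Y - 1) with hz
  have h0 := hY.chi_dotProduct_adjMatrix_mulVec subset_rfl (subset_refl Y)
  have h0' := h0
  rw [dotProduct_comm, ← hA] at h0'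
  have h1 := h.mulVec_dotProduct_mulVec (chi Y)
  have h2 : (A *ᵥ chi Y) ⬝ᵥ 1 = k * #Y := by
    rw [dotProduct_one_eq_sum, sum_adjMatrix_mulVec h.regular, sum_chi]
  have h3 : chi Y ⬝ᵥ 1 = (#Y : ℤ) := by rw [dotProduct_one_eq_sum, sum_chi]
  have h4 : chi Y ⬝ᵥ chi Y = (#Y : ℤ) := by rw [chi_dotProduct_chi, inter_self]
  have h5 : (1 : V → ℤ) ⬝ᵥ 1 = n := by simp [h.card]
  rw [← hA] at h0
  rw [← hA, h0, h4, sum_chi] at h1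
  have hzz : z ⬝ᵥ z = 0 := by
    simp only [hz, dotProduct_add, add_dotProduct, dotProduct_smul, smul_dotProduct,
      dotProduct_sub, sub_dotProduct, dotProduct_comm 1 (A *ᵥ chi Y), dotProduct_comm 1 (chi Y),
      h0, h0', h1, h2, h3, h4, h5, smul_eq_mul]
    rw [hk, hn, hc, hm]
    ring
  have hx0 := congrFun (dotProduct_self_eq_zero.mp hzz) x
  simp only [hz, Pi.add_apply, Pi.smul_apply, Pi.sub_apply, hA, adjMatrix_mulVec_chi, chi, hx,
    if_false, Pi.one_apply, Pi.zero_apply, smul_eq_mul] at hx0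
  have : (#(G.neighborFinset x ∩ Y) : ℤ) = m := by linarith
  exact_mod_cast this

/-- Two vertices outside a Delsarte coclique have `1` or `q` common neighbours in it. -/
lemma IsCoclique.card_neighborFinset_inter_inter (hY : IsCoclique G Y)
    (h : G.IsSRGWith n k l m) (hn : (n : ℤ) = (q + 1) * (q ^ 3 - q ^ 2 + 1))
    (hk : (k : ℤ) = q * m) (hl : (l : ℤ) = q - 1) (hm : (m : ℤ) = q ^ 2 - q + 1)
    (hc : (#Y : ℤ) = q ^ 3 - q ^ 2 + 1) {x w : V} (hx : x ∉ Y) (hw : w ∉ Y) (hxw : x ≠ w) :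
    (#(G.neighborFinset w ∩ (G.neighborFinset x ∩ Y)) : ℤ) = if G.Adj x w then 1 else q := by
  have hcard := fun v => hY.card_neighborFinset_inter h hn hk hm hc (x := v)
  set A := G.adjMatrix ℤ with hA
  set b := chi (G.neighborFinset x ∩ Y) with hb
  set d := chi {x} with hd
  have hAY : A *ᵥ chi Y = (m : ℤ) • (1 - chi Y) := by
    ext v
    by_cases hv : v ∈ Y
    · rw [hA, hY.adjMatrix_mulVec_chi_eq_zero subset_rfl hv]; simp [chi, hv]
    · rw [hA, adjMatrix_mulVec_chi, hcard v hv]; simp [chi, hv]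
  have hbb : b ⬝ᵥ b = m := by rw [chi_dotProduct_chi, inter_self, hcard x hx]
  have hbd : b ⬝ᵥ d = 0 := by rw [chi_dotProduct_chi]; simp [hx]
  have hdd : d ⬝ᵥ d = 1 := by rw [chi_dotProduct_chi]; simp
  have hby : b ⬝ᵥ chi Y = m := by
    rw [chi_dotProduct_chi, inter_assoc, inter_self, hcard x hx]
  have hdy : d ⬝ᵥ chi Y = 0 := by rw [chi_dotProduct_chi]; simp [hx]
  have hb1 : b ⬝ᵥ 1 = m := by rw [dotProduct_one_eq_sum, sum_chi, hcard x hx]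
  have hd1 : d ⬝ᵥ 1 = 1 := by rw [dotProduct_one_eq_sum, sum_chi]; simp
  have hbAb : b ⬝ᵥ A *ᵥ b = 0 :=
    hY.chi_dotProduct_adjMatrix_mulVec inter_subset_right inter_subset_right
  have hdAd : d ⬝ᵥ A *ᵥ d = 0 := by
    rw [chi_dotProduct, sum_singleton, hA, adjMatrix_mulVec_chi]; simp
  have hdAb : d ⬝ᵥ A *ᵥ b = m := by
    rw [chi_dotProduct, sum_singleton, hA, adjMatrix_mulVec_chi, ← inter_assoc, inter_self,
      hcard x hx]
  have hbAd : b ⬝ᵥ A *ᵥ d = m := by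
    rw [dotProduct_adjMatrix_mulVec, dotProduct_comm, hdAb]
  set u : V → ℤ := b + (q - 1) • d with hu
  have huu : u ⬝ᵥ u = m + (q - 1) ^ 2 := by
    simp only [hu, dotProduct_add, add_dotProduct, dotProduct_smul, smul_dotProduct,
      dotProduct_comm d b, hbb, hbd, hdd, smul_eq_mul]
    ring
  have hu1 : u ⬝ᵥ 1 = m + (q - 1) := by
    simp only [hu, add_dotProduct, smul_dotProduct, hb1, hd1, smul_eq_mul]
    ring
  have huy : u ⬝ᵥ chi Y = m := by
    simp only [hu, add_dotProduct, smul_dotProduct, hby, hdy, smul_eq_mul]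
    ring
  have huAu : u ⬝ᵥ A *ᵥ u = 2 * (q - 1) * m := by
    simp only [hu, mulVec_add, mulVec_smul, dotProduct_add, add_dotProduct, dotProduct_smul,
      smul_dotProduct, hbAb, hbAd, hdAb, hdAd, smul_eq_mul]
    ring
  have hAu1 : (A *ᵥ u) ⬝ᵥ 1 = k * (m + (q - 1)) := by
    rw [dotProduct_one_eq_sum, sum_adjMatrix_mulVec h.regular, ← dotProduct_one_eq_sum, hu1]
  have hAuy : (A *ᵥ u) ⬝ᵥ chi Y = m * (q - 1) := by
    rw [← dotProduct_adjMatrix_mulVec, ← hA, hAY, dotProduct_smul, dotProduct_sub, hu1, huy,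
      smul_eq_mul]
    ring
  have hAuAu := h.mulVec_dotProduct_mulVec u
  rw [← hA, huu, huAu, ← dotProduct_one_eq_sum, hu1] at hAuAu
  have hyy : chi Y ⬝ᵥ chi Y = (#Y : ℤ) := by rw [chi_dotProduct_chi, inter_self]
  have hy1 : chi Y ⬝ᵥ 1 = (#Y : ℤ) := by rw [dotProduct_one_eq_sum, sum_chi]
  have h11 : (1 : V → ℤ) ⬝ᵥ 1 = n := by simp [h.card]
  set z : V → ℤ := A *ᵥ u - (q - 1) • u - q • (1 - chi Y) with hz
  have hzz : z ⬝ᵥ z = 0 := by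
    simp only [hz, dotProduct_sub, sub_dotProduct, dotProduct_smul, smul_dotProduct,
      dotProduct_comm (A *ᵥ u) u, dotProduct_comm 1 (A *ᵥ u), dotProduct_comm (chi Y) (A *ᵥ u),
      dotProduct_comm 1 u, dotProduct_comm (chi Y) u, dotProduct_comm 1 (chi Y),
      huu, hu1, huy, huAu, hAu1, hAuy, hAuAu, hyy, hy1, h11, smul_eq_mul]
    rw [hk, hn, hc, hl, hm]
    ring
  have hw0 := congrFun (dotProduct_self_eq_zero.mp hzz) w
  have hAdw : (A *ᵥ d) w = if G.Adj x w then 1 else 0 := by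
    rw [hA, adjMatrix_mulVec_chi]
    by_cases hadj : G.Adj x w <;> simp [hadj, G.adj_comm w x]
  have hAbw : (A *ᵥ b) w = #(G.neighborFinset w ∩ (G.neighborFinset x ∩ Y)) := by
    rw [hA, adjMatrix_mulVec_chi]
  have hbw : b w = 0 := by simp [hb, chi, hw]
  have hdw : d w = 0 := by simp [hd, chi, hxw.symm]
  have hyw : chi Y w = 0 := by simp [chi, hw]
  simp only [hz, hu, mulVec_add, mulVec_smul, Pi.add_apply, Pi.smul_apply, Pi.sub_apply, hAdw,
    hAbw, hbw, hdw, hyw, Pi.one_apply, Pi.zero_apply, smul_eq_mul] at hw0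
  split_ifs at hw0 ⊢ <;> linarith

end Indicator

theorem gq_q_qsq_sub_q_no_ovoid_of_three_mod_eight {V : Type*} [Fintype V] [DecidableEq V]
    (G : SimpleGraph V) [DecidableRel G.Adj] (q : ℕ) (hq : 1 < q) (hmod : q % 8 = 3)
    (hsrg : G.IsSRGWith ((q + 1) * (q ^ 3 - q ^ 2 + 1)) (q * (q ^ 2 - q + 1))
      (q - 1) (q ^ 2 - q + 1)) :
    ¬ ∃ Y : Finset V, IsCoclique G Y ∧ Y.card = q ^ 3 - q ^ 2 + 1 := by
  rintro ⟨Y, hY, hc⟩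
  set m := q ^ 2 - q + 1 with hmdef
  have hq2 : q ≤ q ^ 2 := Nat.le_self_pow two_ne_zero q
  have hq3 : q ^ 2 ≤ q ^ 3 := Nat.pow_le_pow_right (by omega) (by norm_num)
  have hm : (m : ℤ) = (q : ℤ) ^ 2 - q + 1 := by rw [hmdef]; push_cast [hq2]; ring
  have hcZ : (Y.card : ℤ) = (q : ℤ) ^ 3 - q ^ 2 + 1 := by rw [hc]; push_cast [hq3]; ring
  have hn : (((q + 1) * (q ^ 3 - q ^ 2 + 1) : ℕ) : ℤ)
      = ((q : ℤ) + 1) * ((q : ℤ) ^ 3 - q ^ 2 + 1) := by push_cast [hq3]; ring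
  have hk : ((q * m : ℕ) : ℤ) = (q : ℤ) * m := by push_cast; ring
  have hl : ((q - 1 : ℕ) : ℤ) = (q : ℤ) - 1 := by push_cast [hq.le]; ring
  have hblock := fun v => hY.card_neighborFinset_inter hsrg hn hk hm hcZ (x := v)
  obtain ⟨t, ht⟩ : ∃ t : ℤ, (q : ℤ) = 8 * t + 3 := ⟨q / 8, by omega⟩
  have hqmod : (q : ZMod 8) = 3 := by
    rw [← Int.cast_natCast, ht]; push_cast; rw [show (8 : ZMod 8) = 0 from rfl]; ring
  have hmmod : (m : ZMod 8) = 7 := by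
    rw [← Int.cast_natCast, hm]; push_cast; rw [hqmod]; rfl
  have hcmod : (Y.card : ZMod 8) = 3 := by
    rw [← Int.cast_natCast, hcZ]; push_cast; rw [hqmod]; rfl
  have hm8 : m % 8 = 7 := by
    exact (ZMod.natCast_eq_natCast_iff' m 7 8).mp (by exact_mod_cast hmmod)
  have hc8 : Y.card % 8 = 3 := by
    exact (ZMod.natCast_eq_natCast_iff' Y.card 3 8).mp (by exact_mod_cast hcmod)
  have hsdiff : ∀ v ∉ Y, (Y \ G.neighborFinset v).card + m = Y.card := fun v hv => by
    rw [← hblock v hv, Finset.inter_comm, Finset.card_sdiff_add_card_inter]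
  obtain ⟨T, hTY, hTeven, hT0, hT3⟩ := exists_even_inter_card_mod_four Y
    (fun i : {v // v ∉ Y} => Y \ G.neighborFinset i.1) (fun i => Finset.sdiff_subset)
    (fun i => by have := hsdiff i.1 i.2; omega)
    (fun ⟨i, hi⟩ ⟨j, hj⟩ => by
      dsimp only
      rcases eq_or_ne i j with rfl | hij
      · rw [Finset.inter_self]
        have := hsdiff i hi
        exact Nat.even_iff.mpr (by omega)
      · have h1 := hY.card_neighborFinset_inter_inter hsrg hn hk hl hm hcZ hi hj hij
        have h2 := hsdiff j hj
        have h3 := hblock i hi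
        have h4 := Finset.card_sdiff_add_card_inter (Y \ G.neighborFinset j)
          (G.neighborFinset i)
        have h5 := Finset.card_sdiff_add_card_inter (G.neighborFinset i ∩ Y)
          (G.neighborFinset j)
        have e1 : (Y \ G.neighborFinset i) ∩ (Y \ G.neighborFinset j)
            = (Y \ G.neighborFinset j) \ G.neighborFinset i := by ext; simp; tauto
        have e2 : (Y \ G.neighborFinset j) ∩ G.neighborFinset i
            = (G.neighborFinset i ∩ Y) \ G.neighborFinset j := by ext; simp; tauto
        rw [Finset.inter_comm (G.neighborFinset j)] at h1
        rw [e1, Nat.even_iff]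
        rw [e2] at h4
        split_ifs at h1 <;> omega) hc8
  have hpar : ∀ v ∉ Y, (G.adjMatrix ℤ).mulVec (chi T) v % 2 = T.card % 2 := fun v hv => by
    have h1 := Nat.even_iff.mp (hTeven ⟨v, hv⟩)
    have h2 := Finset.card_sdiff_add_card_inter T (G.neighborFinset v)
    rw [show T ∩ (Y \ G.neighborFinset v) = T \ G.neighborFinset v by
      rw [← Finset.inter_sdiff_assoc, Finset.inter_eq_left.mpr hTY]] at h1
    rw [adjMatrix_mulVec_chi, Finset.inter_comm]
    omega
  have hsq := hsrg.mulVec_dotProduct_mulVec (chi T)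
  rw [hY.chi_dotProduct_adjMatrix_mulVec hTY hTY, chi_dotProduct_chi, Finset.inter_self,
    sum_chi] at hsq
  simp only [dotProduct] at hsq
  rcases Nat.even_or_odd T.card with hev | hodd
  · have hdvd : (8 : ℤ) ∣ ∑ v, ((G.adjMatrix ℤ).mulVec (chi T) v * (G.adjMatrix ℤ).mulVec (chi T) v
        - 2 * (G.adjMatrix ℤ).mulVec (chi T) v) := by
      refine Finset.dvd_sum fun v _ => ?_
      by_cases hv : v ∈ Y
      · simp [hY.adjMatrix_mulVec_chi_eq_zero hTY hv]
      · have := hpar v hv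
        obtain ⟨a, ha⟩ : Even ((G.adjMatrix ℤ).mulVec (chi T) v) := by
          rw [Int.even_iff]; have := Nat.even_iff.mp hev; omega
        obtain ⟨b, hb⟩ := Int.even_mul_pred_self a
        exact ⟨b, by rw [ha]; linear_combination 4 * hb⟩
    rw [Finset.sum_sub_distrib, hsq, ← Finset.mul_sum, sum_adjMatrix_mulVec hsrg.regular,
      sum_chi] at hdvd
    have h0 := (ZMod.intCast_zmod_eq_zero_iff_dvd _ 8).mpr hdvd
    obtain ⟨a, ha⟩ : ∃ a, T.card = 4 * a + 2 :=
      ⟨T.card / 4, by have := Nat.even_iff.mp hev; omega⟩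
    rw [ha] at h0
    push_cast at h0
    rw [mul_zero, hqmod, hmmod] at h0
    generalize (a : ZMod 8) = a at h0
    revert a; decide
  · have hdvd : (8 : ℤ) ∣ ∑ v, ((G.adjMatrix ℤ).mulVec (chi T) v * (G.adjMatrix ℤ).mulVec (chi T) v
        - (1 - chi Y v)) := by
      refine Finset.dvd_sum fun v _ => ?_
      by_cases hv : v ∈ Y
      · simp [hY.adjMatrix_mulVec_chi_eq_zero hTY hv, chi, hv]
      · have := hpar v hv
        have ho : Odd ((G.adjMatrix ℤ).mulVec (chi T) v) := by
          rw [Int.odd_iff]; have := Nat.odd_iff.mp hodd; omega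
        simpa [chi, hv, sq] using Int.eight_dvd_sq_sub_one_of_odd ho
    rw [Finset.sum_sub_distrib, Finset.sum_sub_distrib, hsq, sum_chi, hcZ] at hdvd
    simp only [Finset.sum_const, Finset.card_univ, hsrg.card, nsmul_eq_mul, hn] at hdvd
    have h0 := (ZMod.intCast_zmod_eq_zero_iff_dvd _ 8).mpr hdvd
    obtain ⟨a, ha⟩ : ∃ a, T.card = 4 * a + 1 :=
      ⟨T.card / 4, by have := Nat.odd_iff.mp hodd; omega⟩
    rw [ha] at h0
    push_cast at h0
    rw [mul_zero, hqmod, hmmod] at h0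
    generalize (a : ZMod 8) = a at h0
    revert a; decide
end

section
/- Let q = ℓp^e + 1, where p is a prime with p ≡ 3 (mod 4), e is an odd positive integer, and ℓ is a positive integer with ℓ ≡ 2 (mod 4). Then a strongly regular graph with parameters v = (q + 1)(q³ − q² + 1), k = q(q² − q + 1), λ = q − 1, μ = q² − q + 1 (the parameters of the point graph of a generalized quadrangle of order (q, q² − q), with eigenvalues e⁺ = q − 1 and e⁻ = −q² + q − 1) contains no coclique of size q³ − q² + 1 (i.e., no Delsarte coclique; equivalently, a generalized quadrangle of order (q, q² − q) possesses no ovoid). -/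
theorem sum_char_quadratic_eq_card {A : Type*} [AddCommGroup A] [Fintype A] (C : AddSubgroup A)
    (φ : A → ℂ) (β : A → AddChar A ℂ)
    (hφ : ∀ x, ∀ c ∈ C, φ (x + c) = φ x * β x c)
    (hiso : ∀ x ∈ C, φ x = 1 ∧ ∀ c ∈ C, β x c = 1)
    (hmax : ∀ x, (∀ c ∈ C, β x c = 1) → x ∈ C) :
    ∑ x, φ x = Nat.card C := by
  classical
  have hβ : ∀ x, ∑ c : C, β x c = if x ∈ C then (Nat.card C : ℂ) else 0 := by
    intro x
    have h := AddChar.sum_eq_ite ((β x).compAddMonoidHom C.subtype)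
    simp only [AddChar.compAddMonoidHom_apply, AddSubgroup.subtype_apply] at h
    rw [h, Nat.card_eq_fintype_card]
    congr 1
    rw [eq_iff_iff]
    constructor
    · intro h0
      refine hmax x fun c hc => ?_
      simpa using DFunLike.congr_fun h0 ⟨c, hc⟩
    · intro hx
      ext c
      simpa using (hiso x hx).2 c c.2
  have hpos : (Nat.card C : ℂ) ≠ 0 := by
    rw [Nat.card_eq_fintype_card]; exact_mod_cast Fintype.card_ne_zero
  apply mul_left_cancel₀ hpos
  calc (Nat.card C : ℂ) * ∑ x, φ x = ∑ c : C, ∑ x, φ (x + c) := by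
        have : ∀ c : C, ∑ x, φ (x + c) = ∑ x, φ x := fun c =>
          Equiv.sum_comp (Equiv.addRight (c : A)) φ
        simp [this, Nat.card_eq_fintype_card]
    _ = ∑ x, φ x * ∑ c : C, β x c := by
        rw [Finset.sum_comm]
        refine Finset.sum_congr rfl fun x _ => ?_
        rw [Finset.mul_sum]
        exact Finset.sum_congr rfl fun c _ => hφ x c c.2
    _ = ∑ x, if x ∈ C then (Nat.card C : ℂ) else 0 := by
        refine Finset.sum_congr rfl fun x _ => ?_
        rw [hβ]
        split_ifs with hx
        · rw [(hiso x hx).1, one_mul]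
        · simp
    _ = (Nat.card C : ℂ) * Nat.card C := by
        rw [← Finset.sum_filter, Finset.sum_const, nsmul_eq_mul, Nat.card_eq_fintype_card,
          Fintype.card_subtype]

section Code

variable {X P : Type*} [Fintype P]

/-- The subgroup of `(ℤ/d)^P × ℤ/d` generated by the rows of `N` extended by a last entry `1`. -/
def extendedCode (N : X → P → ℤ) (d : ℕ) : AddSubgroup ((P → ZMod d) × ZMod d) :=
  AddSubgroup.closure (Set.range fun b => ((fun i => (N b i : ZMod d)), 1))

/-- The bilinear form `∑ xᵢ yᵢ - x' y'` on `(ℤ/d)^P × ℤ/d`. -/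
def lorentzForm (d : ℕ) (x : (P → ZMod d) × ZMod d) : ((P → ZMod d) × ZMod d) →+ ZMod d where
  toFun y := ∑ i, x.1 i * y.1 i - x.2 * y.2
  map_zero' := by simp
  map_add' y z := by simp [mul_add, Finset.sum_add_distrib]; ring

theorem lorentzForm_apply (d : ℕ) (x y : (P → ZMod d) × ZMod d) :
    lorentzForm d x y = ∑ i, x.1 i * y.1 i - x.2 * y.2 := rfl

theorem lorentzForm_comm (d : ℕ) (x y : (P → ZMod d) × ZMod d) :
    lorentzForm d x y = lorentzForm d y x := by
  simp [lorentzForm_apply, mul_comm]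

theorem lorentzForm_eq_zero_of_mem {N : X → P → ℤ} {d : ℕ}
    (hN : ∀ b b', ((∑ i, N b i * N b' i : ℤ) : ZMod d) = 1) {x y : (P → ZMod d) × ZMod d}
    (hx : x ∈ extendedCode N d) (hy : y ∈ extendedCode N d) : lorentzForm d x y = 0 := by
  have key : ∀ b, ∀ y ∈ extendedCode N d,
      lorentzForm d ((fun i => (N b i : ZMod d)), 1) y = 0 := by
    intro b y hy
    induction hy using AddSubgroup.closure_induction with
    | mem y hy =>
      obtain ⟨b', rfl⟩ := hy
      have := hN b b'
      push_cast at this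
      simp [lorentzForm_apply, this]
    | zero => simp
    | add y z _ _ h1 h2 => rw [map_add, h1, h2, add_zero]
    | neg y _ h => rw [map_neg, h, neg_zero]
  induction hx using AddSubgroup.closure_induction with
  | mem x hx => obtain ⟨b, rfl⟩ := hx; exact key b y hy
  | zero => rw [lorentzForm_comm, map_zero]
  | add x z _ _ h1 h2 =>
    rw [lorentzForm_comm] at *
    rw [map_add, h1, h2, add_zero]
  | neg x _ h =>
    rw [lorentzForm_comm] at *
    rw [map_neg, h, neg_zero]

theorem mem_extendedCode_of_orthogonal [Fintype X] [Nonempty P] [DecidableEq P] {N : X → P → ℤ}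
    {d d' M : ℕ} (hd : d ≠ 0) (hM : M = d * d') (hcop : d'.Coprime d)
    (hcol : ∀ i, ∑ b, N b i = (M + 1) * ((M + 1) * M + 1))
    (hpair : ∀ i j, ∑ b, N b i * N b j =
      (if i = j then (((M : ℤ) + 1) * M + 1) * M else 0) + ((M + 1) * M + 1))
    (hX : (Fintype.card X : ℤ) = (M + 1) * ((M + 1) ^ 2 * M + 1))
    (x : (P → ZMod d) × ZMod d) (hx : ∀ c ∈ extendedCode N d, lorentzForm d x c = 0) :
    x ∈ extendedCode N d := by
  have : NeZero d := ⟨hd⟩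
  have hdM : (M : ZMod d) = 0 := by rw [hM]; simp
  have hgen : ∀ b, ((fun i => (N b i : ZMod d)), 1) ∈ extendedCode N d := fun b =>
    AddSubgroup.subset_closure ⟨b, rfl⟩
  obtain ⟨y, hy⟩ : ∃ y : P → ℤ, ∀ i, (y i : ZMod d) = x.1 i :=
    ⟨fun i => (x.1 i).val, fun i => by simp⟩
  obtain ⟨z, hz⟩ : ∃ z : ℤ, (z : ZMod d) = x.2 := ⟨x.2.val, by simp⟩
  have ht : ∀ b, ∃ t : ℤ, ∑ i, N b i * y i - z = d * t := by
    intro b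
    have h := hx _ (hgen b)
    rw [lorentzForm_apply] at h
    have : ((∑ i, N b i * y i - z : ℤ) : ZMod d) = 0 := by
      push_cast
      rw [← h]
      simp [hy, hz, mul_comm]
    exact (ZMod.intCast_zmod_eq_zero_iff_dvd _ _).1 this
  choose t ht using ht
  set S := ∑ i, y i with hS
  have h1 : ∀ i, (d : ℤ) * ∑ b, t b * N b i =
      ((M + 1) * M + 1) * M * y i + ((M + 1) * M + 1) * S
        - (M + 1) * ((M + 1) * M + 1) * z := by
    intro i
    calc (d : ℤ) * ∑ b, t b * N b i = ∑ b, (∑ j, N b j * y j - z) * N b i := by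
          rw [Finset.mul_sum]
          exact Finset.sum_congr rfl fun b _ => by rw [ht]; ring
      _ = ∑ j, y j * ∑ b, N b i * N b j - z * ∑ b, N b i := by
          simp only [sub_mul, Finset.sum_sub_distrib, Finset.mul_sum, Finset.sum_mul]
          rw [Finset.sum_comm]
          congr 1
          exact Finset.sum_congr rfl fun b _ => Finset.sum_congr rfl fun j _ => by ring
      _ = _ := by
          simp only [hpair, hcol, mul_add, Finset.sum_add_distrib, ← Finset.sum_mul, mul_ite,
            mul_zero, Finset.sum_ite_eq, Finset.mem_univ, if_true, ← hS, mul_one]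
          ring
  have h2 : (d : ℤ) * ∑ b, t b = (M + 1) * ((M + 1) * M + 1) * S
      - (M + 1) * ((M + 1) ^ 2 * M + 1) * z := by
    calc (d : ℤ) * ∑ b, t b = ∑ b, (∑ j, N b j * y j - z) := by
          rw [Finset.mul_sum]
          exact Finset.sum_congr rfl fun b _ => by rw [ht]
      _ = ∑ j, y j * ∑ b, N b j - Fintype.card X * z := by
          simp only [Finset.sum_sub_distrib, Finset.mul_sum]
          rw [Finset.sum_comm]
          simp [mul_comm]
      _ = _ := by
          simp only [hcol, hX, ← Finset.sum_mul, ← hS]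
          ring
  have hd0 : (d : ℤ) ≠ 0 := by exact_mod_cast hd
  have hMz : (M : ℤ) = d * d' := by exact_mod_cast hM
  obtain ⟨s, hs⟩ : ∃ s : ℤ, ∀ i, ∑ b, t b * N b i = ((M + 1) * M + 1) * d' * y i + s := by
    obtain ⟨i₀⟩ := ‹Nonempty P›
    refine ⟨∑ b, t b * N b i₀ - ((M + 1) * M + 1) * d' * y i₀, fun i => ?_⟩
    apply mul_left_cancel₀ hd0
    rw [mul_add, mul_sub, h1, h1]
    linear_combination ((M + 1) * M + 1 : ℤ) * (y i - y i₀) * hMz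
  have hds : (d : ℤ) * s = ((M + 1) * M + 1) * S - (M + 1) * ((M + 1) * M + 1) * z := by
    obtain ⟨i₀⟩ := ‹Nonempty P›
    have := h1 i₀
    rw [hs] at this
    linear_combination this + ((M + 1) * M + 1 : ℤ) * y i₀ * hMz
  have hSz : (S : ZMod d) = z := by
    have := congrArg (Int.cast : ℤ → ZMod d) h2
    push_cast at this
    simp only [hdM] at this
    simp at this
    exact (sub_eq_zero.1 this.symm)
  have hT : ∑ b, t b - s = ((M + 1) * M + 1) * d' * S - (M + 1) ^ 2 * M * d' * z := by
    apply mul_left_cancel₀ hd0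
    rw [mul_sub, h2, hds]
    linear_combination (((M + 1) * M + 1) * S - (M + 1) ^ 2 * M * z : ℤ) * hMz
  have hone : ((fun _ => 1, 1) : (P → ZMod d) × ZMod d) ∈ extendedCode N d := by
    have h := sum_mem (S := extendedCode N d) (t := Finset.univ) fun b _ => hgen b
    convert h using 1
    ext i
    · have := congrArg (Int.cast : ℤ → ZMod d) (hcol i)
      push_cast at this
      simp [Prod.fst_sum, this, hdM]
    · have := congrArg (Int.cast : ℤ → ZMod d) hX
      push_cast at this
      simp [Prod.snd_sum, this, hdM]
  have hmul : d' • x ∈ extendedCode N d := by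
    have h := sub_mem (sum_mem (S := extendedCode N d) (t := Finset.univ) fun b _ =>
      zsmul_mem (hgen b) (t b)) (zsmul_mem hone s)
    convert h using 1
    ext i
    · have := congrArg (Int.cast : ℤ → ZMod d) (hs i)
      push_cast at this
      simp [Prod.fst_sum, this, hdM, hy]
    · have := congrArg (Int.cast : ℤ → ZMod d) hT
      push_cast at this
      simp [Prod.snd_sum, this, hdM, hSz, hz]
  have hinv : ((d' : ZMod d)⁻¹.val) • (d' • x) = x := by
    have hu : ((d' : ZMod d)⁻¹.val : ZMod d) * d' = 1 := by
      rw [ZMod.natCast_zmod_val, mul_comm, ZMod.coe_mul_inv_eq_one _ hcop]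
    rw [smul_smul]
    ext i
    · change (_ * _ : ℕ) • x.1 i = x.1 i
      rw [nsmul_eq_mul, Nat.cast_mul, hu, one_mul]
    · change (_ * _ : ℕ) • x.2 = x.2
      rw [nsmul_eq_mul, Nat.cast_mul, hu, one_mul]
  rw [← hinv]
  exact nsmul_mem hmul _

end Code

section Graph

variable {V : Type*} [Fintype V] [DecidableEq V] {G : SimpleGraph V} [DecidableRel G.Adj]

theorem SimpleGraph.IsSRGWith.sum_adjMatrix_mul_adjMatrix {v k l μ : ℕ}
    (h : G.IsSRGWith v k l μ) (x y : V) :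
    ∑ z, G.adjMatrix ℤ x z * G.adjMatrix ℤ y z =
      if x = y then (k : ℤ) else if G.Adj x y then (l : ℤ) else μ := by
  have h1 := congrFun₂ (h.matrix_eq (α := ℤ)) x y
  rw [pow_two, Matrix.mul_apply] at h1
  calc ∑ z, G.adjMatrix ℤ x z * G.adjMatrix ℤ y z
      = ∑ z, G.adjMatrix ℤ x z * G.adjMatrix ℤ z y := by
        simp [SimpleGraph.adjMatrix_apply, G.adj_comm]
    _ = _ := by
        rw [h1]
        simp only [Matrix.add_apply, Matrix.smul_apply, SimpleGraph.adjMatrix_apply,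
          Matrix.one_apply, SimpleGraph.compl_adj]
        by_cases hxy : x = y
        · subst hxy; simp
        · by_cases ha : G.Adj x y <;> simp [hxy, ha]

theorem IsCoclique.sum_compl_eq_sum {Y : Finset V} (hY : IsCoclique G Y) {y : V} (hy : y ∈ Y)
    (f : V → ℤ) : ∑ x ∈ Yᶜ, G.adjMatrix ℤ y x * f x = ∑ x, G.adjMatrix ℤ y x * f x := by
  rw [← Finset.sum_add_sum_compl Y, right_eq_add]
  exact Finset.sum_eq_zero fun x hx => by simp [SimpleGraph.adjMatrix_apply, hY y hy x hx]

variable {M : ℕ} {Y : Finset V}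

theorem IsCoclique.sum_compl_adj_mul_adj
    (hs : G.IsSRGWith ((M + 2) * ((M + 1) ^ 2 * M + 1)) ((M + 1) * ((M + 1) * M + 1)) M
      ((M + 1) * M + 1)) (hY : IsCoclique G Y) {y y' : V} (hy : y ∈ Y) (hy' : y' ∈ Y) :
    ∑ x ∈ Yᶜ, G.adjMatrix ℤ y x * G.adjMatrix ℤ y' x =
      (if y = y' then (((M : ℤ) + 1) * M + 1) * M else 0) + ((M + 1) * M + 1) := by
  rw [hY.sum_compl_eq_sum hy, hs.sum_adjMatrix_mul_adjMatrix, if_neg (hY y hy y' hy')]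
  split_ifs <;> push_cast <;> ring

theorem IsCoclique.sum_compl_adj
    (hs : G.IsSRGWith ((M + 2) * ((M + 1) ^ 2 * M + 1)) ((M + 1) * ((M + 1) * M + 1)) M
      ((M + 1) * M + 1)) (hY : IsCoclique G Y) {y : V} (hy : y ∈ Y) :
    ∑ x ∈ Yᶜ, G.adjMatrix ℤ y x = ((M : ℤ) + 1) * ((M + 1) * M + 1) := by
  calc ∑ x ∈ Yᶜ, G.adjMatrix ℤ y x = ∑ x ∈ Yᶜ, G.adjMatrix ℤ y x * G.adjMatrix ℤ y x :=
        Finset.sum_congr rfl fun x _ => by simp [SimpleGraph.adjMatrix_apply]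
    _ = _ := by
        rw [hY.sum_compl_adj_mul_adj hs hy hy, if_pos rfl]
        ring

theorem card_compl_of_card_eq
    (hs : G.IsSRGWith ((M + 2) * ((M + 1) ^ 2 * M + 1)) ((M + 1) * ((M + 1) * M + 1)) M
      ((M + 1) * M + 1)) (hc : Y.card = (M + 1) ^ 2 * M + 1) :
    (Yᶜ.card : ℤ) = (M + 1) * ((M + 1) ^ 2 * M + 1) := by
  have h := Finset.card_add_card_compl Y
  rw [hs.card, hc] at h
  zify at h
  linear_combination h

/-- Every vertex outside a Delsarte coclique has the same number of neighbours inside. -/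
theorem IsCoclique.sum_adj_eq
    (hs : G.IsSRGWith ((M + 2) * ((M + 1) ^ 2 * M + 1)) ((M + 1) * ((M + 1) * M + 1)) M
      ((M + 1) * M + 1)) (hY : IsCoclique G Y) (hc : Y.card = (M + 1) ^ 2 * M + 1)
    {x : V} (hx : x ∈ Yᶜ) : ∑ y ∈ Y, G.adjMatrix ℤ y x = ((M : ℤ) + 1) * M + 1 := by
  set A := G.adjMatrix ℤ with hA
  have hcz : (Y.card : ℤ) = (M + 1) ^ 2 * M + 1 := by rw [hc]; push_cast; ring
  have e1 : ∑ x ∈ Yᶜ, ∑ y ∈ Y, A y x = Y.card * (((M : ℤ) + 1) * ((M + 1) * M + 1)) := by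
    rw [Finset.sum_comm, Finset.sum_congr rfl fun y hy => hY.sum_compl_adj hs hy]
    simp
  have e2 : ∑ x ∈ Yᶜ, (∑ y ∈ Y, A y x) * ∑ y ∈ Y, A y x =
      Y.card * ((((M : ℤ) + 1) * M + 1) * M + Y.card * ((M + 1) * M + 1)) := by
    simp only [Finset.sum_mul_sum]
    rw [Finset.sum_comm]
    have : ∀ y ∈ Y, ∑ x ∈ Yᶜ, ∑ y' ∈ Y, A y x * A y' x =
        (((M : ℤ) + 1) * M + 1) * M + Y.card * ((M + 1) * M + 1) := by
      intro y hy
      rw [Finset.sum_comm, Finset.sum_congr rfl fun y' hy' => hY.sum_compl_adj_mul_adj hs hy hy']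
      simp [Finset.sum_add_distrib, hy]
    rw [Finset.sum_congr rfl this]
    simp
  have e3 : ∑ x ∈ Yᶜ, (∑ y ∈ Y, A y x - (((M : ℤ) + 1) * M + 1)) ^ 2 = 0 := by
    have : ∀ x, (∑ y ∈ Y, A y x - (((M : ℤ) + 1) * M + 1)) ^ 2 =
        (∑ y ∈ Y, A y x) * (∑ y ∈ Y, A y x) - (∑ y ∈ Y, A y x) * (2 * (((M : ℤ) + 1) * M + 1))
          + (((M : ℤ) + 1) * M + 1) ^ 2 := fun x => by ring
    simp only [this, Finset.sum_add_distrib, Finset.sum_sub_distrib, ← Finset.sum_mul, e2, e1,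
      Finset.sum_const, nsmul_eq_mul]
    rw [card_compl_of_card_eq hs hc, hcz]
    ring
  rw [Finset.sum_eq_zero_iff_of_nonneg fun _ _ => sq_nonneg _] at e3
  have := e3 x hx
  rwa [sq_eq_zero_iff, sub_eq_zero] at this

/-- The blocks cut out on a Delsarte coclique by the outside vertices meet in `1` or `M + 1`
points. -/
theorem IsCoclique.sum_adj_mul_adj
    (hs : G.IsSRGWith ((M + 2) * ((M + 1) ^ 2 * M + 1)) ((M + 1) * ((M + 1) * M + 1)) M
      ((M + 1) * M + 1)) (hY : IsCoclique G Y) (hc : Y.card = (M + 1) ^ 2 * M + 1)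
    {x x' : V} (hx : x ∈ Yᶜ) (hx' : x' ∈ Yᶜ) :
    ∑ y ∈ Y, G.adjMatrix ℤ y x * G.adjMatrix ℤ y x' =
      (M : ℤ) + 1 - M * G.adjMatrix ℤ x x' + if x = x' then (M : ℤ) ^ 2 else 0 := by
  set A := G.adjMatrix ℤ with hA
  have hsymm : ∀ a b, A a b = A b a := fun a b => by
    simp [hA, SimpleGraph.adjMatrix_apply, G.adj_comm]
  have hsq : ∀ a b, A a b * A a b = A a b := fun a b => by
    simp [hA, SimpleGraph.adjMatrix_apply]
  have hdiag : ∀ a, A a a = 0 := fun a => by simp [hA]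
  set f : V → ℤ := fun z => ∑ y ∈ Y, A y x * A y z with hf
  have hm := hY.sum_adj_eq hs hc hx
  rw [← hA] at hm
  have hfx : f x = ((M : ℤ) + 1) * M + 1 := by
    simp only [hf, hsq, hm]
  have e1 : ∑ z ∈ Yᶜ, f z = (((M : ℤ) + 1) * M + 1) * (((M : ℤ) + 1) * ((M + 1) * M + 1)) := by
    rw [Finset.sum_comm]
    simp only [← Finset.mul_sum]
    rw [Finset.sum_congr rfl fun y hy => by rw [hA, hY.sum_compl_adj hs hy], ← Finset.sum_mul,
      ← hA, hm]
  have e2 : ∑ z ∈ Yᶜ, f z * f z =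
      (((M : ℤ) + 1) * M + 1) * ((((M : ℤ) + 1) * M + 1) * M)
        + (((M : ℤ) + 1) * M + 1) ^ 2 * (((M : ℤ) + 1) * M + 1) := by
    simp only [hf, Finset.sum_mul_sum]
    rw [Finset.sum_comm]
    have : ∀ y ∈ Y, ∑ z ∈ Yᶜ, ∑ y' ∈ Y, (A y x * A y z) * (A y' x * A y' z) =
        A y x * ((((M : ℤ) + 1) * M + 1) * M)
          + A y x * ((((M : ℤ) + 1) * M + 1) * ((M + 1) * M + 1)) := by
      intro y hy
      rw [Finset.sum_comm]
      have : ∀ y' ∈ Y, ∑ z ∈ Yᶜ, (A y x * A y z) * (A y' x * A y' z) =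
          A y x * ((if y = y' then A y' x * ((((M : ℤ) + 1) * M + 1) * M) else 0)
            + A y' x * ((M + 1) * M + 1)) := by
        intro y' hy'
        have h := hY.sum_compl_adj_mul_adj hs hy hy'
        calc _ = A y x * A y' x * ∑ z ∈ Yᶜ, A y z * A y' z := by
              rw [Finset.mul_sum]
              exact Finset.sum_congr rfl fun z _ => by ring
          _ = _ := by
              rw [hA, h, ← hA]
              split_ifs <;> ring
      rw [Finset.sum_congr rfl this, ← Finset.mul_sum, Finset.sum_add_distrib, ← Finset.sum_mul,
        hm, Finset.sum_ite_eq, if_pos hy, mul_add, ← mul_assoc (A y x), hsq]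
    rw [Finset.sum_congr rfl this, Finset.sum_add_distrib, ← Finset.sum_mul, ← Finset.sum_mul, hm]
    ring
  have e3 : ∑ z ∈ Yᶜ, f z * A x z = (((M : ℤ) + 1) * M + 1) * M := by
    simp only [hf, Finset.sum_mul]
    rw [Finset.sum_comm, ← hm, Finset.sum_mul]
    refine Finset.sum_congr rfl fun y hy => ?_
    simp only [mul_assoc, ← Finset.mul_sum]
    have hyx : y ≠ x := by
      rintro rfl
      exact Finset.mem_compl.1 hx hy
    rw [hA, hY.sum_compl_eq_sum hy, hs.sum_adjMatrix_mul_adjMatrix, if_neg hyx]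
    by_cases h : G.Adj y x <;> simp [h]
  have e4 : ∑ z ∈ Yᶜ, A x z = (((M : ℤ) + 1) * M + 1) * M := by
    have h1 : ∑ z, A x z = ((M : ℤ) + 1) * ((M + 1) * M + 1) := by
      have h := hs.sum_adjMatrix_mul_adjMatrix x x
      rw [← hA] at h
      simp only [hsq, if_true] at h
      rw [h]; push_cast; ring
    have h2 : ∑ z ∈ Y, A x z = ((M : ℤ) + 1) * M + 1 := by
      rw [← hm]
      exact Finset.sum_congr rfl fun y _ => hsymm _ _
    have h3 := Finset.sum_add_sum_compl Y (A x)
    linear_combination h3 - h2 + h1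
  have e5 : ∑ z ∈ Yᶜ, (f z - ((M : ℤ) + 1 - M * A x z + if x = z then (M : ℤ) ^ 2 else 0)) ^ 2
      = 0 := by
    have : ∀ z, (f z - ((M : ℤ) + 1 - M * A x z + if x = z then (M : ℤ) ^ 2 else 0)) ^ 2 =
        f z * f z - f z * (2 * (M + 1)) + f z * A x z * (2 * M) + (M + 1) ^ 2
          + A x z * (M ^ 2 - 2 * (M + 1) * M)
          + (if x = z then M ^ 4 + 2 * (M + 1) * M ^ 2 - 2 * f x * M ^ 2 else 0) := by
      intro z
      by_cases h : x = z
      · subst h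
        simp only [hdiag, if_true]
        ring
      · simp only [if_neg h]
        linear_combination (M : ℤ) ^ 2 * hsq x z
    simp only [this, Finset.sum_add_distrib, Finset.sum_sub_distrib, ← Finset.sum_mul, e1, e2, e3,
      e4, Finset.sum_ite_eq, if_pos hx, Finset.sum_const, nsmul_eq_mul,
      card_compl_of_card_eq hs hc, hfx]
    ring
  rw [Finset.sum_eq_zero_iff_of_nonneg fun _ _ => sq_nonneg _] at e5
  have := e5 x' hx'
  rwa [sq_eq_zero_iff, sub_eq_zero] at this

end Graph

section Sums

theorem AddChar.apply_sum_eq_prod {ι A R : Type*} [AddCommMonoid A] [CommMonoid R] (ψ : AddChar A R)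
    (s : Finset ι) (f : ι → A) : ψ (∑ i ∈ s, f i) = ∏ i ∈ s, ψ (f i) := by
  classical
  induction s using Finset.induction_on with
  | empty => simp
  | insert i s hi ih =>
    rw [Finset.sum_insert hi, Finset.prod_insert hi, AddChar.map_add_eq_mul, ih]

variable {X P : Type*} [Fintype X] [Fintype P]

theorem pow_sum_mul_sum_eq_card [Nonempty P] [DecidableEq P] {N : X → P → ℤ}
    {d d' M : ℕ} [NeZero d] (hM : M = d * d') (hcop : d'.Coprime d)
    (hN : ∀ b b', ((∑ i, N b i * N b' i : ℤ) : ZMod d) = 1)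
    (hcol : ∀ i, ∑ b, N b i = (M + 1) * ((M + 1) * M + 1))
    (hpair : ∀ i j, ∑ b, N b i * N b j =
      (if i = j then (((M : ℤ) + 1) * M + 1) * M else 0) + ((M + 1) * M + 1))
    (hX : (Fintype.card X : ℤ) = (M + 1) * ((M + 1) ^ 2 * M + 1))
    (χ : AddChar (ZMod d) ℂ) (hχ : ∀ a, χ a = 1 → a = 0) (h h' : ZMod d → ℂ)
    (h0 : h 0 = 1) (h0' : h' 0 = 1)
    (hh : ∀ x y, h (x + y) = h x * h y * χ (x * y))
    (hh' : ∀ x y, h' (x + y) = h' x * h' y * χ (-(x * y)))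
    (hgen : ∀ b, (∏ i, h (N b i)) * h' 1 = 1) :
    (∑ x, h x) ^ Fintype.card P * ∑ x, h' x = Nat.card (extendedCode N d) := by
  set φ : (P → ZMod d) × ZMod d → ℂ := fun x => (∏ i, h (x.1 i)) * h' x.2 with hφ
  have hadd : ∀ x y, φ (x + y) = φ x * φ y * χ (lorentzForm d x y) := by
    intro x y
    simp only [hφ, Prod.fst_add, Prod.snd_add, Pi.add_apply, hh, hh', lorentzForm_apply,
      sub_eq_add_neg, AddChar.map_add_eq_mul, AddChar.apply_sum_eq_prod, Finset.prod_mul_distrib]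
    ring
  have hone : ∀ x ∈ extendedCode N d, φ x = 1 := by
    intro x hx
    have hφ0 : φ 0 = 1 := by simp [hφ, h0, h0']
    induction hx using AddSubgroup.closure_induction with
    | mem x hx => obtain ⟨b, rfl⟩ := hx; exact hgen b
    | zero => exact hφ0
    | add x y hx hy h1 h2 =>
      rw [hadd, h1, h2, lorentzForm_eq_zero_of_mem hN hx hy]
      simp
    | neg x hx h1 =>
      have := hadd x (-x)
      rw [add_neg_cancel, hφ0, h1, map_neg, lorentzForm_eq_zero_of_mem hN hx hx] at this
      simpa using this.symm
  rw [← sum_char_quadratic_eq_card (extendedCode N d) φ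
    (fun x => χ.compAddMonoidHom (lorentzForm d x))]
  · rw [Fintype.sum_prod_type]
    simp only [hφ, ← Finset.mul_sum, ← Finset.sum_mul]
    congr 1
    rw [← Finset.card_univ, ← Finset.prod_const, Finset.prod_univ_sum, Fintype.piFinset_univ]
  · intro x c hc
    rw [hadd, hone c hc, mul_one]
    rfl
  · intro x hx
    refine ⟨hone x hx, fun c hc => ?_⟩
    simp [lorentzForm_eq_zero_of_mem hN hx hc]
  · intro x hx
    exact mem_extendedCode_of_orthogonal (NeZero.ne d) hM hcop hcol hpair hX x
      fun c hc => hχ _ (hx c hc)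

theorem half_mod_four_eq_three [Nonempty P] [DecidableEq P] {N : X → P → ℤ} {M u : ℕ}
    (hM : M = 2 * u) (hu : Odd u) (h01 : ∀ b i, N b i = 0 ∨ N b i = 1)
    (hN : ∀ b b', (M : ℤ) ∣ ∑ i, N b i * N b' i - 1)
    (hrow : ∀ b, ∑ i, N b i = (M + 1) * M + 1)
    (hcol : ∀ i, ∑ b, N b i = (M + 1) * ((M + 1) * M + 1))
    (hpair : ∀ i j, ∑ b, N b i * N b j =
      (if i = j then (((M : ℤ) + 1) * M + 1) * M else 0) + ((M + 1) * M + 1))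
    (hP : Fintype.card P = (M + 1) ^ 2 * M + 1)
    (hX : (Fintype.card X : ℤ) = (M + 1) * ((M + 1) ^ 2 * M + 1)) : u % 4 = 3 := by
  by_contra hu3
  have hu1 : u % 4 = 1 := by
    have := Nat.odd_iff.1 hu
    omega
  set χ := ZMod.stdAddChar (N := 2)
  have hχ : ∀ a, χ a = 1 → a = 0 := fun a ha =>
    ZMod.injective_stdAddChar (ha.trans (AddChar.map_zero_eq_one _).symm)
  have hχ1 : χ 1 = -1 := by
    have h2 : χ 1 * χ 1 = 1 := by
      rw [← AddChar.map_add_eq_mul, show (1 + 1 : ZMod 2) = 0 from rfl, AddChar.map_zero_eq_one]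
    rcases mul_self_eq_one_iff.1 h2 with h | h
    · exact absurd (hχ 1 h) (by decide)
    · exact h
  set h : ZMod 2 → ℂ := fun x => if x = 0 then 1 else Complex.I with hh
  have hadd : ∀ x y, h (x + y) = h x * h y * χ (x * y) := by
    intro x y
    have h2 : ∀ x : ZMod 2, x = 0 ∨ x = 1 := by decide
    rcases h2 x with rfl | rfl <;> rcases h2 y with rfl | rfl <;>
      simp [hh, hχ1, show (1 + 1 : ZMod 2) = 0 from rfl]
  have hsum : ∑ x, h x = 1 + Complex.I := by
    rw [show (Finset.univ : Finset (ZMod 2)) = {0, 1} from rfl]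
    simp [hh]
  have key := pow_sum_mul_sum_eq_card (d := 2) (d' := u) hM (Nat.coprime_two_right.2 hu)
    (fun b b' => by
      have h1 : ((2 : ℕ) : ℤ) ∣ ∑ i, N b i * N b' i - 1 :=
        (Int.natCast_dvd_natCast.2 ⟨u, hM⟩).trans (hN b b')
      have h2 := (ZMod.intCast_zmod_eq_zero_iff_dvd _ _).2 h1
      rw [Int.cast_sub, sub_eq_zero] at h2
      simpa using h2)
    hcol hpair hX χ hχ h h (by simp [hh]) (by simp [hh]) hadd
    (fun x y => by rw [hadd, ZMod.neg_eq_self_mod_two])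
    (fun b => by
      have h1 : ∀ i, h (N b i) = Complex.I ^ (N b i).toNat := by
        intro i
        rcases h01 b i with hi | hi <;> simp [hi, hh]
      have h2 : ∑ i, (N b i).toNat = (M + 1) * M + 1 := by
        zify
        rw [← hrow b]
        refine Finset.sum_congr rfl fun i _ => ?_
        rcases h01 b i with hi | hi <;> simp [hi]
      simp only [h1]
      rw [Finset.prod_pow_eq_pow_sum, h2]
      simp only [hh, one_ne_zero, if_false]
      rw [← pow_succ, Complex.I_pow_eq_pow_mod]
      have : ((M + 1) * M + 1 + 1) % 4 = 0 := by
        have : M % 4 = 2 := by omega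
        simp [Nat.add_mod, Nat.mul_mod, this]
      rw [this, pow_zero])
  rw [hsum, ← pow_succ, hP] at key
  obtain ⟨j, hj⟩ : ∃ j, (M + 1) ^ 2 * M + 1 + 1 = 2 * (4 * j + 2) := by
    have h1 : ((M + 1) ^ 2 * M + 2) % 8 = 4 := by
      have h2 : M % 8 = 2 := by omega
      simp [Nat.add_mod, Nat.mul_mod, Nat.pow_mod, h2]
    exact ⟨((M + 1) ^ 2 * M + 2) / 8, by omega⟩
  have hsq : (1 + Complex.I) ^ 2 = 2 * Complex.I := by
    linear_combination Complex.I_sq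
  rw [hj, pow_mul, hsq, mul_pow, pow_add Complex.I, pow_mul Complex.I, Complex.I_pow_four,
    one_pow, one_mul, Complex.I_sq] at key
  have hneg : ((2 ^ (4 * j + 2) + Nat.card (extendedCode N 2) : ℕ) : ℂ) = 0 := by
    push_cast
    linear_combination -key
  rw [Nat.cast_eq_zero] at hneg
  have : 0 < 2 ^ (4 * j + 2) := by positivity
  omega

theorem gaussSum_mul_conj {u : ℕ} [NeZero u] (hu : Odd u) :
    (∑ x : ZMod u, ZMod.stdAddChar (x * x)) * ∑ x : ZMod u, ZMod.stdAddChar (-(x * x)) = u := by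
  have h2 : IsUnit (2 : ZMod u) := by
    have := (ZMod.isUnit_iff_coprime 2 u).2 (Nat.coprime_two_left.2 hu)
    exact_mod_cast this
  calc _ = ∑ y : ZMod u, ∑ x : ZMod u, ZMod.stdAddChar (x * x - y * y) := by
        rw [Finset.sum_mul_sum, Finset.sum_comm]
        simp only [sub_eq_add_neg, AddChar.map_add_eq_mul]
    _ = ∑ y : ZMod u, ∑ x : ZMod u, ZMod.stdAddChar (x * x) * ZMod.stdAddChar (y * (2 * x)) := by
        refine Finset.sum_congr rfl fun y _ => ?_
        rw [← Equiv.sum_comp (Equiv.addRight y)]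
        refine Finset.sum_congr rfl fun x _ => ?_
        rw [← AddChar.map_add_eq_mul, Equiv.coe_addRight]
        congr 1
        ring
    _ = ∑ x : ZMod u, ZMod.stdAddChar (x * x) * if x = 0 then (u : ℂ) else 0 := by
        rw [Finset.sum_comm]
        refine Finset.sum_congr rfl fun x _ => ?_
        rw [← Finset.mul_sum, AddChar.sum_mulShift _ (ZMod.isPrimitive_stdAddChar u), ZMod.card]
        simp [h2.mul_right_eq_zero]
    _ = u := by simp

theorem gaussSum_eq_one_add_two_mul {u : ℕ} [NeZero u] (hu : Odd u) :
    ∃ a : ℂ, IsIntegral ℤ a ∧ ∑ x : ZMod u, ZMod.stdAddChar (x * x) = 1 + 2 * a := by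
  obtain ⟨v, rfl⟩ := hu
  set f : ZMod (2 * v + 1) → ℂ := fun x => ZMod.stdAddChar (x * x) with hf
  have hint : ∀ x, IsIntegral ℤ (f x) := by
    intro x
    refine IsIntegral.of_pow (n := 2 * v + 1) (by omega) ?_
    rw [hf, ← AddChar.map_nsmul_eq_pow, nsmul_eq_mul, CharP.cast_eq_zero, zero_mul,
      AddChar.map_zero_eq_one]
    exact isIntegral_one
  refine ⟨∑ i ∈ Finset.range v, f ((i + 1 : ℕ) : ZMod (2 * v + 1)),
    IsIntegral.sum _ fun i _ => hint _, ?_⟩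
  have h1 : ∑ x, f x = ∑ i ∈ Finset.range (2 * v + 1), f (i : ZMod (2 * v + 1)) := by
    rw [← Fin.sum_univ_eq_sum_range (fun i : ℕ => f (i : ZMod (2 * v + 1)))]
    exact Finset.sum_congr rfl fun x _ => by
      congr 1
      exact (ZMod.natCast_zmod_val (n := 2 * v + 1) x).symm
  have h2 : ∑ i ∈ Finset.range v, f ((v + i + 1 : ℕ) : ZMod (2 * v + 1)) =
      ∑ i ∈ Finset.range v, f ((i + 1 : ℕ) : ZMod (2 * v + 1)) := by
    rw [← Finset.sum_range_reflect]
    refine Finset.sum_congr rfl fun i hi => ?_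
    have hi := Finset.mem_range.1 hi
    have h3 : ((v + (v - 1 - i) + 1 : ℕ) : ZMod (2 * v + 1)) = -((i + 1 : ℕ) : ZMod (2 * v + 1)) := by
      rw [eq_neg_iff_add_eq_zero, ← Nat.cast_add,
        show v + (v - 1 - i) + 1 + (i + 1) = 2 * v + 1 by omega, CharP.cast_eq_zero]
    rw [h3, hf]
    simp only [neg_mul_neg]
  have h4 : ∀ F : ℕ → ℂ, ∑ i ∈ Finset.range (2 * v + 1), F i =
      ∑ i ∈ Finset.range v, F (i + 1) + ∑ i ∈ Finset.range v, F (v + i + 1) + F 0 := by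
    intro F
    rw [Finset.sum_range_succ', two_mul v, Finset.sum_range_add]
  rw [h1, h4, h2]
  simp [hf]
  ring

theorem pow_modEq_one_of_gaussSum_pow_eq {u k : ℕ} {g a : ℂ} (ha : IsIntegral ℤ a)
    (hg : g = 1 + 2 * a) (h : (g ^ 2) ^ k = (u : ℂ) ^ k) : u ^ k ≡ 1 [MOD 4] := by
  have hpow : ∀ j : ℕ, ∃ b : ℂ, IsIntegral ℤ b ∧ (g ^ 2) ^ j = 1 + 4 * b := by
    intro j
    induction j with
    | zero => exact ⟨0, isIntegral_zero, by simp⟩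
    | succ j ih =>
      obtain ⟨b, hb, hj⟩ := ih
      have h4 : IsIntegral ℤ (4 : ℂ) := by exact_mod_cast isIntegral_natCast (R := ℤ) (B := ℂ) 4
      have hc := ha.add (ha.mul ha)
      refine ⟨b + (a + a * a) + 4 * (b * (a + a * a)),
        (hb.add hc).add (h4.mul (hb.mul hc)), ?_⟩
      rw [pow_succ, hj, hg]
      ring
  obtain ⟨b, hb, hk⟩ := hpow k
  have hb' : b = algebraMap ℚ ℂ (((u : ℚ) ^ k - 1) / 4) := by
    have : (u : ℂ) ^ k = 1 + 4 * b := h.symm.trans hk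
    simp
    linear_combination -this / 4
  rw [hb', isIntegral_algebraMap_iff (algebraMap ℚ ℂ).injective,
    IsIntegrallyClosed.isIntegral_iff] at hb
  obtain ⟨y, hy⟩ := hb
  have : (u : ℤ) ^ k - 1 = 4 * y := by
    have h5 : ((u : ℚ) ^ k - 1) = 4 * y := by
      simp at hy
      linear_combination -4 * hy
    exact_mod_cast h5
  refine (Nat.modEq_iff_dvd.2 ⟨y, ?_⟩).symm
  push_cast
  exact this

theorem half_mod_four_eq_one [Nonempty P] [DecidableEq P] {N : X → P → ℤ} {M u : ℕ}
    (hM : M = 2 * u) (hu : Odd u)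
    (hN : ∀ b b', (M : ℤ) ∣ ∑ i, N b i * N b' i - 1)
    (hcol : ∀ i, ∑ b, N b i = (M + 1) * ((M + 1) * M + 1))
    (hpair : ∀ i j, ∑ b, N b i * N b j =
      (if i = j then (((M : ℤ) + 1) * M + 1) * M else 0) + ((M + 1) * M + 1))
    (hP : Fintype.card P = (M + 1) ^ 2 * M + 1)
    (hX : (Fintype.card X : ℤ) = (M + 1) * ((M + 1) ^ 2 * M + 1)) : u % 4 = 1 := by
  have : NeZero u := ⟨by rintro rfl; simp at hu⟩
  have h2 : IsUnit (2 : ZMod u) := by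
    have := (ZMod.isUnit_iff_coprime 2 u).2 (Nat.coprime_two_left.2 hu)
    exact_mod_cast this
  set ψ := ZMod.stdAddChar (N := u) with hψ
  have hone : ∀ b b', ((∑ i, N b i * N b' i : ℤ) : ZMod u) = 1 := by
    intro b b'
    have h1 : (u : ℤ) ∣ ∑ i, N b i * N b' i - 1 :=
      (Int.natCast_dvd_natCast.2 ⟨2, by rw [hM, mul_comm]⟩).trans (hN b b')
    have h3 := (ZMod.intCast_zmod_eq_zero_iff_dvd _ _).2 h1
    rw [Int.cast_sub, sub_eq_zero] at h3
    simpa using h3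
  have key := pow_sum_mul_sum_eq_card (d := u) (d' := 2) (by rw [hM, mul_comm])
    (Nat.coprime_two_left.2 hu) hone hcol hpair hX (ψ.mulShift 2)
    (fun a ha => by
      rw [AddChar.mulShift_apply] at ha
      have := ZMod.injective_stdAddChar (ha.trans (AddChar.map_zero_eq_one _).symm)
      exact h2.mul_right_eq_zero.1 this)
    (fun x => ψ (x * x)) (fun x => ψ (-(x * x))) (by simp) (by simp)
    (fun x y => by
      simp only [AddChar.mulShift_apply, ← AddChar.map_add_eq_mul]
      congr 1
      ring)
    (fun x y => by
      simp only [AddChar.mulShift_apply, ← AddChar.map_add_eq_mul]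
      congr 1
      ring)
    (fun b => by
      have := hone b b
      push_cast at this
      rw [← AddChar.apply_sum_eq_prod, this, ← AddChar.map_add_eq_mul]
      simp)
  have hgg := gaussSum_mul_conj hu
  obtain ⟨a, ha, hga⟩ := gaussSum_eq_one_add_two_mul hu
  rw [← hψ] at hgg hga
  have hconj : ∑ x : ZMod u, ψ (-(x * x)) = (starRingEnd ℂ) (∑ x : ZMod u, ψ (x * x)) := by
    rw [map_sum]
    exact Finset.sum_congr rfl fun x _ => AddChar.map_neg_eq_conj _ _
  rw [hconj] at key hgg
  generalize (∑ x : ZMod u, ψ (x * x)) = g at key hgg hga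
  obtain ⟨k, hk, hkn⟩ : ∃ k, Odd k ∧ (M + 1) ^ 2 * M + 1 = 2 * k + 1 := by
    refine ⟨(2 * u + 1) ^ 2 * u, Odd.mul (Odd.pow (by simp)) hu, ?_⟩
    rw [hM]
    ring
  rw [hP, hkn] at key
  generalize Nat.card (extendedCode N u) = K at key
  have hKsq : (K : ℂ) ^ 2 = ((u : ℂ) ^ (k + 1)) ^ 2 := by
    have key' := congrArg (starRingEnd ℂ) key
    simp only [map_mul, map_pow, Complex.conj_conj, map_natCast] at key'
    calc (K : ℂ) ^ 2 = (g ^ (2 * k + 1) * starRingEnd ℂ g) * (starRingEnd ℂ g ^ (2 * k + 1) * g) := by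
          rw [key, key', sq]
      _ = ((g * starRingEnd ℂ g) ^ (k + 1)) ^ 2 := by ring
      _ = _ := by rw [hgg]
  have hK : K = u ^ (k + 1) := by
    have : K ^ 2 = (u ^ (k + 1)) ^ 2 := by exact_mod_cast hKsq
    exact Nat.pow_left_injective two_ne_zero this
  have hu0 : (u : ℂ) ≠ 0 := by exact_mod_cast NeZero.ne u
  have hpow : (g ^ 2) ^ k = (u : ℂ) ^ k := by
    apply mul_right_cancel₀ hu0
    rw [hK] at key
    push_cast at key
    rw [← pow_succ, ← key]
    nth_rewrite 1 [← hgg]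
    ring
  have hmod := pow_modEq_one_of_gaussSum_pow_eq ha hga hpow
  by_contra h1
  have h3 : u % 4 = 3 := by
    have := Nat.odd_iff.1 hu
    omega
  obtain ⟨j, rfl⟩ := hk
  have : u ^ (2 * j + 1) % 4 = 1 % 4 := hmod
  rw [pow_succ, pow_mul, Nat.mul_mod, Nat.pow_mod, Nat.pow_mod u, h3] at this
  norm_num at this

end Sums

theorem gq_q_qsq_sub_q_no_ovoid_of_special_form {V : Type*} [Fintype V] [DecidableEq V]
    (G : SimpleGraph V) [DecidableRel G.Adj] (q p e ℓ : ℕ) (hp : p.Prime) (hpmod : p % 4 = 3)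
    (he : Odd e) (hepos : 0 < e) (hℓpos : 0 < ℓ) (hℓmod : ℓ % 4 = 2)
    (hqdef : q = ℓ * p ^ e + 1)
    (hsrg : G.IsSRGWith ((q + 1) * (q ^ 3 - q ^ 2 + 1)) (q * (q ^ 2 - q + 1))
      (q - 1) (q ^ 2 - q + 1)) :
    ¬ ∃ Y : Finset V, IsCoclique G Y ∧ Y.card = q ^ 3 - q ^ 2 + 1 := by
  rintro ⟨Y, hY, hc⟩
  obtain ⟨M, hqM⟩ : ∃ M, q = M + 1 := ⟨_, hqdef⟩
  obtain ⟨u, hu, hM⟩ : ∃ u, Odd u ∧ M = 2 * u := by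
    have hodd : Odd (p ^ e) := Odd.pow (Nat.odd_iff.2 (by omega))
    have hMe : M = ℓ * p ^ e := by omega
    refine ⟨ℓ / 2 * p ^ e, Odd.mul (Nat.odd_iff.2 (by omega)) hodd, ?_⟩
    rw [hMe, ← mul_assoc]
    congr 1
    omega
  clear hqdef
  subst hqM
  have e1 : (M + 1) ^ 3 - (M + 1) ^ 2 + 1 = (M + 1) ^ 2 * M + 1 := by
    rw [show (M + 1) ^ 3 = (M + 1) ^ 2 * M + (M + 1) ^ 2 by ring, Nat.add_sub_cancel]
  have e2 : (M + 1) ^ 2 - (M + 1) + 1 = (M + 1) * M + 1 := by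
    rw [show (M + 1) ^ 2 = (M + 1) * M + (M + 1) by ring, Nat.add_sub_cancel]
  rw [e1] at hc
  rw [e1, e2, Nat.add_sub_cancel] at hsrg
  have hP : Fintype.card Y = (M + 1) ^ 2 * M + 1 := by rw [Fintype.card_coe, hc]
  have : Nonempty Y := Fintype.card_pos_iff.1 (by omega)
  set N : {x // x ∈ Yᶜ} → Y → ℤ := fun x y => G.adjMatrix ℤ y x with hNdef
  have hX : (Fintype.card {x // x ∈ Yᶜ} : ℤ) = (M + 1) * ((M + 1) ^ 2 * M + 1) := by
    rw [Fintype.card_coe, card_compl_of_card_eq hsrg hc]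
  have hcol : ∀ i, ∑ b, N b i = (M + 1) * ((M + 1) * M + 1) := by
    intro i
    rw [← hY.sum_compl_adj hsrg i.2]
    exact Finset.sum_coe_sort Yᶜ fun x => G.adjMatrix ℤ i x
  have hpair : ∀ i j, ∑ b, N b i * N b j =
      (if i = j then (((M : ℤ) + 1) * M + 1) * M else 0) + ((M + 1) * M + 1) := by
    intro i j
    have h := hY.sum_compl_adj_mul_adj hsrg i.2 j.2
    simp only [← Subtype.ext_iff] at h
    rw [← h]
    exact Finset.sum_coe_sort Yᶜ fun x => G.adjMatrix ℤ i x * G.adjMatrix ℤ j x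
  have hrow : ∀ b, ∑ i, N b i = (M + 1) * M + 1 := by
    intro b
    rw [← hY.sum_adj_eq hsrg hc b.2]
    exact Finset.sum_coe_sort Y fun y => G.adjMatrix ℤ y b
  have hN : ∀ b b', (M : ℤ) ∣ ∑ i, N b i * N b' i - 1 := by
    intro b b'
    have h : ∑ i, N b i * N b' i = ∑ y ∈ Y, G.adjMatrix ℤ y b * G.adjMatrix ℤ y b' :=
      Finset.sum_coe_sort Y fun y => G.adjMatrix ℤ y b * G.adjMatrix ℤ y b'
    rw [h, hY.sum_adj_mul_adj hsrg hc b.2 b'.2]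
    refine ⟨1 - G.adjMatrix ℤ b b' + if (b : V) = b' then (M : ℤ) else 0, ?_⟩
    split_ifs <;> ring
  have h01 : ∀ b i, N b i = 0 ∨ N b i = 1 := by
    intro b i
    simp only [hNdef, SimpleGraph.adjMatrix_apply]
    split_ifs <;> simp
  have h3 := half_mod_four_eq_three hM hu h01 hN hrow hcol hpair hP hX
  have h1 := half_mod_four_eq_one hM hu hN hcol hpair hP hX
  omega
end

section
/- Let q > 2 be an integer and let Γ be a strongly regular graph with parameters v = (q + 1)(q³ − q² + 1), k = q(q² − q + 1), λ = q − 1, μ = q² − q + 1 (the parameters of the point graph of a generalized quadrangle of order (q, q² − q)). If the automorphism group of Γ acts transitively on the vertices of Γ, then Γ contains no coclique of size q³ − q² + 1 (i.e., no Delsarte coclique). In particular, a point-transitive generalized quadrangle of order (q, q² − q) with q > 2 does not possess an ovoid. -/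
open Finset

namespace SimpleGraph

variable {V : Type*} (G : SimpleGraph V) [DecidableRel G.Adj]

/-- The number of neighbours of `x` in `S`, as an integer. -/
def degreeIn (S : Finset V) (x : V) : ℤ := ∑ y ∈ S, if G.Adj x y then 1 else 0

variable {G}

theorem degreeIn_eq_card_filter (S : Finset V) (x : V) :
    G.degreeIn S x = #(S.filter (G.Adj x)) := by
  simp [degreeIn]

theorem sum_degreeIn_comm (S T : Finset V) :
    ∑ x ∈ T, G.degreeIn S x = ∑ y ∈ S, G.degreeIn T y := by
  simp only [degreeIn]
  rw [sum_comm]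
  simp only [G.adj_comm]

theorem degreeIn_eq_zero {S : Finset V} {x : V} (h : ∀ y ∈ S, ¬ G.Adj x y) :
    G.degreeIn S x = 0 :=
  sum_eq_zero fun y hy => if_neg (h y hy)

theorem degreeIn_sdiff_add_inter [DecidableEq V] (S T : Finset V) (x : V) :
    G.degreeIn (S \ T) x + G.degreeIn (S ∩ T) x = G.degreeIn S x := by
  rw [degreeIn, degreeIn, degreeIn, add_comm, sum_inter_add_sum_sdiff]

variable [Fintype V]

theorem sum_adj_mul_adj (x y : V) :
    ∑ z, ((if G.Adj z x then 1 else 0) * (if G.Adj z y then 1 else 0) : ℤ) =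
      Fintype.card (G.commonNeighbors x y) := by
  simp only [← ite_and, mul_ite, mul_one, mul_zero, sum_boole]
  rw [← Set.toFinset_card]
  congr 2
  ext z
  simp [mem_commonNeighbors, G.adj_comm, and_comm]

variable {v k l m : ℕ}

theorem IsSRGWith.degreeIn_univ (h : G.IsSRGWith v k l m) (x : V) :
    G.degreeIn univ x = k := by
  have := h.regular.degree_eq x
  rw [degreeIn_eq_card_filter, ← this, ← G.card_neighborFinset_eq_degree,
    neighborFinset_eq_filter]

theorem IsSRGWith.sum_degreeIn (h : G.IsSRGWith v k l m) (S : Finset V) :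
    ∑ x, G.degreeIn S x = #S * k := by
  rw [sum_degreeIn_comm]
  simp [h.degreeIn_univ]

theorem IsSRGWith.degreeIn_neighborFinset (h : G.IsSRGWith v k l m) {x y : V}
    (hxy : G.Adj x y) : G.degreeIn (G.neighborFinset x) y = l := by
  rw [← h.of_adj x y hxy, ← sum_adj_mul_adj, degreeIn, neighborFinset_eq_filter, sum_filter]
  refine sum_congr rfl fun z _ => ?_
  simp only [G.adj_comm]
  split_ifs <;> simp

theorem IsSRGWith.sum_degreeIn_sq [DecidableEq V] (h : G.IsSRGWith v k l m) {S : Finset V}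
    (hS : IsCoclique G S) :
    ∑ x, G.degreeIn S x ^ 2 = #S * k + #S * (#S - 1) * m := by
  have hcomm : ∀ y ∈ S, ∀ z ∈ S, (Fintype.card (G.commonNeighbors y z) : ℤ) =
      m + if y = z then (k - m : ℤ) else 0 := by
    intro y hy z hz
    split_ifs with hyz
    · subst hyz
      rw [← sum_adj_mul_adj]
      simp only [← ite_and, mul_ite, mul_one, mul_zero, and_self]
      have := h.degreeIn_univ y
      simp only [degreeIn, G.adj_comm y] at this
      rw [this]
      ring
    · rw [h.of_not_adj hyz (hS y hy z hz), add_zero]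
  calc ∑ x, G.degreeIn S x ^ 2
      = ∑ y ∈ S, ∑ z ∈ S, (Fintype.card (G.commonNeighbors y z) : ℤ) := by
        simp only [← sum_adj_mul_adj, sq, degreeIn, sum_mul_sum]
        rw [sum_comm]
        exact sum_congr rfl fun y _ => sum_comm
    _ = ∑ y ∈ S, ∑ z ∈ S, (m + if y = z then (k - m : ℤ) else 0) :=
        sum_congr rfl fun y hy => sum_congr rfl fun z hz => hcomm y hy z hz
    _ = #S * k + #S * (#S - 1) * m := by
        simp only [sum_add_distrib, sum_ite_eq, sum_const, nsmul_eq_mul, sum_ite_mem,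
          inter_self]
        ring

end SimpleGraph

namespace DelsarteCoclique

open SimpleGraph

variable {V : Type*} {G : SimpleGraph V}

/-- A coclique of size `q³ - q² + 1`. -/
structure IsDelsarte (G : SimpleGraph V) (q : ℤ) (A : Finset V) : Prop where
  isCoclique : IsCoclique G A
  card : (#A : ℤ) = q ^ 3 - q ^ 2 + 1

variable {q : ℤ} {A B C : Finset V}

theorem IsDelsarte.exists_mem (hA : IsDelsarte G q A) (hq : 2 < q)
    (htrans : ∀ x y : V, ∃ φ : G ≃g G, φ x = y) (x : V) :
    ∃ B, IsDelsarte G q B ∧ x ∈ B := by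
  have hpos : (0 : ℤ) < #A := by rw [hA.card]; nlinarith [sq_nonneg q]
  obtain ⟨a, ha⟩ := card_pos.1 (by exact_mod_cast hpos : 0 < #A)
  obtain ⟨φ, rfl⟩ := htrans a x
  refine ⟨A.map φ.toEquiv.toEmbedding, ⟨?_, by rw [card_map, hA.card]⟩,
    mem_map_of_mem φ.toEquiv.toEmbedding ha⟩
  intro y hy z hz
  obtain ⟨y', hy', rfl⟩ := mem_map.1 hy
  obtain ⟨z', hz', rfl⟩ := mem_map.1 hz
  exact fun h => hA.isCoclique y' hy' z' hz' (φ.map_adj_iff.1 h)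

variable [DecidableRel G.Adj]

theorem IsDelsarte.degreeIn_self (hA : IsDelsarte G q A) {S : Finset V} (hS : S ⊆ A) {x : V}
    (hx : x ∈ A) : G.degreeIn S x = 0 :=
  degreeIn_eq_zero fun y hy => hA.isCoclique x hx y (hS hy)

variable [Fintype V]

/-- The strongly regular graphs with the parameters of the point graph of a generalized quadrangle
of order `(q, q² - q)`, in terms of integers. -/
structure IsGQGraph (G : SimpleGraph V) [DecidableRel G.Adj] (q : ℤ) : Prop where
  card : (Fintype.card V : ℤ) = (q + 1) * (q ^ 3 - q ^ 2 + 1)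
  sum_degreeIn (S : Finset V) : ∑ x, G.degreeIn S x = #S * (q * (q ^ 2 - q + 1))
  degreeIn_univ (x : V) : G.degreeIn univ x = q * (q ^ 2 - q + 1)
  degreeIn_neighborFinset (x y : V) (h : G.Adj x y) :
    G.degreeIn (G.neighborFinset x) y = q - 1
  sum_degreeIn_sq (S : Finset V) (hS : IsCoclique G S) :
    ∑ x, G.degreeIn S x ^ 2 =
      #S * (q * (q ^ 2 - q + 1)) + #S * (#S - 1) * (q ^ 2 - q + 1)

theorem IsGQGraph.of_isSRGWith {q : ℕ} (hq : 1 ≤ q)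
    (h : G.IsSRGWith ((q + 1) * (q ^ 3 - q ^ 2 + 1)) (q * (q ^ 2 - q + 1))
      (q - 1) (q ^ 2 - q + 1)) : IsGQGraph G (q : ℤ) := by
  have h₂ : q ≤ q ^ 2 := Nat.le_self_pow two_ne_zero q
  have h₃ : q ^ 2 ≤ q ^ 3 := Nat.pow_le_pow_right hq (by norm_num)
  refine ⟨?_, fun S => ?_, fun x => ?_, fun x y hxy => ?_, fun S hS => ?_⟩
  · rw [h.card]; push_cast [h₂, h₃]; ring
  · rw [h.sum_degreeIn]; push_cast [h₂]; ring
  · rw [h.degreeIn_univ]; push_cast [h₂]; ring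
  · rw [h.degreeIn_neighborFinset hxy]; push_cast [hq]; ring
  · classical
    rw [h.sum_degreeIn_sq hS]; push_cast [h₂]; ring

variable [DecidableEq V]

/-- Equality in the ratio bound: an outside vertex has exactly `-e⁻` neighbours in a Delsarte
coclique. -/
theorem IsDelsarte.degreeIn_eq (hA : IsDelsarte G q A) (hG : IsGQGraph G q) {x : V}
    (hx : x ∉ A) : G.degreeIn A x = q ^ 2 - q + 1 := by
  have hsum : ∑ x ∈ Aᶜ, (G.degreeIn A x - (q ^ 2 - q + 1)) ^ 2 = 0 := by
    have hin : ∑ x ∈ A, (G.degreeIn A x - (q ^ 2 - q + 1)) ^ 2 =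
        #A * (q ^ 2 - q + 1) ^ 2 := by
      rw [sum_congr rfl fun x hx => by rw [hA.degreeIn_self Subset.rfl hx]]
      rw [sum_const, nsmul_eq_mul]
      ring
    have hall : ∑ x, (G.degreeIn A x - (q ^ 2 - q + 1)) ^ 2 =
        ∑ x, G.degreeIn A x ^ 2 - 2 * (q ^ 2 - q + 1) * ∑ x, G.degreeIn A x +
          Fintype.card V * (q ^ 2 - q + 1) ^ 2 := by
      simp only [sub_sq (G.degreeIn A _), sum_add_distrib, sum_sub_distrib, mul_sum, sum_const,
        nsmul_eq_mul, card_univ]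
      congr 2
      exact sum_congr rfl fun x _ => by ring
    rw [hG.sum_degreeIn_sq A hA.isCoclique, hG.sum_degreeIn, hG.card,
      ← sum_add_sum_compl A, hin, hA.card] at hall
    linear_combination hall
  have := (sum_eq_zero_iff_of_nonneg fun x _ => sq_nonneg _).1 hsum x (mem_compl.2 hx)
  linear_combination pow_eq_zero_iff two_ne_zero |>.1 this

/-- Two vertices outside a Delsarte coclique have a number of common neighbours in it that depends
only on whether they are adjacent. -/
theorem IsDelsarte.degreeIn_filter_eq (hA : IsDelsarte G q A) (hG : IsGQGraph G q) {x u : V}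
    (hx : x ∉ A) (hu : u ∉ A) (hxu : u ≠ x) :
    G.degreeIn (A.filter (G.Adj x)) u = if G.Adj x u then 1 else q := by
  set T := A.filter (G.Adj x) with hT
  have hTA : T ⊆ A := filter_subset _ _
  have hTc : IsCoclique G T := fun y hy z hz => hA.isCoclique y (hTA hy) z (hTA hz)
  have hTcard : (#T : ℤ) = q ^ 2 - q + 1 := by
    rw [hT, ← degreeIn_eq_card_filter, hA.degreeIn_eq hG hx]
  have hTx : G.degreeIn T x = q ^ 2 - q + 1 := by
    rw [degreeIn_eq_card_filter, ← hTcard, hT, filter_filter]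
    simp
  have hsplit (f : V → ℤ) : ∑ w, f w = ∑ w ∈ A, f w + f x +
      ∑ w ∈ (Aᶜ.erase x).filter (G.Adj x), f w +
      ∑ w ∈ (Aᶜ.erase x).filter (¬ G.Adj x ·), f w := by
    rw [add_assoc, sum_filter_add_sum_filter_not, add_assoc,
      add_sum_erase _ _ (mem_compl.2 hx), sum_add_sum_compl]
  have hnbr (f : V → ℤ) : ∑ w ∈ G.neighborFinset x, f w =
      ∑ w ∈ T, f w + ∑ w ∈ (Aᶜ.erase x).filter (G.Adj x), f w := by
    rw [← sum_inter_add_sum_sdiff _ A]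
    congr 2
    · ext w; simp [hT, and_comm]
    · ext w
      simp only [mem_sdiff, mem_neighborFinset, mem_filter, mem_erase, mem_compl]
      exact ⟨fun h => ⟨⟨h.1.ne', h.2⟩, h.1⟩, fun h => ⟨h.2, h.1.2⟩⟩
  have hzero (w : V) (hw : w ∈ A) : G.degreeIn T w = 0 := hA.degreeIn_self hTA hw
  have hN : ∑ w ∈ G.neighborFinset x, G.degreeIn T w = (q ^ 2 - q + 1) * (q - 1) := by
    rw [sum_degreeIn_comm, sum_congr rfl fun y hy =>
      hG.degreeIn_neighborFinset x y (mem_filter.1 hy).2]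
    rw [sum_const, nsmul_eq_mul, hTcard]
  have hNcard : ∑ w ∈ G.neighborFinset x, (1 : ℤ) = q * (q ^ 2 - q + 1) := by
    rw [← hG.degreeIn_univ x, degreeIn, neighborFinset_eq_filter, sum_filter]
  have hs₁ := hsplit 1
  have hs₂ := hsplit (G.degreeIn T)
  have hs₃ := hsplit (G.degreeIn T · ^ 2)
  have hn₁ := hnbr 1
  have hn₂ := hnbr (G.degreeIn T)
  rw [hN, sum_eq_zero fun w hw => hzero w (hTA hw)] at hn₂
  rw [hG.sum_degreeIn, sum_eq_zero hzero, hTx, hTcard] at hs₂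
  rw [hG.sum_degreeIn_sq T hTc, sum_eq_zero fun w hw => by rw [hzero w hw]; rfl, hTx,
    hTcard] at hs₃
  simp only [Pi.one_apply] at hs₁ hn₁
  rw [hNcard] at hn₁
  simp only [sum_const, nsmul_eq_mul, mul_one, card_univ, hG.card, hA.card, hTcard] at hs₁ hn₁
  set S₁ := (Aᶜ.erase x).filter (G.Adj x)
  set S₂ := (Aᶜ.erase x).filter (¬ G.Adj x ·)
  have hdev (S : Finset V) (c : ℤ) : ∑ w ∈ S, (G.degreeIn T w - c) ^ 2 =
      ∑ w ∈ S, G.degreeIn T w ^ 2 - 2 * c * ∑ w ∈ S, G.degreeIn T w + #S * c ^ 2 := by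
    simp only [sub_sq (G.degreeIn T _), sum_add_distrib, sum_sub_distrib, mul_sum, sum_const,
      nsmul_eq_mul]
    congr 2
    exact sum_congr rfl fun x _ => by ring
  have hsum : ∑ w ∈ S₁, (G.degreeIn T w - 1) ^ 2 + ∑ w ∈ S₂, (G.degreeIn T w - q) ^ 2 = 0 := by
    rw [hdev, hdev]
    linear_combination -hs₃ + 2 * q * hs₂ - q ^ 2 * hs₁ + (2 - 2 * q) * hn₂ - (1 - q ^ 2) * hn₁
  have h₁ : 0 ≤ ∑ w ∈ S₁, (G.degreeIn T w - 1) ^ 2 := sum_nonneg fun _ _ => sq_nonneg _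
  have h₂ : 0 ≤ ∑ w ∈ S₂, (G.degreeIn T w - q) ^ 2 := sum_nonneg fun _ _ => sq_nonneg _
  split_ifs with hadj
  · have h := (sum_eq_zero_iff_of_nonneg fun x _ => sq_nonneg _).1
      (by linarith : ∑ w ∈ S₁, (G.degreeIn T w - 1) ^ 2 = 0) u (by simp [S₁, *])
    linear_combination pow_eq_zero_iff two_ne_zero |>.1 h
  · have h := (sum_eq_zero_iff_of_nonneg fun x _ => sq_nonneg _).1
      (by linarith : ∑ w ∈ S₂, (G.degreeIn T w - q) ^ 2 = 0) u (by simp [S₂, *])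
    linear_combination pow_eq_zero_iff two_ne_zero |>.1 h

theorem IsDelsarte.degreeIn_sdiff (hA : IsDelsarte G q A) (hB : IsDelsarte G q B)
    (hG : IsGQGraph G q) {y : V} (hyA : y ∈ A) :
    G.degreeIn (B \ A) y = if y ∈ B then 0 else q ^ 2 - q + 1 := by
  split_ifs with hyB
  · exact hB.degreeIn_self sdiff_subset hyB
  · rw [← hB.degreeIn_eq hG hyB, ← degreeIn_sdiff_add_inter B A,
      hA.degreeIn_self inter_subset_right hyA, add_zero]

/-- Distinct Delsarte cocliques meet in `(q - 1)²` vertices. -/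
theorem IsDelsarte.card_inter (hA : IsDelsarte G q A) (hB : IsDelsarte G q B)
    (hG : IsGQGraph G q) (hq : 2 < q) (hAB : A ≠ B) : (#(B ∩ A) : ℤ) = (q - 1) ^ 2 := by
  have hcard : #A = #B := by exact_mod_cast hA.card.trans hB.card.symm
  obtain ⟨x, hxB, hxA⟩ : ∃ x ∈ B, x ∉ A := by
    by_contra! h
    exact hAB (eq_of_subset_of_card_le h hcard.le).symm
  have hx : x ∈ B \ A := mem_sdiff.2 ⟨hxB, hxA⟩
  have hcount := sum_degreeIn_comm (G := G) (A.filter (G.Adj x)) (B \ A)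
  have hl : ∑ u ∈ (B \ A).erase x, G.degreeIn (A.filter (G.Adj x)) u =
      (#(B \ A) - 1) * q := by
    rw [sum_congr rfl fun u hu => hA.degreeIn_filter_eq hG hxA
      (mem_sdiff.1 (mem_of_mem_erase hu)).2 (ne_of_mem_erase hu),
      sum_congr rfl fun u hu => if_neg
      (hB.isCoclique x hxB u (mem_sdiff.1 (mem_of_mem_erase hu)).1)]
    rw [sum_const, nsmul_eq_mul, cast_card_erase_of_mem hx]
  have hx' : G.degreeIn (A.filter (G.Adj x)) x = q ^ 2 - q + 1 := by
    rw [degreeIn_eq_card_filter, filter_filter, ← hA.degreeIn_eq hG hxA,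
      degreeIn_eq_card_filter]
    simp
  have hr : ∑ y ∈ A.filter (G.Adj x), G.degreeIn (B \ A) y = (q ^ 2 - q + 1) ^ 2 := by
    rw [sum_congr rfl fun y hy => (hA.degreeIn_sdiff hB hG (mem_filter.1 hy).1).trans
      (if_neg fun hyB => hB.isCoclique x hxB y hyB (mem_filter.1 hy).2)]
    rw [sum_const, nsmul_eq_mul, ← degreeIn_eq_card_filter, hA.degreeIn_eq hG hxA]
    ring
  rw [← add_sum_erase _ _ hx, hl, hr, hx'] at hcount
  have hBcard : (#(B \ A) : ℤ) + #(B ∩ A) = q ^ 3 - q ^ 2 + 1 := by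
    rw [← hB.card]; exact_mod_cast card_sdiff_add_card_inter B A
  have hq₀ : q ≠ 0 := by omega
  refine mul_left_cancel₀ hq₀ ?_
  linear_combination q * hBcard - hcount

/-- A vertex outside two distinct Delsarte cocliques has `q - 1` neighbours in their
intersection. -/
theorem IsDelsarte.degreeIn_inter (hA : IsDelsarte G q A) (hB : IsDelsarte G q B)
    (hG : IsGQGraph G q) (hq : 2 < q) (hAB : A ≠ B) {x : V} (hxA : x ∉ A) (hxB : x ∉ B) :
    G.degreeIn (B ∩ A) x = q - 1 := by
  have hcount := sum_degreeIn_comm (G := G) (A.filter (G.Adj x)) (B \ A)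
  have hl : ∑ u ∈ B \ A, G.degreeIn (A.filter (G.Adj x)) u =
      #(B \ A) * q - (q - 1) * G.degreeIn (B \ A) x := by
    have h (u : V) (hu : u ∈ B \ A) : G.degreeIn (A.filter (G.Adj x)) u =
        q - (q - 1) * if G.Adj x u then 1 else 0 := by
      rw [hA.degreeIn_filter_eq hG hxA (mem_sdiff.1 hu).2
        (ne_of_mem_of_not_mem (mem_sdiff.1 hu).1 hxB)]
      split_ifs <;> ring
    rw [sum_congr rfl h, sum_sub_distrib, sum_const, nsmul_eq_mul, ← mul_sum, degreeIn]
  have hr : ∑ y ∈ A.filter (G.Adj x), G.degreeIn (B \ A) y =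
      (q ^ 2 - q + 1) * G.degreeIn (A \ B) x := by
    rw [sum_congr rfl fun y hy => hA.degreeIn_sdiff hB hG (mem_filter.1 hy).1,
      degreeIn, sum_filter, ← sum_inter_add_sum_sdiff A B, mul_sum]
    rw [sum_eq_zero, zero_add]
    · refine sum_congr rfl fun y hy => ?_
      simp [(mem_sdiff.1 hy).2]
    · intro y hy
      simp [(mem_inter.1 hy).2]
  rw [hl, hr] at hcount
  have hdA := degreeIn_sdiff_add_inter (G := G) A B x
  have hdB := degreeIn_sdiff_add_inter (G := G) B A x
  rw [hA.degreeIn_eq hG hxA, inter_comm] at hdA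
  rw [hB.degreeIn_eq hG hxB] at hdB
  have hBcard : (#(B \ A) : ℤ) + #(B ∩ A) = q ^ 3 - q ^ 2 + 1 := by
    rw [← hB.card]; exact_mod_cast card_sdiff_add_card_inter B A
  rw [hA.card_inter hB hG hq hAB] at hBcard
  have hq₀ : q ^ 2 ≠ 0 := pow_ne_zero 2 (by omega)
  refine mul_left_cancel₀ hq₀ ?_
  linear_combination hcount - q * hBcard + (q - 1) * hdB + (q ^ 2 - q + 1) * hdA

/-- There are no three distinct Delsarte cocliques. -/
theorem not_three (hA : IsDelsarte G q A) (hB : IsDelsarte G q B) (hC : IsDelsarte G q C)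
    (hG : IsGQGraph G q) (hq : 2 < q) (hAB : A ≠ B) (hAC : A ≠ C) (hBC : B ≠ C) : False := by
  have hcount := sum_degreeIn_comm (G := G) ((B ∩ A) \ C) (C \ (A ∪ B))
  have hl : ∑ x ∈ C \ (A ∪ B), G.degreeIn ((B ∩ A) \ C) x = #(C \ (A ∪ B)) * (q - 1) := by
    rw [← nsmul_eq_mul, ← sum_const]
    refine sum_congr rfl fun x hx => ?_
    simp only [mem_sdiff, mem_union, not_or] at hx
    rw [← hA.degreeIn_inter hB hG hq hAB hx.2.1 hx.2.2, ← degreeIn_sdiff_add_inter (B ∩ A) C,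
      hC.degreeIn_self inter_subset_right hx.1, add_zero]
  have hr : ∑ y ∈ (B ∩ A) \ C, G.degreeIn (C \ (A ∪ B)) y =
      #((B ∩ A) \ C) * (q ^ 2 - q + 1) := by
    rw [← nsmul_eq_mul, ← sum_const]
    refine sum_congr rfl fun y hy => ?_
    simp only [mem_sdiff, mem_inter] at hy
    rw [← hC.degreeIn_eq hG hy.2, ← degreeIn_sdiff_add_inter C (A ∪ B),
      degreeIn_eq_zero (S := C ∩ (A ∪ B)), add_zero]
    intro z hz
    rcases mem_union.1 (mem_inter.1 hz).2 with h | h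
    · exact hA.isCoclique y hy.1.2 z h
    · exact hB.isCoclique y hy.1.1 z h
  rw [hl, hr] at hcount
  have h₁ : (#((B ∩ A) \ C) : ℤ) + #((B ∩ A) ∩ C) = (q - 1) ^ 2 := by
    rw [← hA.card_inter hB hG hq hAB]; exact_mod_cast card_sdiff_add_card_inter (B ∩ A) C
  have h₂ : (#(C \ (A ∪ B)) : ℤ) + #(C ∩ (A ∪ B)) = q ^ 3 - q ^ 2 + 1 := by
    rw [← hC.card]; exact_mod_cast card_sdiff_add_card_inter C (A ∪ B)
  have h₃ : (#(C ∩ (A ∪ B)) : ℤ) + #((B ∩ A) ∩ C) = (q - 1) ^ 2 + (q - 1) ^ 2 := by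
    nth_rw 1 [← hA.card_inter hC hG hq hAC]
    rw [← hB.card_inter hC hG hq hBC]
    have h := card_union_add_card_inter (C ∩ A) (C ∩ B)
    rw [← inter_union_distrib_left, ← inter_inter_distrib_left, inter_comm A B,
      inter_comm C (B ∩ A)] at h
    exact_mod_cast h
  have hq₀ : q ≠ 0 := by omega
  have key : q * (#((B ∩ A) ∩ C) : ℤ) = (q - 1) * (q - 2) := by
    refine mul_left_cancel₀ hq₀ ?_
    linear_combination (q ^ 2 - q + 1) * h₁ - (q - 1) * (h₂ - h₃) + hcount
  have hdvd : q ∣ 2 := ⟨#((B ∩ A) ∩ C) - q + 3, by linear_combination -key⟩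
  exact absurd (Int.le_of_dvd two_pos hdvd) (by omega)

end DelsarteCoclique

theorem gq_q_qsq_sub_q_vertex_transitive_no_ovoid {V : Type*} [Fintype V] [DecidableEq V]
    (G : SimpleGraph V) [DecidableRel G.Adj] (q : ℕ) (hq : 2 < q)
    (hsrg : G.IsSRGWith ((q + 1) * (q ^ 3 - q ^ 2 + 1)) (q * (q ^ 2 - q + 1))
      (q - 1) (q ^ 2 - q + 1))
    (htrans : ∀ x y : V, ∃ φ : G ≃g G, φ x = y) :
    ¬ ∃ Y : Finset V, IsCoclique G Y ∧ Y.card = q ^ 3 - q ^ 2 + 1 := by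
  rintro ⟨A, hA, hAcard⟩
  have hG := DelsarteCoclique.IsGQGraph.of_isSRGWith (by omega) hsrg
  have hq' : (2 : ℤ) < q := by exact_mod_cast hq
  have hA : DelsarteCoclique.IsDelsarte G (q : ℤ) A := by
    refine ⟨hA, ?_⟩
    rw [hAcard]
    push_cast [Nat.pow_le_pow_right (by omega : 1 ≤ q) (by norm_num : 2 ≤ 3)]
    ring
  have hpos : 0 < #A := by omega
  have hV : Fintype.card V = (q + 1) * #A := by rw [hsrg.card, hAcard]
  have hne (S : Finset V) (hS : #S ≤ #A + #A) : ∃ x, x ∉ S := by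
    by_contra! h
    have : #S = Fintype.card V := card_eq_iff_eq_univ S |>.2 (eq_univ_iff_forall.2 h)
    nlinarith
  obtain ⟨x, hx⟩ := hne A (by omega)
  obtain ⟨B, hB, hxB⟩ := hA.exists_mem hq' htrans x
  have hBcard : #B = #A := by exact_mod_cast hB.card.trans hA.card.symm
  obtain ⟨z, hz⟩ := hne (A ∪ B) (by have := card_union_le A B; omega)
  obtain ⟨C, hC, hzC⟩ := hA.exists_mem hq' htrans z
  rw [mem_union, not_or] at hz
  exact DelsarteCoclique.not_three hA hB hC hG hq' (fun h => hx (h ▸ hxB))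
    (fun h => hz.1 (h ▸ hzC)) (fun h => hz.2 (h ▸ hzC))
end

section
/- Let q > 1 be odd with q ≡ 5 (mod 8). Then a strongly regular graph with parameters v = (q + 1)(q² − q + 1), k = q(q² + 1)/2, λ = (q − 1)(q² + 3)/4, μ = (q + 1)(q² + 1)/4 (equivalently, with eigenvalues e⁺ = (q − 1)/2 and e⁻ = −(q² + 1)/2; these are the parameters of Taylor's 2-graph for U(3, q)) contains no coclique of size q² − q + 1 (i.e., no Delsarte coclique). -/
open Finset Matrix

section DoublyEvenFamily

variable {V : Type*} [DecidableEq V]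

lemma card_symmDiff_add (X c : Finset V) :
    #(symmDiff X c) + 2 * #(X ∩ c) = #X + #c := by
  have h1 : #(symmDiff X c) = #(X \ c) + #(c \ X) := by
    rw [symmDiff_def, sup_eq_union, card_union_of_disjoint disjoint_sdiff_sdiff]
  have h2 := card_sdiff_add_card_inter X c
  have h3 := card_sdiff_add_card_inter c X
  rw [inter_comm c X] at h3
  omega

lemma even_card_symmDiff_inter_iff {X c d : Finset V} (h : Even #(c ∩ d)) :
    Even #(symmDiff X c ∩ d) ↔ Even #(X ∩ d) := by
  have h1 := card_symmDiff_add (X ∩ d) (c ∩ d)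
  have h2 : symmDiff (X ∩ d) (c ∩ d) = symmDiff X c ∩ d := (inf_symmDiff_distrib_right X c d).symm
  rw [h2] at h1
  simp only [Nat.even_iff] at *
  omega

lemma I_pow_card_symmDiff {X c : Finset V} (hc : 4 ∣ #c) (h : ¬ Even #(X ∩ c)) :
    Complex.I ^ #(symmDiff X c) = -Complex.I ^ #X := by
  obtain ⟨a, ha⟩ := hc
  obtain ⟨b, hb⟩ := Nat.not_even_iff_odd.mp h
  have h1 := card_symmDiff_add X c
  have h2 : Complex.I ^ (#(symmDiff X c) + 2 * #(X ∩ c)) = Complex.I ^ (#X + #c) := by rw [h1]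
  rw [ha, hb, pow_add, pow_add, pow_mul Complex.I 4, Complex.I_pow_four, one_pow, pow_mul,
    Complex.I_sq, Odd.neg_one_pow ⟨b, rfl⟩] at h2
  linear_combination -h2

/-- Summing `I ^ #X` over all subsets of `Y` only sees the sets orthogonal to a self-orthogonal
family of subsets of doubly even size. -/
lemma sum_I_pow_card_filter_even (Y : Finset V) (T : Finset (Finset V))
    (hsub : ∀ c ∈ T, c ⊆ Y) (h4 : ∀ c ∈ T, 4 ∣ #c)
    (heven : ∀ c ∈ T, ∀ d ∈ T, Even #(c ∩ d)) :
    ∑ X ∈ Y.powerset with ∀ c ∈ T, Even #(X ∩ c), Complex.I ^ #X =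
      ∑ X ∈ Y.powerset, Complex.I ^ #X := by
  induction T using Finset.induction_on with
  | empty => simp
  | insert c T hcT ih =>
    rw [← ih (fun d hd => hsub d (mem_insert_of_mem hd)) (fun d hd => h4 d (mem_insert_of_mem hd))
      (fun d hd e he => heven d (mem_insert_of_mem hd) e (mem_insert_of_mem he)),
      ← sum_filter_add_sum_filter_not ({X ∈ Y.powerset | ∀ d ∈ T, Even #(X ∩ d)})
        (fun X => Even #(X ∩ c))]
    have hc := mem_insert_self c T
    have hzero : ∑ X ∈ {X ∈ Y.powerset | ∀ d ∈ T, Even #(X ∩ d)} with ¬ Even #(X ∩ c),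
        Complex.I ^ #X = 0 := by
      refine sum_involution (fun X _ => symmDiff X c) ?_ ?_ ?_ ?_
      · intro X hX
        rw [I_pow_card_symmDiff (h4 c hc) (mem_filter.mp hX).2, add_neg_cancel]
      · intro X hX _ heq
        have h0 : c = ∅ := by simpa using heq
        simp [h0] at hX
      · intro X hX
        simp only [mem_filter, mem_powerset] at hX ⊢
        refine ⟨⟨?_, fun d hd => ?_⟩, ?_⟩
        · exact symmDiff_le_sup.trans (union_subset hX.1.1 (hsub c hc))
        · exact (even_card_symmDiff_inter_iff (heven c hc d (mem_insert_of_mem hd))).mpr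
            (hX.1.2 d hd)
        · rw [even_card_symmDiff_inter_iff (heven c hc c hc)]
          exact hX.2
      · intro X _
        simp
    rw [hzero, add_zero, filter_filter]
    refine sum_congr (filter_congr fun X _ => ?_) fun _ _ => rfl
    rw [forall_mem_insert, and_comm]

lemma exists_subset_orthogonal_of_card_mod_eight {Y : Finset V} (hY : #Y % 8 = 5)
    (T : Finset (Finset V)) (hsub : ∀ c ∈ T, c ⊆ Y) (h4 : ∀ c ∈ T, 4 ∣ #c)
    (heven : ∀ c ∈ T, ∀ d ∈ T, Even #(c ∩ d)) :
    ∃ X ⊆ Y, (∀ c ∈ T, Even #(X ∩ c)) ∧ ¬ 4 ∣ #X * (#X - 1) := by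
  by_contra! hcon
  have hsum := sum_I_pow_card_filter_even Y T hsub h4 heven
  have hall : ∑ X ∈ Y.powerset, Complex.I ^ #X = (Complex.I + 1) ^ #Y := by
    rw [← sum_pow_mul_eq_add_pow]
    simp
  have hnonneg : 0 ≤ (∑ X ∈ Y.powerset with ∀ c ∈ T, Even #(X ∩ c), Complex.I ^ #X).re := by
    rw [Complex.re_sum]
    refine sum_nonneg fun X hX => ?_
    rw [mem_filter, mem_powerset] at hX
    have h := hcon X hX.1 hX.2
    have hmod : #X % 4 = 0 ∨ #X % 4 = 1 := by
      have hlt : #X % 4 < 4 := Nat.mod_lt _ (by norm_num)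
      by_contra! hne
      obtain ⟨a, ha⟩ : ∃ a, #X = 4 * a + 2 ∨ #X = 4 * a + 3 := ⟨#X / 4, by omega⟩
      rcases ha with ha | ha <;> rw [ha] at h
      · rw [show 4 * a + 2 - 1 = 4 * a + 1 by omega,
          show (4 * a + 2) * (4 * a + 1) = 4 * (4 * a * a + 3 * a) + 2 by ring] at h
        omega
      · rw [show 4 * a + 3 - 1 = 4 * a + 2 by omega,
          show (4 * a + 3) * (4 * a + 2) = 4 * (4 * a * a + 5 * a + 1) + 2 by ring] at h
        omega
    rw [← Nat.div_add_mod #X 4, pow_add, pow_mul, Complex.I_pow_four, one_pow, one_mul]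
    rcases hmod with h | h <;> simp [h]
  have hpow : (Complex.I + 1) ^ #Y = ((-4 * 16 ^ (#Y / 8) : ℝ) : ℂ) * (Complex.I + 1) := by
    have h2 : (Complex.I + 1) ^ 2 = 2 * Complex.I := by
      linear_combination Complex.I_sq
    have h4 : (Complex.I + 1) ^ 4 = -4 := by
      rw [show 4 = 2 * 2 from rfl, pow_mul, h2]
      linear_combination 4 * Complex.I_sq
    have h8 : (Complex.I + 1) ^ 8 = 16 := by
      rw [show 8 = 4 * 2 from rfl, pow_mul, h4]
      norm_num
    conv_lhs => rw [← Nat.div_add_mod #Y 8, hY, pow_add, pow_mul, h8, pow_succ, h4]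
    push_cast
    ring
  rw [hsum, hall, hpow, Complex.re_ofReal_mul] at hnonneg
  have : (0 : ℝ) < 16 ^ (#Y / 8) := by positivity
  simp at hnonneg
  linarith

end DoublyEvenFamily

section StronglyRegular

variable {V : Type*} [Fintype V] {G : SimpleGraph V} [DecidableRel G.Adj] {n k l m : ℕ}

lemma SimpleGraph.adjMatrix_dotProduct_mulVec (u w : V → ℤ) :
    u ⬝ᵥ (G.adjMatrix ℤ *ᵥ w) = (G.adjMatrix ℤ *ᵥ u) ⬝ᵥ w := by
  rw [dotProduct_mulVec, ← mulVec_transpose, SimpleGraph.transpose_adjMatrix]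

lemma SimpleGraph.IsSRGWith.sum_adjMatrix_mulVec (h : G.IsSRGWith n k l m) (u : V → ℤ) :
    ∑ x, (G.adjMatrix ℤ *ᵥ u) x = k * ∑ x, u x := by
  have h1 := SimpleGraph.adjMatrix_dotProduct_mulVec (G := G) (fun _ => 1) u
  have h2 : G.adjMatrix ℤ *ᵥ (fun _ => 1) = fun _ => (k : ℤ) := by
    ext x
    simp [h.regular.degree_eq x]
  rw [h2] at h1
  simpa [dotProduct, mul_sum] using h1

variable [DecidableEq V]

lemma SimpleGraph.IsSRGWith.adjMatrix_mulVec_mulVec (h : G.IsSRGWith n k l m) (u : V → ℤ) (x : V) :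
    (G.adjMatrix ℤ *ᵥ (G.adjMatrix ℤ *ᵥ u)) x =
      (k - m) * u x + (l - m) * (G.adjMatrix ℤ *ᵥ u) x + m * ∑ y, u y := by
  have hc : Gᶜ.adjMatrix ℤ = Matrix.of (fun _ _ => 1) - 1 - G.adjMatrix ℤ := by
    ext y z
    by_cases hyz : y = z
    · simp [hyz]
    · by_cases hadj : G.Adj y z <;> simp [hyz, hadj]
  have hJ : ((Matrix.of fun _ _ => (1 : ℤ)) *ᵥ u) x = ∑ y, u y := by
    simp [mulVec, dotProduct]
  rw [mulVec_mulVec, ← sq, h.matrix_eq (α := ℤ), hc]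
  simp only [← Nat.cast_smul_eq_nsmul ℤ, add_mulVec, sub_mulVec, smul_mulVec, one_mulVec,
    Pi.add_apply, Pi.smul_apply, Pi.sub_apply, hJ, smul_eq_mul]
  ring

lemma adjMatrix_mulVec_indicator (X : Finset V) (x : V) :
    (G.adjMatrix ℤ *ᵥ fun y => if y ∈ X then 1 else 0) x = #(X ∩ G.neighborFinset x) := by
  rw [SimpleGraph.adjMatrix_mulVec_apply, sum_boole, filter_mem_eq_inter, inter_comm]

lemma sum_card_inter_neighborFinset (h : G.IsSRGWith n k l m) (X : Finset V) :
    ∑ x, (#(X ∩ G.neighborFinset x) : ℤ) = k * #X := by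
  have := h.sum_adjMatrix_mulVec (fun y => if y ∈ X then 1 else 0)
  simpa only [adjMatrix_mulVec_indicator, sum_boole, filter_mem_eq_inter, univ_inter] using this

lemma IsCoclique.inter_neighborFinset {X Y : Finset V} (hY : IsCoclique G Y) (hX : X ⊆ Y) {x : V}
    (hx : x ∈ Y) : X ∩ G.neighborFinset x = ∅ := by
  ext y
  simpa using fun hy => hY x hx y (hX hy)

lemma IsCoclique.sum_sq_card_inter_neighborFinset (h : G.IsSRGWith n k l m) {X : Finset V}
    (hX : IsCoclique G X) :
    ∑ x, (#(X ∩ G.neighborFinset x) : ℤ) ^ 2 = #X * (k - m + m * #X) := by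
  set u : V → ℤ := fun y => if y ∈ X then 1 else 0 with hu
  have h1 := SimpleGraph.adjMatrix_dotProduct_mulVec (G := G) u (G.adjMatrix ℤ *ᵥ u)
  have h2 : ∑ y, u y = #X := by simp [hu]
  simp only [dotProduct, h.adjMatrix_mulVec_mulVec, h2] at h1
  simp only [hu, adjMatrix_mulVec_indicator] at h1
  simp only [sq]
  rw [← h1]
  simp only [ite_mul, one_mul, zero_mul, sum_ite_mem, univ_inter]
  rw [sum_congr rfl (g := fun _ => (k - m + m * #X : ℤ))]
  · simp
  · intro x hx
    simp [hx, hX.inter_neighborFinset subset_rfl hx]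

/-- If `e` and `e'` are the nontrivial eigenvalues and `2 * (A - e) - J` kills `u` on the support
of `u`, where `J` is the all-ones matrix, then it kills `u` everywhere. -/
lemma two_mul_adjMatrix_mulVec_eq (h : G.IsSRGWith n k l m) (e e' : ℤ)
    (hsum : (l : ℤ) - m = e + e') (hprod : (k : ℤ) - m = -(e * e'))
    (hn : 2 * (k : ℤ) - 2 * e - n = 0) (hm : e' + 2 * m - k = 0) (u : V → ℤ)
    (hu : ∀ x, u x ≠ 0 → 2 * (G.adjMatrix ℤ *ᵥ u) x - 2 * e * u x - ∑ y, u y = 0) (x : V) :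
    2 * (G.adjMatrix ℤ *ᵥ u) x - 2 * e * u x - ∑ y, u y = 0 := by
  set s := ∑ y, u y with hs
  set f : V → ℤ := fun x => 2 * (G.adjMatrix ℤ *ᵥ u) x - 2 * e * u x - s with hf
  have hf' : f = (2 : ℤ) • (G.adjMatrix ℤ *ᵥ u) - (2 * e) • u - s • fun _ => (1 : ℤ) := by
    ext x
    simp [hf]
  have hfsum : ∑ x, f x = 0 := by
    simp only [hf, sum_sub_distrib, ← mul_sum, h.sum_adjMatrix_mulVec, sum_const, card_univ, h.card,
      nsmul_eq_mul, ← hs]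
    linear_combination s * hn
  have hA1 : G.adjMatrix ℤ *ᵥ (fun _ => 1) = fun _ => (k : ℤ) := by
    ext x
    simp [h.regular.degree_eq x]
  have hAf : G.adjMatrix ℤ *ᵥ f = e' • f := by
    rw [hf']
    simp only [mulVec_sub, mulVec_smul, hA1]
    ext x
    simp only [Pi.sub_apply, Pi.smul_apply, h.adjMatrix_mulVec_mulVec, smul_eq_mul, ← hs]
    linear_combination (2 * (G.adjMatrix ℤ *ᵥ u) x) * hsum + 2 * u x * hprod + s * hm
  have hfu : f ⬝ᵥ u = 0 := by
    refine sum_eq_zero fun x _ => ?_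
    by_cases hx : u x = 0
    · simp [hx]
    · rw [show f x = 0 from hu x hx, zero_mul]
  have hff : f ⬝ᵥ f = 0 := by
    have h1 : f ⬝ᵥ (G.adjMatrix ℤ *ᵥ u) = 0 := by
      rw [SimpleGraph.adjMatrix_dotProduct_mulVec, hAf, smul_dotProduct, hfu, smul_zero]
    have h2 : f ⬝ᵥ (fun _ => (1 : ℤ)) = 0 := by simpa [dotProduct] using hfsum
    nth_rewrite 2 [hf']
    simp only [dotProduct_sub, dotProduct_smul, h1, h2, hfu, smul_zero, sub_zero]
  exact congrFun (dotProduct_self_eq_zero.mp hff) x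

lemma IsCoclique.card_inter_neighborFinset_eq (h : G.IsSRGWith n k l m) {Y : Finset V}
    (hY : IsCoclique G Y) (K : ℤ)
    (hK : (#Y : ℤ) * (k - m + m * #Y) - 2 * K * k * #Y + K ^ 2 * n = #Y * K ^ 2)
    {x : V} (hx : x ∉ Y) : (#(Y ∩ G.neighborFinset x) : ℤ) = K := by
  have h1 : ∑ x, ((#(Y ∩ G.neighborFinset x) : ℤ) - K) ^ 2 = #Y * K ^ 2 := by
    simp only [sub_sq, sum_sub_distrib, sum_add_distrib, ← mul_sum, ← sum_mul,
      hY.sum_sq_card_inter_neighborFinset h, sum_card_inter_neighborFinset h, sum_const, card_univ,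
      h.card, nsmul_eq_mul]
    linear_combination hK
  have h2 : ∑ x ∈ Y, ((#(Y ∩ G.neighborFinset x) : ℤ) - K) ^ 2 = #Y * K ^ 2 := by
    rw [sum_congr rfl (g := fun _ => K ^ 2)]
    · simp
    · intro x hx
      simp [hY.inter_neighborFinset subset_rfl hx]
  rw [← sum_add_sum_compl Y, h2, add_eq_left, sum_eq_zero_iff_of_nonneg fun _ _ => sq_nonneg _] at h1
  exact sub_eq_zero.mp (pow_eq_zero_iff two_ne_zero |>.mp (h1 x (mem_compl.mpr hx)))

/-- Two vertices outside a Delsarte coclique have an odd number of common neighbors in it. -/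
lemma IsCoclique.odd_card_inter_neighborFinset_inter {p : ℕ} (h : G.IsSRGWith n k l m)
    (hn : n = (8 * p + 6) * (64 * p ^ 2 + 72 * p + 21))
    (hk : k = (8 * p + 5) * (32 * p ^ 2 + 40 * p + 13))
    (hl : l = (8 * p + 4) * (16 * p ^ 2 + 20 * p + 7))
    (hm : m = (4 * p + 3) * (32 * p ^ 2 + 40 * p + 13)) {Y : Finset V}
    (hY : IsCoclique G Y) (hcard : #Y = 64 * p ^ 2 + 72 * p + 21)
    (hK : ∀ x ∉ Y, #(Y ∩ G.neighborFinset x) = 32 * p ^ 2 + 40 * p + 13) {w w' : V}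
    (hw : w ∉ Y) (hw' : w' ∉ Y) : Odd #(Y ∩ G.neighborFinset w ∩ G.neighborFinset w') := by
  obtain rfl | hne := eq_or_ne w w'
  · rw [inter_assoc, inter_self, hK w hw]
    exact ⟨16 * p ^ 2 + 20 * p + 6, by ring⟩
  set B := Y ∩ G.neighborFinset w with hB
  have hBY : B ⊆ Y := inter_subset_left
  set u : V → ℤ := ((8 * p + 5 : ℤ) * (8 * p + 4)) • (fun y => if y ∈ ({w} : Finset V) then 1 else 0)
    + (2 * (8 * p + 5 : ℤ)) • (fun y => if y ∈ B then 1 else 0)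
    - (8 * p + 6 : ℤ) • (fun y => if y ∈ Y then 1 else 0) with hu
  have hAu (x : V) : (G.adjMatrix ℤ *ᵥ u) x =
      (8 * p + 5 : ℤ) * (8 * p + 4) * #({w} ∩ G.neighborFinset x)
      + 2 * (8 * p + 5 : ℤ) * #(B ∩ G.neighborFinset x)
      - (8 * p + 6) * #(Y ∩ G.neighborFinset x) := by
    simp only [hu, mulVec_sub, mulVec_add, mulVec_smul, Pi.sub_apply, Pi.add_apply, Pi.smul_apply,
      adjMatrix_mulVec_indicator, smul_eq_mul]
  have hux (x : V) : u x = (8 * p + 5 : ℤ) * (8 * p + 4) * (if x = w then 1 else 0)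
      + 2 * (8 * p + 5 : ℤ) * (if x ∈ B then 1 else 0) - (8 * p + 6) * (if x ∈ Y then 1 else 0) := by
    simp only [hu, Pi.sub_apply, Pi.add_apply, Pi.smul_apply, smul_eq_mul, mem_singleton]
  have hsum : ∑ y, u y = 2 * (32 * p ^ 2 + 40 * p + 12) := by
    simp only [hux, sum_sub_distrib, sum_add_distrib, ← mul_sum, sum_boole, filter_mem_eq_inter, univ_inter,
      filter_eq', mem_univ, if_true, card_singleton, hB, hK w hw, hcard]
    push_cast
    ring
  have hsing (x : V) : ({w} ∩ G.neighborFinset x) = if G.Adj w x then {w} else ∅ := by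
    split_ifs with hadj
    · simpa using hadj.symm
    · simp [singleton_inter_of_notMem, G.adj_comm x w, hadj]
  have key := two_mul_adjMatrix_mulVec_eq h (4 * p + 2) (-(32 * p ^ 2 + 40 * p + 13))
    (by rw [hl, hm]; push_cast; ring) (by rw [hk, hm]; push_cast; ring)
    (by rw [hk, hn]; push_cast; ring) (by rw [hk, hm]; push_cast; ring) u ?_ w'
  · have hwB : w' ∉ B := fun hmem => hw' (hBY hmem)
    rw [hAu, hux, hsum, hsing, hK w' hw', if_neg hne.symm, if_neg hwB, if_neg hw'] at key
    have hq : (8 * p + 5 : ℤ) ≠ 0 := by positivity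
    by_cases hadj : G.Adj w w'
    · rw [if_pos hadj, card_singleton] at key
      have hval : (#(B ∩ G.neighborFinset w') : ℤ) = (4 * p + 3) ^ 2 - (4 * p + 2) := by
        apply mul_left_cancel₀ hq
        push_cast at key
        linarith
      rw [← Int.odd_coe_nat, hval]
      exact ⟨8 * p ^ 2 + 10 * p + 3, by ring⟩
    · rw [if_neg hadj, card_empty] at key
      have hval : (#(B ∩ G.neighborFinset w') : ℤ) = (4 * p + 3) ^ 2 := by
        apply mul_left_cancel₀ hq
        push_cast at key
        linarith
      rw [← Int.odd_coe_nat, hval]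
      exact ⟨8 * p ^ 2 + 12 * p + 4, by ring⟩
  · intro x hx
    rw [hAu, hux, hsum, hsing]
    by_cases hxY : x ∈ Y
    · have hxw : x ≠ w := fun heq => hw (heq ▸ hxY)
      have hxB : x ∈ B ↔ G.Adj w x := by simp [hB, hxY]
      rw [hY.inter_neighborFinset hBY hxY, hY.inter_neighborFinset subset_rfl hxY, if_neg hxw,
        if_pos hxY]
      by_cases hadj : G.Adj w x
      · rw [if_pos hadj, if_pos (hxB.mpr hadj), card_singleton, card_empty]
        push_cast
        ring
      · rw [if_neg hadj, if_neg (mt hxB.mp hadj), card_empty]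
        push_cast
        ring
    · have hxB : x ∉ B := fun hmem => hxY (hBY hmem)
      have hxw : x = w := by
        by_contra hxw
        exact hx (by rw [hux, if_neg hxw, if_neg hxB, if_neg hxY]; ring)
      rw [if_neg hxB, if_neg hxY, if_pos hxw, hxw, if_neg (G.loopless.irrefl w), hB, inter_assoc,
        inter_self, hK w hw, card_empty]
      push_cast
      ring

lemma four_dvd_of_even_card_inter_sdiff {p : ℕ} (h : G.IsSRGWith n k l m)
    (hn : n = (8 * p + 6) * (64 * p ^ 2 + 72 * p + 21))
    (hk : k = (8 * p + 5) * (32 * p ^ 2 + 40 * p + 13))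
    (hm : m = (4 * p + 3) * (32 * p ^ 2 + 40 * p + 13)) {X Y : Finset V}
    (hY : IsCoclique G Y) (hcard : #Y = 64 * p ^ 2 + 72 * p + 21) (hXY : X ⊆ Y)
    (heven : ∀ w ∉ Y, Even #(X ∩ (Y \ G.neighborFinset w))) : 4 ∣ #X * (#X - 1) := by
  have hX : IsCoclique G X := fun x hx y hy => hY x (hXY hx) y (hXY hy)
  set f : V → ℤ := fun w => (#X - #(X ∩ G.neighborFinset w) : ℤ) with hf
  have hdvd : (8 : ℤ) ∣ ∑ w ∈ Yᶜ, (f w ^ 2 - 2 * f w) := by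
    refine dvd_sum fun w hw => ?_
    have heq : f w = #(X ∩ (Y \ G.neighborFinset w)) := by
      have h1 := card_sdiff_add_card_inter X (G.neighborFinset w)
      rw [← inter_sdiff_assoc, inter_eq_left.mpr hXY]
      simp only [hf]
      omega
    obtain ⟨g, hg⟩ := heven w (mem_compl.mp hw)
    obtain ⟨a, ha⟩ := Int.even_mul_pred_self (g : ℤ)
    rw [heq, hg]
    exact ⟨a, by push_cast; linear_combination 4 * ha⟩
  have hall : ∑ w, (f w ^ 2 - 2 * f w) =
      n * (#X : ℤ) ^ 2 - 2 * #X * (k * #X) + #X * (k - m + m * #X) - 2 * (n * #X - k * #X) := by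
    simp only [hf, sub_sq, sum_sub_distrib, sum_add_distrib, ← mul_sum,
      hX.sum_sq_card_inter_neighborFinset h, sum_card_inter_neighborFinset h, sum_const, card_univ,
      h.card, nsmul_eq_mul]
  have hin : ∑ w ∈ Y, (f w ^ 2 - 2 * f w) = #Y * ((#X : ℤ) ^ 2 - 2 * #X) := by
    rw [sum_congr rfl (g := fun _ => (#X : ℤ) ^ 2 - 2 * #X)]
    · rw [sum_const, nsmul_eq_mul]
    · intro x hx
      simp [hf, hY.inter_neighborFinset hXY hx]
  rw [← sum_add_sum_compl Y, hin] at hall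
  obtain ⟨a, ha⟩ := hdvd
  rw [ha, hn, hk, hm, hcard] at hall
  push_cast at hall
  have hz : (4 : ℤ) ∣ #X * (#X - 1) := by
    have hcop : IsCoprime (4 : ℤ) ((2 * p + 1) * (32 * p ^ 2 + 40 * p + 13)) := by
      have hodd : Odd ((2 * p + 1) * (32 * p ^ 2 + 40 * p + 13) : ℤ) :=
        (odd_two_mul_add_one _).mul ⟨16 * p ^ 2 + 20 * p + 6, by ring⟩
      exact (IsCoprime.pow_left (m := 2) (Int.isCoprime_two_left.mpr hodd))
    refine hcop.dvd_of_dvd_mul_left ?_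
    refine ⟨(8 * p + 5) * (4 * p ^ 2 + 4 * p + 1) * (#X ^ 2 - 2 * #X) - a, ?_⟩
    linarith
  rcases Nat.eq_zero_or_pos #X with h0 | h0
  · simp [h0]
  · zify [h0]
    exact hz

end StronglyRegular

theorem taylor_graph_no_delsarte_coclique_of_five_mod_eight {V : Type*} [Fintype V] [DecidableEq V]
    (G : SimpleGraph V) [DecidableRel G.Adj] (q k l m : ℕ) (hq : 1 < q) (hodd : Odd q) (hmod : q % 8 = 5)
    (hk : 2 * k = q * (q ^ 2 + 1)) (hl : 4 * l = (q - 1) * (q ^ 2 + 3))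
    (hm : 4 * m = (q + 1) * (q ^ 2 + 1))
    (hsrg : G.IsSRGWith ((q + 1) * (q ^ 2 - q + 1)) k l m) :
    ¬ ∃ Y : Finset V, IsCoclique G Y ∧ Y.card = q ^ 2 - q + 1 := by
  obtain ⟨p, rfl⟩ : ∃ p, q = 8 * p + 5 := ⟨q / 8, by omega⟩
  have hcardY : (8 * p + 5) ^ 2 - (8 * p + 5) + 1 = 64 * p ^ 2 + 72 * p + 21 := by
    rw [show (8 * p + 5) ^ 2 = 64 * p ^ 2 + 72 * p + 20 + (8 * p + 5) by ring, Nat.add_sub_cancel]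
  have hk' : k = (8 * p + 5) * (32 * p ^ 2 + 40 * p + 13) := by
    apply Nat.eq_of_mul_eq_mul_left two_pos
    rw [hk]
    ring
  have hl' : l = (8 * p + 4) * (16 * p ^ 2 + 20 * p + 7) := by
    apply Nat.eq_of_mul_eq_mul_left four_pos
    rw [hl, show 8 * p + 5 - 1 = 8 * p + 4 by omega]
    ring
  have hm' : m = (4 * p + 3) * (32 * p ^ 2 + 40 * p + 13) := by
    apply Nat.eq_of_mul_eq_mul_left four_pos
    rw [hm]
    ring
  rw [hcardY]
  rw [hcardY, show 8 * p + 5 + 1 = 8 * p + 6 by ring] at hsrg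
  rintro ⟨Y, hY, hcard⟩
  have hK : ∀ x ∉ Y, #(Y ∩ G.neighborFinset x) = 32 * p ^ 2 + 40 * p + 13 := by
    intro x hx
    have := hY.card_inter_neighborFinset_eq hsrg (32 * p ^ 2 + 40 * p + 13)
      (by rw [hcard, hk', hm']; push_cast; ring) hx
    exact_mod_cast this
  have hcardc : ∀ w ∉ Y, #(Y \ G.neighborFinset w) = 4 * (8 * p ^ 2 + 8 * p + 2) := by
    intro w hw
    have h1 := card_sdiff_add_card_inter Y (G.neighborFinset w)
    rw [hK w hw, hcard] at h1
    linarith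
  obtain ⟨X, hXY, hX, hX4⟩ := exists_subset_orthogonal_of_card_mod_eight (Y := Y) (by omega)
    (Yᶜ.image fun w => Y \ G.neighborFinset w) (by simp) (by
      simp only [forall_mem_image, mem_compl]
      exact fun w hw => ⟨_, hcardc w hw⟩) (by
      simp only [forall_mem_image, mem_compl]
      intro w hw w' hw'
      have hodd := hY.odd_card_inter_neighborFinset_inter hsrg rfl hk' hl' hm' hcard hK hw hw'
      have h1 := card_sdiff_add_card_inter (Y \ G.neighborFinset w) (Y \ G.neighborFinset w')
      have h2 : (Y \ G.neighborFinset w) \ (Y \ G.neighborFinset w') =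
          (Y ∩ G.neighborFinset w') \ G.neighborFinset w := by
        grind
      have h3 := card_sdiff_add_card_inter (Y ∩ G.neighborFinset w') (G.neighborFinset w)
      rw [inter_right_comm, hK w' hw'] at h3
      rw [h2, hcardc w hw] at h1
      rw [Nat.odd_iff] at hodd
      rw [Nat.even_iff]
      omega)
  simp only [forall_mem_image, mem_compl] at hX
  exact hX4 (four_dvd_of_even_card_inter_sdiff hsrg rfl hk' hm' hY hcard hXY fun w hw => hX hw)
end

section
/- Let q = 2ℓp^e + 1, where p is a prime with p ≡ 3 (mod 4), e is an odd positive integer, ℓ is an odd positive integer, and gcd(ℓ, p) = 1. Then a strongly regular graph with parameters v = (q + 1)(q² − q + 1), k = q(q² + 1)/2, λ = (q − 1)(q² + 3)/4, μ = (q + 1)(q² + 1)/4 (equivalently, with eigenvalues e⁺ = (q − 1)/2 and e⁻ = −(q² + 1)/2) contains no coclique of size q² − q + 1 (i.e., no Delsarte coclique). -/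
open Matrix

theorem det_fromBlocks_isotropic {K m : Type*} [Field K] [Fintype m] [DecidableEq m]
    (B D : Matrix m m K) :
    (fromBlocks 0 B Bᵀ D).det = (-1) ^ Fintype.card m * B.det ^ 2 := by
  have hJ : (fromBlocks 0 1 (-1) 0 : Matrix (m ⊕ m) (m ⊕ m) K).det = 1 := by
    have h : (fromBlocks 1 (-1) 0 1 * fromBlocks 0 1 (-1) 0 : Matrix (m ⊕ m) (m ⊕ m) K)
        = fromBlocks 1 1 (-1) 0 := by
      simp [fromBlocks_multiply]
    have h2 := congrArg det h
    rw [det_mul, det_fromBlocks_zero₂₁, det_fromBlocks_one₁₁] at h2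
    simpa using h2
  have h : fromBlocks 0 B Bᵀ D * fromBlocks 0 1 (-1) 0 = fromBlocks (-B) 0 (-D) Bᵀ := by
    simp [fromBlocks_multiply]
  have h2 := congrArg det h
  rw [det_mul, hJ, mul_one, det_fromBlocks_zero₁₂, det_neg, det_transpose] at h2
  rw [h2]; ring

theorem LinearIndependent.exists_sumElim {K E : Type*} [Field K] [AddCommGroup E] [Module K E]
    [Module.Finite K E] {m n : ℕ} {f : Fin m → E} (hf : LinearIndependent K f)
    (hdim : Module.finrank K E = m + n) :
    ∃ g : Fin n → E, LinearIndependent K (Sum.elim f g) := by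
  obtain ⟨D, hD⟩ := Submodule.exists_isCompl (Submodule.span K (Set.range f))
  have hDdim : Module.finrank K D = n := by
    have h := Submodule.finrank_add_eq_of_isCompl hD
    rw [finrank_span_eq_card hf, hdim, Fintype.card_fin] at h
    omega
  let b := Module.finBasisOfFinrankEq K D hDdim
  refine ⟨fun i => b i, hf.sum_type
    (b.linearIndependent.map' D.subtype (Submodule.ker_subtype D)) (hD.disjoint.mono_right ?_)⟩
  rw [Submodule.span_le]
  rintro _ ⟨i, rfl⟩
  exact (b i).2

theorem isSquare_neg_one_of_gram {K ι m : Type*} [Field K] [Fintype ι] [DecidableEq ι]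
    [Fintype m] [DecidableEq m] (hm : Odd (Fintype.card m))
    (hι : Fintype.card ι = 2 * Fintype.card m + 1) (w : ι → K) (f g : m → ι → K)
    (hli : LinearIndependent K (Sum.elim (fun _ : Unit => w) (Sum.elim f g)))
    (hw : w ⬝ᵥ w = 1) (hf : ∀ i, w ⬝ᵥ f i = 0) (hg : ∀ i, w ⬝ᵥ g i = 0)
    (hff : ∀ i j, f i ⬝ᵥ f j = 0) : IsSquare (-1 : K) := by
  let G : Matrix (Unit ⊕ (m ⊕ m)) ι K := Matrix.of (Sum.elim (fun _ => w) (Sum.elim f g))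
  have hcard : Fintype.card (Unit ⊕ (m ⊕ m)) = Fintype.card ι := by
    simp [hι]; omega
  let e := Fintype.equivOfCardEq hcard
  let S := G.submatrix id e
  have hS : IsUnit S := by
    rw [← linearIndependent_rows_iff_isUnit]
    exact hli.map' (LinearEquiv.funCongrLeft K K e).toLinearMap (LinearEquiv.ker _)
  let B : Matrix m m K := Matrix.of fun i j => f i ⬝ᵥ g j
  let C : Matrix m m K := Matrix.of fun i j => g i ⬝ᵥ g j
  have hGG : S * Sᵀ = fromBlocks 1 0 0 (fromBlocks 0 B Bᵀ C) := by
    have h0 : S * Sᵀ = G * Gᵀ := by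
      have h1 : Sᵀ = Gᵀ.submatrix e id := rfl
      rw [h1, submatrix_mul_equiv]
      rfl
    rw [h0]
    have h1 : ∀ i j, (G * Gᵀ) i j = G i ⬝ᵥ G j := fun i j => rfl
    ext i j
    rw [h1]
    rcases i with i | i | i <;> rcases j with j | j | j
    · change w ⬝ᵥ w = (1 : Matrix Unit Unit K) i j
      simp [hw]
    · exact hf j
    · exact hg j
    · exact (dotProduct_comm _ _).trans (hf i)
    · exact hff i j
    · rfl
    · exact (dotProduct_comm _ _).trans (hg i)
    · exact dotProduct_comm _ _
    · rfl
  have hdet := congrArg det hGG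
  rw [det_mul, det_transpose, det_fromBlocks_zero₂₁, det_one, one_mul,
    det_fromBlocks_isotropic, hm.neg_one_pow] at hdet
  have hS0 : S.det ≠ 0 := ((isUnit_iff_isUnit_det S).1 hS).ne_zero
  have hB0 : B.det ≠ 0 := by
    intro h
    rw [h] at hdet
    apply hS0
    simpa using hdet
  refine ⟨S.det / B.det, ?_⟩
  field_simp
  linear_combination -hdet

theorem isSquare_neg_one_of_isotropic {K ι : Type*} [Field K] [Fintype ι] [DecidableEq ι]
    {m : ℕ} (hm : Odd m) (hι : Fintype.card ι = 2 * m + 1) (w : ι → K) (hw : w ⬝ᵥ w = 1)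
    (U : Submodule K (ι → K)) (hwU : ∀ u ∈ U, w ⬝ᵥ u = 0)
    (hUU : ∀ u ∈ U, ∀ u' ∈ U, u ⬝ᵥ u' = 0) (hdim : m ≤ Module.finrank K U) :
    IsSquare (-1 : K) := by
  obtain ⟨f, hf⟩ := exists_linearIndependent_of_le_finrank hdim
  obtain ⟨W, hW⟩ : ∃ W : Submodule K (ι → K), ∀ x, x ∈ W ↔ w ⬝ᵥ x = 0 :=
    ⟨LinearMap.ker (dotProductBilin K K w), fun x => Iff.rfl⟩
  have hw0 : w ≠ 0 := by rintro rfl; simp at hw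
  have hcompl : IsCompl (Submodule.span K {w}) W := by
    constructor
    · rw [disjoint_comm, Submodule.disjoint_span_singleton' hw0, hW, hw]
      exact one_ne_zero
    · rw [codisjoint_iff, eq_top_iff]
      intro x _
      have h : x = (w ⬝ᵥ x) • w + (x - (w ⬝ᵥ x) • w) := by simp
      rw [h]
      refine Submodule.add_mem_sup (Submodule.smul_mem _ _ (Submodule.mem_span_singleton_self w)) ?_
      rw [hW, dotProduct_sub, dotProduct_smul, hw]
      simp
  have hWdim : Module.finrank K W = m + m := by
    have h := Submodule.finrank_add_eq_of_isCompl hcompl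
    rw [finrank_span_singleton hw0, Module.finrank_fintype_fun_eq_card, hι] at h
    omega
  let f' : Fin m → W := fun i => ⟨f i, (hW _).2 (hwU _ (f i).2)⟩
  have hf' : LinearIndependent K f' :=
    LinearIndependent.of_comp W.subtype (hf.map' U.subtype (Submodule.ker_subtype U))
  obtain ⟨g, hfg⟩ := hf'.exists_sumElim hWdim
  have hfg' : LinearIndependent K
      (Sum.elim (fun i => (f i : ι → K)) (fun i => (g i : ι → K))) := by
    have h := hfg.map' W.subtype (Submodule.ker_subtype W)
    rwa [Sum.comp_elim] at h
  refine isSquare_neg_one_of_gram (by simpa using hm) (by simpa using hι) w _ _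
    (LinearIndependent.sum_type (LinearIndependent.of_subsingleton () hw0) hfg' ?_) hw
    (fun i => hwU _ (f i).2) (fun i => (hW _).1 (g i).2) (fun i j => hUU _ (f i).2 _ (f j).2)
  rw [Set.range_const]
  refine hcompl.disjoint.mono_right ?_
  rw [Submodule.span_le]
  rintro _ ⟨i | i, rfl⟩
  · exact (f' i).2
  · exact (g i).2

theorem exists_dotProduct_not_dvd {α : Type*} [Fintype α] [DecidableEq α] {n : ℕ} (hn : n ≠ 0)
    (I : Submodule ℤ (α → ℤ)) (hI : ∀ x : α → ℤ, (n : ℤ) • x ∈ I) (y : α → ℤ) (hy : y ∉ I) :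
    ∃ z : α → ℤ, (∀ u ∈ I, (n : ℤ) ∣ z ⬝ᵥ u) ∧ ¬ (n : ℤ) ∣ z ⬝ᵥ y := by
  have hy' : I.mkQ y ≠ 0 := by simpa using hy
  obtain ⟨c, hc⟩ := CharacterModule.exists_character_apply_ne_zero_of_ne_zero hy'
  let χ : (α → ℤ) →+ AddCircle (1 : ℚ) := AddMonoidHom.comp c I.mkQ.toAddMonoidHom
  have hχI : ∀ u ∈ I, χ u = 0 := by
    intro u hu
    have h : I.mkQ u = 0 := by simpa using hu
    change c (I.mkQ u) = 0
    rw [h]; exact map_zero c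
  have hn' : (n : ℚ) ≠ 0 := by exact_mod_cast hn
  have hz : ∀ i, ∃ a : ℤ, χ (Pi.single i 1) = ((a / n : ℚ) : AddCircle (1 : ℚ)) := by
    intro i
    obtain ⟨r, hr⟩ := QuotientAddGroup.mk_surjective (χ (Pi.single i 1))
    have h1 : χ ((n : ℤ) • Pi.single i 1) = 0 := hχI _ (hI _)
    rw [map_zsmul, ← hr] at h1
    have h2 : (((n : ℤ) • r : ℚ) : AddCircle (1 : ℚ)) = 0 := h1
    rw [AddCircle.coe_eq_zero_iff] at h2
    obtain ⟨a, ha⟩ := h2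
    refine ⟨a, ?_⟩
    rw [← hr]
    have : (a / n : ℚ) = r := by
      field_simp
      simp at ha
      linarith
    rw [this]
  choose z hz using hz
  have hχ : ∀ u : α → ℤ, χ u = (((z ⬝ᵥ u : ℤ) / n : ℚ) : AddCircle (1 : ℚ)) := by
    intro u
    have h1 : u = ∑ i, u i • (Pi.single i 1 : α → ℤ) := by
      ext j; simp [Finset.sum_apply, Pi.single_apply]
    conv_lhs => rw [h1]
    rw [map_sum]
    simp_rw [map_zsmul, hz]
    have h2 : ((z ⬝ᵥ u : ℤ) / n : ℚ) = ∑ i, u i • (z i / n : ℚ) := by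
      simp only [dotProduct]
      push_cast
      rw [Finset.sum_div]
      refine Finset.sum_congr rfl fun i _ => ?_
      rw [zsmul_eq_mul]; ring
    rw [h2]
    exact (map_sum (QuotientAddGroup.mk' (AddSubgroup.zmultiples (1 : ℚ))) _ _).symm
  have hdvd : ∀ u : α → ℤ, χ u = 0 ↔ (n : ℤ) ∣ z ⬝ᵥ u := by
    intro u
    rw [hχ, AddCircle.coe_eq_zero_iff]
    constructor
    · rintro ⟨a, ha⟩
      refine ⟨a, ?_⟩
      rw [zsmul_eq_mul, mul_one] at ha
      field_simp at ha
      have : ((n * a : ℤ) : ℚ) = ((z ⬝ᵥ u : ℤ) : ℚ) := by push_cast; linarith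
      exact_mod_cast this.symm
    · rintro ⟨a, ha⟩
      refine ⟨a, ?_⟩
      rw [ha]
      push_cast
      field_simp
      simp
  exact ⟨z, fun u hu => (hdvd u).1 (hχI u hu), fun h => hc ((hdvd y).2 h)⟩

/-- The code over `ZMod p` of reductions of the integral vectors `x` for which `p ^ f * x` lies in
the lattice spanned by the columns of `N`. -/
def columnCode {α β : Type*} [Fintype β] (N : Matrix α β ℤ) (p f : ℕ) :
    Submodule (ZMod p) (α → ZMod p) where
  carrier := {u | ∃ x : α → ℤ, (∀ i, (x i : ZMod p) = u i) ∧
    ∃ c : β → ℤ, N *ᵥ c = (p : ℤ) ^ f • x}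
  zero_mem' := ⟨0, by simp, 0, by simp⟩
  add_mem' := by
    rintro u v ⟨x, hx, c, hc⟩ ⟨y, hy, d, hd⟩
    exact ⟨x + y, fun i => by simp [hx, hy], c + d, by rw [mulVec_add, hc, hd, smul_add]⟩
  smul_mem' := by
    rintro a u ⟨x, hx, c, hc⟩
    obtain ⟨a, rfl⟩ := ZMod.intCast_surjective a
    exact ⟨a • x, fun i => by simp [hx], a • c, by rw [mulVec_smul, hc, smul_comm]⟩

theorem intCast_dotProduct_eq {α : Type*} [Fintype α] {R : Type*} [CommRing R] {x y : α → ℤ}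
    {u v : α → R} (hx : ∀ i, (x i : R) = u i) (hy : ∀ i, (y i : R) = v i) :
    ((x ⬝ᵥ y : ℤ) : R) = u ⬝ᵥ v := by
  simp [dotProduct, hx, hy]

theorem columnCode_isotropic {α β : Type*} [Fintype α] [Fintype β] (N : Matrix α β ℤ) {p f : ℕ}
    (hp : p ≠ 0) {κ : ℤ} (hκ : IsCoprime (p : ℤ) κ) (hcol : Nᵀ *ᵥ 1 = fun _ => κ)
    (hgram : ∀ i j, (p : ℤ) ^ (2 * f + 1) ∣ (Nᵀ * N) i j - 1)
    {u v : α → ZMod p} (hu : u ∈ columnCode N p f) (hv : v ∈ columnCode N p f)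
    (hu1 : 1 ⬝ᵥ u = 0) : u ⬝ᵥ v = 0 := by
  obtain ⟨x, hx, c, hc⟩ := hu
  obtain ⟨y, hy, d, hd⟩ := hv
  have hsum : ∀ (x : α → ℤ) (c : β → ℤ), N *ᵥ c = (p : ℤ) ^ f • x →
      κ * (1 ⬝ᵥ c) = (p : ℤ) ^ f * (1 ⬝ᵥ x) := by
    intro x c hc
    have h1 : (1 : α → ℤ) ⬝ᵥ (N *ᵥ c) = (Nᵀ *ᵥ 1) ⬝ᵥ c := by
      rw [dotProduct_mulVec, mulVec_transpose]
    rw [hc, hcol, dotProduct_smul, smul_eq_mul] at h1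
    rw [h1]
    simp [dotProduct, Finset.mul_sum]
  have hx1 : (p : ℤ) ∣ 1 ⬝ᵥ x := by
    rw [← ZMod.intCast_zmod_eq_zero_iff_dvd,
      intCast_dotProduct_eq (u := 1) (v := u) (by simp) hx, hu1]
  have hc1 : (p : ℤ) ^ (f + 1) ∣ 1 ⬝ᵥ c := by
    refine hκ.pow_left.dvd_of_dvd_mul_left ?_
    rw [hsum x c hc, pow_succ]
    exact mul_dvd_mul_left _ hx1
  have hd1 : (p : ℤ) ^ f ∣ 1 ⬝ᵥ d := by
    refine (hκ.pow_left (m := f)).dvd_of_dvd_mul_left ?_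
    rw [hsum y d hd]
    exact dvd_mul_right _ _
  choose H hH using hgram
  have hG : Nᵀ * N = Matrix.of (fun _ _ => 1) + (p : ℤ) ^ (2 * f + 1) • Matrix.of H := by
    ext i j
    simp [← hH]
  have hJ : ∀ d : β → ℤ, (Matrix.of (fun _ _ => 1) : Matrix β β ℤ) *ᵥ d = fun _ => 1 ⬝ᵥ d := by
    intro d; ext i; simp [mulVec, dotProduct]
  have key : (N *ᵥ c) ⬝ᵥ (N *ᵥ d) = (1 ⬝ᵥ c) * (1 ⬝ᵥ d)
      + (p : ℤ) ^ (2 * f + 1) * (c ⬝ᵥ (Matrix.of H *ᵥ d)) := by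
    have h1 : (N *ᵥ c) ⬝ᵥ (N *ᵥ d) = c ⬝ᵥ ((Nᵀ * N) *ᵥ d) := by
      rw [← mulVec_mulVec, dotProduct_mulVec c, vecMul_transpose]
    rw [h1, hG, add_mulVec, dotProduct_add, smul_mulVec, dotProduct_smul, hJ, smul_eq_mul]
    congr 1
    simp [dotProduct, Finset.sum_mul]
  rw [hc, hd, smul_dotProduct, dotProduct_smul, smul_eq_mul, smul_eq_mul] at key
  have hdvd : (p : ℤ) ^ (2 * f) * p ∣ (p : ℤ) ^ (2 * f) * (x ⬝ᵥ y) := by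
    have h1 : (p : ℤ) ^ (2 * f) * (x ⬝ᵥ y) = (p : ℤ) ^ f * ((p : ℤ) ^ f * (x ⬝ᵥ y)) := by ring
    rw [h1, key, ← pow_succ]
    refine dvd_add ?_ (dvd_mul_right _ _)
    have h2 : (p : ℤ) ^ (2 * f + 1) = (p : ℤ) ^ (f + 1) * (p : ℤ) ^ f := by ring
    rw [h2]
    exact mul_dvd_mul hc1 hd1
  rw [← intCast_dotProduct_eq hx hy, ZMod.intCast_zmod_eq_zero_iff_dvd]
  exact Int.dvd_of_mul_dvd_mul_left (by positivity) hdvd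

theorem mem_columnCode_of_dual {α β : Type*} [Fintype α] [DecidableEq α] [Fintype β]
    (N : Matrix α β ℤ) {p f : ℕ} (hp : p.Prime) {a r lam : ℤ} (ha : IsCoprime (p : ℤ) a)
    (hr : IsCoprime (p : ℤ) r) (hrow : N *ᵥ 1 = fun _ => r)
    (hNN : N * Nᵀ = (a * (p : ℤ) ^ (2 * f + 1)) • (1 : Matrix α α ℤ)
      + lam • Matrix.of (fun _ _ => 1))
    {u : α → ZMod p} (hu : ∀ v ∈ columnCode N p f, u ⬝ᵥ v = 0) : u ∈ columnCode N p f := by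
  have : Fact p.Prime := ⟨hp⟩
  have hp0 : (p : ℤ) ≠ 0 := by exact_mod_cast hp.ne_zero
  choose x hx using fun i => ZMod.intCast_surjective (u i)
  let I : Submodule ℤ (α → ℤ) := LinearMap.range N.mulVecLin ⊔
    LinearMap.range (((p ^ (f + 1) : ℕ) : ℤ) • (LinearMap.id : (α → ℤ) →ₗ[ℤ] (α → ℤ)))
  by_cases hxI : (p : ℤ) ^ f • x ∈ I
  · obtain ⟨_, ⟨c, rfl⟩, _, ⟨y, rfl⟩, h⟩ := Submodule.mem_sup.1 hxI
    refine ⟨x - (p : ℤ) • y, fun i => by simp [hx], c, ?_⟩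
    have h' : N *ᵥ c + ((p ^ (f + 1) : ℕ) : ℤ) • y = (p : ℤ) ^ f • x := h
    rw [smul_sub, ← h', smul_smul, ← pow_succ]
    push_cast
    rw [add_sub_cancel_right]
  · exfalso
    obtain ⟨z, hz, hzx⟩ := exists_dotProduct_not_dvd (pow_ne_zero (f + 1) hp.ne_zero) I
      (fun x => Submodule.mem_sup_right ⟨x, rfl⟩) _ hxI
    have hzN : ∀ j, (p : ℤ) ^ (f + 1) ∣ (Nᵀ *ᵥ z) j := by
      intro j
      classical
      have h := hz (N *ᵥ Pi.single j 1) (Submodule.mem_sup_left ⟨_, rfl⟩)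
      rw [dotProduct_mulVec, dotProduct_single_one, ← mulVec_transpose] at h
      exact_mod_cast h
    choose w hw using hzN
    have hw' : Nᵀ *ᵥ z = (p : ℤ) ^ (f + 1) • w := by ext j; simp [hw]
    have hsum : r * (1 ⬝ᵥ z) = (p : ℤ) ^ (f + 1) * (1 ⬝ᵥ w) := by
      have h1 : (1 : β → ℤ) ⬝ᵥ (Nᵀ *ᵥ z) = (N *ᵥ 1) ⬝ᵥ z := by
        rw [dotProduct_mulVec, vecMul_transpose]
      rw [hw', hrow, dotProduct_smul, smul_eq_mul] at h1
      rw [h1]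
      simp [dotProduct, Finset.mul_sum]
    obtain ⟨s, hs⟩ : (p : ℤ) ^ (f + 1) ∣ 1 ⬝ᵥ z :=
      hr.pow_left.dvd_of_dvd_mul_left (by rw [hsum]; exact dvd_mul_right _ _)
    have h1 : N *ᵥ (Nᵀ *ᵥ z) = (a * (p : ℤ) ^ (2 * f + 1)) • z + fun _ => lam * (1 ⬝ᵥ z) := by
      rw [mulVec_mulVec, hNN, add_mulVec, smul_mulVec, one_mulVec, smul_mulVec]
      congr 1
    have h2 : N *ᵥ w = (a * (p : ℤ) ^ f) • z + fun _ => lam * s := by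
      rw [hw', mulVec_smul, hs] at h1
      ext i
      have h3 := congrFun h1 i
      simp only [Pi.smul_apply, Pi.add_apply, smul_eq_mul] at h3 ⊢
      refine mul_left_cancel₀ (pow_ne_zero (f + 1) hp0) (h3.trans ?_)
      ring
    have h3 : N *ᵥ (r • w - (lam * s) • 1) = (p : ℤ) ^ f • ((r * a) • z) := by
      rw [mulVec_sub, mulVec_smul, mulVec_smul, h2, hrow]
      ext i
      simp only [Pi.smul_apply, Pi.sub_apply, Pi.add_apply, smul_eq_mul]
      ring
    have hra : ((r * a : ℤ) : ZMod p) ≠ 0 := by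
      rw [Ne, ZMod.intCast_zmod_eq_zero_iff_dvd]
      intro h
      exact (Nat.prime_iff_prime_int.1 hp).not_isUnit ((hr.mul_right ha).isUnit_of_dvd' dvd_rfl h)
    have hmem : ((r * a : ℤ) : ZMod p) • (fun i => (z i : ZMod p)) ∈ columnCode N p f :=
      ⟨(r * a) • z, fun i => by simp, _, h3⟩
    have hmem' : (fun i => (z i : ZMod p)) ∈ columnCode N p f :=
      ((columnCode N p f).smul_mem_iff hra).1 hmem
    have h4 := hu _ hmem'
    rw [← intCast_dotProduct_eq hx (fun i => rfl), ZMod.intCast_zmod_eq_zero_iff_dvd] at h4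
    apply hzx
    rw [dotProduct_smul, dotProduct_comm, smul_eq_mul]
    push_cast
    rw [pow_succ]
    exact mul_dvd_mul_left _ h4

theorem finrank_le_two_mul_of_dual_le {K ι : Type*} [Field K] [Fintype ι] [DecidableEq ι]
    (U : Submodule K (ι → K)) (hU : ∀ u, (∀ v ∈ U, u ⬝ᵥ v = 0) → u ∈ U) :
    Fintype.card ι ≤ 2 * Module.finrank K U := by
  have hB : (Matrix.toBilin' (1 : Matrix ι ι K)).Nondegenerate :=
    LinearMap.BilinForm.nondegenerate_toBilin'_of_det_ne_zero' _ (by simp)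
  have h := LinearMap.BilinForm.finrank_orthogonal hB U
  have hle : (Matrix.toBilin' (1 : Matrix ι ι K)).orthogonal U ≤ U := by
    intro u hu
    refine hU u fun v hv => ?_
    have h1 := hu v hv
    change Matrix.toBilin' 1 v u = 0 at h1
    rw [Matrix.toBilin'_apply', one_mulVec] at h1
    rw [dotProduct_comm, h1]
  have h2 := Submodule.finrank_mono hle
  rw [h, Module.finrank_fintype_fun_eq_card] at h2
  omega

theorem isSquare_neg_one_of_incidence {α β : Type*} [Fintype α] [DecidableEq α] [Fintype β]
    (N : Matrix α β ℤ) {p f m : ℕ} [Fact p.Prime] {a κ r lam : ℤ}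
    (ha : IsCoprime (p : ℤ) a) (hκ : IsCoprime (p : ℤ) κ) (hr : IsCoprime (p : ℤ) r)
    (hcol : Nᵀ *ᵥ 1 = fun _ => κ) (hrow : N *ᵥ 1 = fun _ => r)
    (hNN : N * Nᵀ = (a * (p : ℤ) ^ (2 * f + 1)) • (1 : Matrix α α ℤ)
      + lam • Matrix.of (fun _ _ => 1))
    (hgram : ∀ i j, (p : ℤ) ^ (2 * f + 1) ∣ (Nᵀ * N) i j - 1)
    (hm : Odd m) (hα : Fintype.card α = 2 * m + 1) (hα1 : (Fintype.card α : ZMod p) = 1) :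
    IsSquare (-1 : ZMod p) := by
  have hp : p.Prime := Fact.out
  have hdual := finrank_le_two_mul_of_dual_le (columnCode N p f)
    fun u hu => mem_columnCode_of_dual N hp ha hr hrow hNN hu
  let φ : (α → ZMod p) →ₗ[ZMod p] ZMod p := dotProductBilin (ZMod p) (ZMod p) 1
  let ψ := φ.domRestrict (columnCode N p f)
  have hker : m ≤ Module.finrank (ZMod p) (LinearMap.ker ψ) := by
    have h1 := ψ.finrank_range_add_finrank_ker
    have h2 := Submodule.finrank_le (LinearMap.range ψ)
    rw [Module.finrank_self] at h2
    omega
  have hone : (1 : α → ZMod p) ⬝ᵥ 1 = 1 := by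
    rw [dotProduct_one]
    simpa using hα1
  refine isSquare_neg_one_of_isotropic hm hα 1 hone
    ((LinearMap.ker ψ).map (columnCode N p f).subtype) ?_ ?_ ?_
  · rintro _ ⟨u, hu, rfl⟩
    exact hu
  · rintro _ ⟨u, hu, rfl⟩ _ ⟨v, -, rfl⟩
    exact columnCode_isotropic N hp.ne_zero hκ hcol hgram u.2 v.2 hu
  · rwa [Submodule.finrank_map_subtype_eq]

theorem transpose_mulVec_one_of_delsarte {α β : Type*} [Fintype α] [DecidableEq α] [Fintype β]
    (N : Matrix α β ℤ) (t : ℤ)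
    (hα : (Fintype.card α : ℤ) = 4 * t ^ 2 + 2 * t + 1)
    (hβ : (Fintype.card β : ℤ) = (2 * t + 1) * (4 * t ^ 2 + 2 * t + 1))
    (hrow : N *ᵥ 1 = fun _ => (2 * t + 1) * (2 * t ^ 2 + 2 * t + 1))
    (hNN : N * Nᵀ = (t * (2 * t ^ 2 + 2 * t + 1)) • (1 : Matrix α α ℤ)
      + ((t + 1) * (2 * t ^ 2 + 2 * t + 1)) • Matrix.of (fun _ _ => 1)) :
    Nᵀ *ᵥ 1 = fun _ => 2 * t ^ 2 + 2 * t + 1 := by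
  have h1 : (Nᵀ *ᵥ 1) ⬝ᵥ (Nᵀ *ᵥ 1) = (4 * t ^ 2 + 2 * t + 1) *
      (t * (2 * t ^ 2 + 2 * t + 1)
        + (t + 1) * (2 * t ^ 2 + 2 * t + 1) * (4 * t ^ 2 + 2 * t + 1)) := by
    rw [dotProduct_mulVec, vecMul_transpose, mulVec_mulVec, hNN, add_mulVec, smul_mulVec,
      one_mulVec, smul_mulVec, dotProduct_one]
    simp [mulVec, dotProduct, hα]
  have h2 : (1 : β → ℤ) ⬝ᵥ (Nᵀ *ᵥ 1) =
      (4 * t ^ 2 + 2 * t + 1) * ((2 * t + 1) * (2 * t ^ 2 + 2 * t + 1)) := by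
    rw [dotProduct_mulVec, vecMul_transpose, hrow, dotProduct_one]
    simp [hα]
  have h3 : ∑ j, ((Nᵀ *ᵥ 1) j - (2 * t ^ 2 + 2 * t + 1)) ^ 2 = 0 := by
    have h4 : ∀ j, ((Nᵀ *ᵥ 1) j - (2 * t ^ 2 + 2 * t + 1)) ^ 2 = (Nᵀ *ᵥ 1) j * (Nᵀ *ᵥ 1) j
        - 2 * (2 * t ^ 2 + 2 * t + 1) * (1 * (Nᵀ *ᵥ 1) j) + (2 * t ^ 2 + 2 * t + 1) ^ 2 :=
      fun j => by ring
    simp_rw [h4]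
    rw [Finset.sum_add_distrib, Finset.sum_sub_distrib, ← Finset.mul_sum, Finset.sum_const,
      Finset.card_univ, nsmul_eq_mul, hβ]
    change (Nᵀ *ᵥ 1) ⬝ᵥ (Nᵀ *ᵥ 1) - _ * ((1 : β → ℤ) ⬝ᵥ (Nᵀ *ᵥ 1)) + _ = 0
    rw [h1, h2]
    ring
  rw [Finset.sum_eq_zero_iff_of_nonneg fun _ _ => sq_nonneg _] at h3
  ext j
  have h5 := pow_eq_zero_iff (two_ne_zero) |>.1 (h3 j (Finset.mem_univ j))
  linarith

theorem transpose_mul_self_of_delsarte {α β : Type*} [Fintype α] [DecidableEq α] [Fintype β]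
    [DecidableEq β] (N : Matrix α β ℤ) (B : Matrix β β ℤ) (t : ℤ)
    (hα : (Fintype.card α : ℤ) = 4 * t ^ 2 + 2 * t + 1)
    (hβ : (Fintype.card β : ℤ) = (2 * t + 1) * (4 * t ^ 2 + 2 * t + 1))
    (hrow : N *ᵥ 1 = fun _ => (2 * t + 1) * (2 * t ^ 2 + 2 * t + 1))
    (hdeg : Nᵀ *ᵥ 1 + B *ᵥ 1 = fun _ => (2 * t + 1) * (2 * t ^ 2 + 2 * t + 1))
    (hN01 : ∀ i j, N i j * N i j = N i j) (hBT : Bᵀ = B) (hB0 : ∀ i, B i i = 0)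
    (hNN : N * Nᵀ = (t * (2 * t ^ 2 + 2 * t + 1)) • (1 : Matrix α α ℤ)
      + ((t + 1) * (2 * t ^ 2 + 2 * t + 1)) • Matrix.of (fun _ _ => 1))
    (hNB : N * B = (-(2 * t ^ 2 + t + 1)) • N
      + ((t + 1) * (2 * t ^ 2 + 2 * t + 1)) • Matrix.of (fun _ _ => 1))
    (hBB : Nᵀ * N + B * B = (t * (2 * t ^ 2 + 2 * t + 1)) • (1 : Matrix β β ℤ)
      + (-(2 * t ^ 2 + t + 1)) • B
      + ((t + 1) * (2 * t ^ 2 + 2 * t + 1)) • Matrix.of (fun _ _ => 1)) :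
    Nᵀ * N = t ^ 2 • (1 : Matrix β β ℤ) - t • B + (t + 1) ^ 2 • Matrix.of (fun _ _ => 1) := by
  have hcol := transpose_mulVec_one_of_delsarte N t hα hβ hrow hNN
  set J : Matrix β β ℤ := Matrix.of (fun _ _ => 1) with hJ
  set X : Matrix β β ℤ := Nᵀ * N with hX
  have hXT : Xᵀ = X := by rw [hX, transpose_mul, transpose_transpose]
  have hJT : Jᵀ = J := rfl
  have hcol' : ∀ j, ∑ i, N i j = 2 * t ^ 2 + 2 * t + 1 := by
    intro j
    have h := congrFun hcol j
    simpa [mulVec, dotProduct] using h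
  have hrow' : ∀ i, ∑ j, N i j = (2 * t + 1) * (2 * t ^ 2 + 2 * t + 1) := by
    intro i
    have h := congrFun hrow i
    simpa [mulVec, dotProduct] using h
  have hBrow : ∀ i, ∑ j, B i j = 2 * t * (2 * t ^ 2 + 2 * t + 1) := by
    intro i
    rw [hcol] at hdeg
    have h := congrFun hdeg i
    simp [mulVec, dotProduct] at h
    linarith
  have hNJ : Nᵀ * (Matrix.of (fun _ _ => 1) : Matrix α β ℤ) = (2 * t ^ 2 + 2 * t + 1) • J := by
    ext i j
    simp [mul_apply, hJ, hcol']
  have hNJN : Nᵀ * (Matrix.of (fun _ _ => 1) : Matrix α α ℤ) * N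
      = (2 * t ^ 2 + 2 * t + 1) ^ 2 • J := by
    ext i j
    simp [mul_apply, hJ, hcol', ← Finset.mul_sum]
    ring
  have hXX : X * X = (t * (2 * t ^ 2 + 2 * t + 1)) • X
      + ((t + 1) * (2 * t ^ 2 + 2 * t + 1) * (2 * t ^ 2 + 2 * t + 1) ^ 2) • J := by
    have h : X * X = Nᵀ * (N * Nᵀ) * N := by simp only [hX, Matrix.mul_assoc]
    rw [h, hNN, Matrix.mul_add, Matrix.add_mul, Matrix.mul_smul, Matrix.mul_smul, Matrix.smul_mul,
      Matrix.smul_mul, hNJN, Matrix.mul_one, smul_smul]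
  have hXB : X * B = (-(2 * t ^ 2 + t + 1)) • X
      + ((t + 1) * (2 * t ^ 2 + 2 * t + 1) * (2 * t ^ 2 + 2 * t + 1)) • J := by
    rw [hX, Matrix.mul_assoc, hNB, Matrix.mul_add, Matrix.mul_smul, Matrix.mul_smul, hNJ, smul_smul]
  have hBX : B * X = (-(2 * t ^ 2 + t + 1)) • X
      + ((t + 1) * (2 * t ^ 2 + 2 * t + 1) * (2 * t ^ 2 + 2 * t + 1)) • J := by
    have h := congrArg transpose hXB
    rwa [transpose_mul, transpose_add, transpose_smul, transpose_smul, hXT, hBT, hJT] at h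
  have hBB' : B * B = (t * (2 * t ^ 2 + 2 * t + 1)) • (1 : Matrix β β ℤ)
      + (-(2 * t ^ 2 + t + 1)) • B + ((t + 1) * (2 * t ^ 2 + 2 * t + 1)) • J - X := by
    rw [← hBB]; abel
  have hBJ : B * J = (2 * t * (2 * t ^ 2 + 2 * t + 1)) • J := by
    ext i j
    simp [mul_apply, hJ, hBrow]
  have hJB : J * B = (2 * t * (2 * t ^ 2 + 2 * t + 1)) • J := by
    have h := congrArg transpose hBJ
    rwa [transpose_mul, transpose_smul, hBT, hJT] at h
  have hNJ' : N * J = ((2 * t + 1) * (2 * t ^ 2 + 2 * t + 1)) • Matrix.of (fun _ _ => 1) := by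
    ext i j
    simp [mul_apply, hJ, hrow']
  have hXJ : X * J = ((2 * t + 1) * (2 * t ^ 2 + 2 * t + 1) * (2 * t ^ 2 + 2 * t + 1)) • J := by
    rw [hX, Matrix.mul_assoc, hNJ', Matrix.mul_smul, hNJ, smul_smul]
  have hJX : J * X = ((2 * t + 1) * (2 * t ^ 2 + 2 * t + 1) * (2 * t ^ 2 + 2 * t + 1)) • J := by
    have h := congrArg transpose hXJ
    rwa [transpose_mul, transpose_smul, hXT, hJT] at h
  have hJJ : J * J = ((2 * t + 1) * (4 * t ^ 2 + 2 * t + 1)) • J := by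
    ext i j
    simp [mul_apply, hJ, hβ]
  set Z : Matrix β β ℤ := X - t ^ 2 • (1 : Matrix β β ℤ) + t • B - (t + 1) ^ 2 • J with hZ
  have hZZ : Z * Z = (-(t * (2 * t + 1) * (t + 1))) • Z := by
    rw [hZ]
    simp only [Matrix.mul_add, Matrix.add_mul, Matrix.mul_sub, Matrix.sub_mul, Matrix.mul_smul,
      Matrix.smul_mul, Matrix.mul_one, Matrix.one_mul, hXX, hXB, hBX, hBB', hBJ, hJB, hXJ, hJX, hJJ]
    module
  have hZT : Zᵀ = Z := by
    simp only [hZ, transpose_sub, transpose_add, transpose_smul, hXT, hBT, hJT, transpose_one]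
  have hZdiag : ∀ i, Z i i = 0 := by
    intro i
    have h : X i i = 2 * t ^ 2 + 2 * t + 1 := by
      rw [hX, mul_apply, ← hcol' i]
      exact Finset.sum_congr rfl fun j _ => hN01 j i
    simp only [hZ, hJ, Matrix.add_apply, Matrix.sub_apply, Matrix.smul_apply, one_apply_eq, of_apply,
      h, hB0, smul_eq_mul]
    ring
  have hZ0 : Z = 0 := by
    rw [← trace_conjTranspose_mul_self_eq_zero_iff, conjTranspose_eq_transpose_of_trivial, hZT, hZZ,
      trace_smul]
    simp [trace, hZdiag]
  rw [hZ] at hZ0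
  rw [← sub_eq_zero, ← hZ0]
  abel

theorem adjMatrix_sq_of_isSRGWith {V : Type*} [Fintype V] [DecidableEq V] (G : SimpleGraph V)
    [DecidableRel G.Adj] {n k l m : ℕ} (hG : G.IsSRGWith n k l m) :
    G.adjMatrix ℤ * G.adjMatrix ℤ = ((k : ℤ) - m) • (1 : Matrix V V ℤ)
      + ((l : ℤ) - m) • G.adjMatrix ℤ + (m : ℤ) • Matrix.of (fun _ _ => 1) := by
  rw [← sq, hG.matrix_eq]
  ext i j
  simp only [Matrix.add_apply, Matrix.smul_apply, SimpleGraph.adjMatrix_apply,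
    SimpleGraph.compl_adj, Matrix.one_apply, of_apply, smul_eq_mul]
  by_cases hij : i = j
  · subst hij; simp
  · by_cases h : G.Adj i j <;> simp [hij, h]

theorem taylor_graph_no_delsarte_coclique_of_special_form {V : Type*} [Fintype V] [DecidableEq V]
    (G : SimpleGraph V) [DecidableRel G.Adj] (q p e ℓ k l m : ℕ) (hp : p.Prime) (hpmod : p % 4 = 3)
    (he : Odd e) (hepos : 0 < e) (hℓodd : Odd ℓ) (hℓpos : 0 < ℓ)
    (hcop : Nat.Coprime ℓ p) (hqdef : q = 2 * ℓ * p ^ e + 1)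
    (hk : 2 * k = q * (q ^ 2 + 1)) (hl : 4 * l = (q - 1) * (q ^ 2 + 3))
    (hm : 4 * m = (q + 1) * (q ^ 2 + 1))
    (hsrg : G.IsSRGWith ((q + 1) * (q ^ 2 - q + 1)) k l m) :
    ¬ ∃ Y : Finset V, IsCoclique G Y ∧ Y.card = q ^ 2 - q + 1 := by
  rintro ⟨Y, hY, hYcard⟩
  have : Fact p.Prime := ⟨hp⟩
  obtain ⟨f, rfl⟩ := he
  obtain ⟨t, ht⟩ : ∃ t, t = ℓ * p ^ (2 * f + 1) := ⟨_, rfl⟩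
  have hpodd : Odd p := Nat.odd_iff.2 (by omega)
  have htodd : Odd t := by rw [ht]; exact hℓodd.mul hpodd.pow
  have hq : q = 2 * t + 1 := by rw [hqdef, ht]; ring
  clear hqdef
  subst hq
  have hv : (2 * t + 1) ^ 2 - (2 * t + 1) + 1 = 4 * t ^ 2 + 2 * t + 1 := by
    have h : (2 * t + 1) ^ 2 = (4 * t ^ 2 + 2 * t) + (2 * t + 1) := by ring
    rw [h, Nat.add_sub_cancel]
  rw [hv] at hYcard hsrg
  rw [Nat.add_sub_cancel] at hl
  have hk' : (k : ℤ) = (2 * t + 1) * (2 * t ^ 2 + 2 * t + 1) := by zify at hk; linarith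
  have hl' : (l : ℤ) = 2 * t * (t ^ 2 + t + 1) := by zify at hl; linarith
  have hm' : (m : ℤ) = (t + 1) * (2 * t ^ 2 + 2 * t + 1) := by zify at hm; linarith
  have hA := adjMatrix_sq_of_isSRGWith G hsrg
  rw [show (k : ℤ) - m = t * (2 * t ^ 2 + 2 * t + 1) by rw [hk', hm']; ring,
    show (l : ℤ) - m = -(2 * t ^ 2 + t + 1) by rw [hl', hm']; ring, hm'] at hA
  set A := G.adjMatrix ℤ with hAdef
  obtain ⟨P, hPY⟩ : ∃ P : V → Prop, ∀ x, P x ↔ x ∈ Y := ⟨fun x => x ∈ Y, fun x => Iff.rfl⟩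
  have : DecidablePred P := Classical.decPred P
  let N : Matrix {x // P x} {x // ¬ P x} ℤ := A.toBlock P (fun x => ¬ P x)
  let B : Matrix {x // ¬ P x} {x // ¬ P x} ℤ := A.toBlock (fun x => ¬ P x) (fun x => ¬ P x)
  have hP0 : A.toBlock P P = 0 := by
    ext i j
    simp [hAdef, hY i ((hPY i).1 i.2) j ((hPY j).1 j.2)]
  have hNT : A.toBlock (fun x => ¬ P x) P = Nᵀ := by
    ext i j
    simp [N, hAdef, G.adj_comm]
  have hBT : Bᵀ = B := by
    ext i j
    simp [B, hAdef, G.adj_comm]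
  have hB0 : ∀ i, B i i = 0 := by
    intro i
    simp [B, hAdef]
  have hN01 : ∀ i j, N i j * N i j = N i j := by
    intro i j
    simp [N, hAdef]
  have hNN : N * Nᵀ = ((t : ℤ) * (2 * t ^ 2 + 2 * t + 1)) • (1 : Matrix {x // P x} {x // P x} ℤ)
      + (((t : ℤ) + 1) * (2 * t ^ 2 + 2 * t + 1)) • Matrix.of (fun _ _ => 1) := by
    have h := toBlock_mul_eq_add P P P A A
    rw [hP0, hNT, Matrix.zero_mul, zero_add] at h
    change _ = N * Nᵀ at h
    rw [← h, hA]
    ext i j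
    have h0 : A i j = 0 := congrFun (congrFun hP0 i) j
    simp only [toBlock_apply, Matrix.add_apply, Matrix.smul_apply, Matrix.one_apply, of_apply,
      smul_eq_mul, h0, Subtype.ext_iff]
    ring
  have hNB : N * B = (-(2 * (t : ℤ) ^ 2 + t + 1)) • N
      + (((t : ℤ) + 1) * (2 * t ^ 2 + 2 * t + 1)) • Matrix.of (fun _ _ => 1) := by
    have h := toBlock_mul_eq_add P P (fun x => ¬ P x) A A
    rw [hP0, Matrix.zero_mul, zero_add] at h
    change _ = N * B at h
    rw [← h, hA]
    ext i j
    have h0 : (i : V) ≠ j := fun h => j.2 (h ▸ i.2)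
    simp only [N, toBlock_apply, Matrix.add_apply, Matrix.smul_apply, Matrix.one_apply_ne h0,
      of_apply, smul_eq_mul]
    ring
  have hBB : Nᵀ * N + B * B
      = ((t : ℤ) * (2 * t ^ 2 + 2 * t + 1)) • (1 : Matrix {x // ¬ P x} {x // ¬ P x} ℤ)
      + (-(2 * (t : ℤ) ^ 2 + t + 1)) • B
      + (((t : ℤ) + 1) * (2 * t ^ 2 + 2 * t + 1)) • Matrix.of (fun _ _ => 1) := by
    have h := toBlock_mul_eq_add (fun x => ¬ P x) P (fun x => ¬ P x) A A
    rw [hNT] at h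
    change _ = Nᵀ * N + B * B at h
    rw [← h, hA]
    ext i j
    simp only [B, toBlock_apply, Matrix.add_apply, Matrix.smul_apply, Matrix.one_apply, of_apply,
      smul_eq_mul, Subtype.ext_iff]
  have hsum : ∀ x, ∑ y, A x y = (2 * t + 1) * (2 * t ^ 2 + 2 * t + 1) := by
    intro x
    rw [← hk', ← hsrg.regular x]
    simp [hAdef, SimpleGraph.adjMatrix_apply, ← SimpleGraph.card_neighborFinset_eq_degree,
      SimpleGraph.neighborFinset_eq_filter]
  have hrow : N *ᵥ 1 = fun _ => (2 * (t : ℤ) + 1) * (2 * t ^ 2 + 2 * t + 1) := by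
    ext i
    rw [← hsum i, ← Fintype.sum_subtype_add_sum_subtype P]
    have h0 : ∀ j : {x // P x}, A i j = 0 := fun j => congrFun (congrFun hP0 i) j
    simp [mulVec, dotProduct, N, h0]
  have hdeg : Nᵀ *ᵥ 1 + B *ᵥ 1 = fun _ => (2 * (t : ℤ) + 1) * (2 * t ^ 2 + 2 * t + 1) := by
    ext i
    rw [← hsum i, ← Fintype.sum_subtype_add_sum_subtype P, ← hNT]
    simp [mulVec, dotProduct, B]
  have hα : Fintype.card {x // P x} = 4 * t ^ 2 + 2 * t + 1 := by
    rw [← hYcard]; exact Fintype.card_of_subtype Y fun x => (hPY x).symm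
  have hβ : Fintype.card {x // ¬ P x} = (2 * t + 1) * (4 * t ^ 2 + 2 * t + 1) := by
    rw [Fintype.card_subtype_compl, hα, hsrg.card]
    refine Nat.sub_eq_of_eq_add ?_
    ring
  have hα' : (Fintype.card {x // P x} : ℤ) = 4 * t ^ 2 + 2 * t + 1 := by rw [hα]; push_cast; ring
  have hβ' : (Fintype.card {x // ¬ P x} : ℤ) = (2 * t + 1) * (4 * t ^ 2 + 2 * t + 1) := by
    rw [hβ]; push_cast; ring
  have hcol := transpose_mulVec_one_of_delsarte N t hα' hβ' hrow hNN
  have hgram := transpose_mul_self_of_delsarte N B t hα' hβ' hrow hdeg hN01 hBT hB0 hNN hNB hBB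
  have htp : (t : ℤ) = ℓ * (p : ℤ) ^ (2 * f + 1) := by rw [ht]; push_cast; ring
  have hpt : (p : ℤ) ∣ t := by rw [htp, pow_succ]; exact ⟨ℓ * (p : ℤ) ^ (2 * f), by ring⟩
  have hcoprime : ∀ a : ℤ, IsCoprime (p : ℤ) (t * a + 1) := by
    intro a
    obtain ⟨s, hs⟩ := hpt
    exact ⟨-(s * a), 1, by rw [hs]; ring⟩
  have hκ : IsCoprime (p : ℤ) (2 * t ^ 2 + 2 * t + 1) := by
    convert hcoprime (2 * t + 2) using 1; ring
  have hr : IsCoprime (p : ℤ) ((2 * t + 1) * (2 * t ^ 2 + 2 * t + 1)) := by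
    convert (hcoprime 2).mul_right hκ using 1; ring
  have hℓ : IsCoprime (p : ℤ) ℓ := (Nat.isCoprime_iff_coprime.2 hcop).symm
  have hsq : IsSquare (-1 : ZMod p) := by
    refine isSquare_neg_one_of_incidence (f := f) (m := 2 * t ^ 2 + t)
      (lam := (t + 1) * (2 * t ^ 2 + 2 * t + 1)) N (hℓ.mul_right hκ) hκ hr
      hcol hrow ?_ ?_ ?_ ?_ ?_
    · rwa [mul_right_comm, ← htp]
    · intro i j
      rw [hgram]
      refine dvd_trans (Dvd.intro_left (ℓ : ℤ) htp.symm)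
        ⟨t * (1 : Matrix {x // ¬ P x} {x // ¬ P x} ℤ) i j - B i j + t + 2, ?_⟩
      simp only [Matrix.add_apply, Matrix.sub_apply, Matrix.smul_apply, of_apply, smul_eq_mul]
      ring
    · exact (even_two_mul _).add_odd htodd
    · rw [hα]; ring
    · have h0 : ((t : ℤ) : ZMod p) = 0 := (ZMod.intCast_zmod_eq_zero_iff_dvd _ _).2 hpt
      have h1 : (t : ZMod p) = 0 := by exact_mod_cast h0
      rw [hα]
      push_cast
      rw [h1]
      ring
  exact ZMod.exists_sq_eq_neg_one_iff.1 hsq hpmod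
end
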